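/- Let k be a totally real number field of degree d ≥ 5 over ℚ. Then the absolute value D_k of the discriminant of k satisfies D_k^{1/d} ≥ 14641^{1/5}; equivalently, D_k^5 ≥ 14641^d. -/

import Mathlib

section
namespace TR
open Finset Matrix

lemma summ_gauss1 {c : ℝ} (hc : 0 < c) : Summable (fun k : ℤ => Real.exp (-c * (k:ℝ)^2)) := by
  have h : Summable (fun k : ℕ => Real.exp (-c * (k:ℝ)^2)) := by
    refine Summable.of_nonneg_of_le (fun _ => (Real.exp_pos _).le) (fun k => ?_)
      ((Real.summable_exp_nat_mul_iff (a := -c)).2 (by linarith))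
    apply Real.exp_le_exp.2
    rcases Nat.eq_zero_or_pos k with h | h
    · simp [h]
    · have : (1:ℝ) ≤ k := by exact_mod_cast h
      nlinarith [mul_nonneg hc.le (mul_nonneg (by linarith : (0:ℝ) ≤ k) (by linarith : (0:ℝ) ≤ k - 1))]
  exact Summable.of_nat_of_neg (by simpa using h) (by simpa using h)

lemma summ_gauss {c : ℝ} (hc : 0 < c) (n : ℕ) :
    Summable (fun k : Fin n → ℤ => Real.exp (-c * ∑ i, (k i:ℝ)^2)) := by
  induction n with
  | zero => exact Summable.of_finite
  | succ n ih =>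
    rw [← (Fin.consEquiv (fun _ : Fin (n+1) => ℤ)).summable_iff]
    have := (summ_gauss1 hc).mul_of_nonneg ih (fun _ => (Real.exp_pos _).le)
      (fun _ => (Real.exp_pos _).le)
    refine this.congr (fun p => ?_)
    simp only [Function.comp, Fin.consEquiv_apply, Fin.sum_univ_succ, Fin.cons_zero, Fin.cons_succ]
    rw [← Real.exp_add]; congr 1; ring

variable {n : ℕ}

/-- The quadratic form `|A x|^2`. -/
def qf (A : Matrix (Fin n) (Fin n) ℝ) (x : Fin n → ℝ) : ℝ := ∑ a, (A.mulVec x a)^2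

lemma qf_nonneg (A : Matrix (Fin n) (Fin n) ℝ) (x : Fin n → ℝ) : 0 ≤ qf A x :=
  Finset.sum_nonneg (fun _ _ => sq_nonneg _)

/-- Integer vectors as real vectors. -/
def ev (k : Fin n → ℤ) : Fin n → ℝ := fun i => (k i : ℝ)

lemma coercive {A : Matrix (Fin n) (Fin n) ℝ} (hA : A.det ≠ 0) :
    ∃ c > 0, ∀ x : Fin n → ℝ, c * ∑ i, (x i)^2 ≤ qf A x := by
  set K : ℝ := ∑ i, ∑ a, (A⁻¹ i a)^2 with hK
  have hK0 : 0 ≤ K := Finset.sum_nonneg (fun _ _ => Finset.sum_nonneg (fun _ _ => sq_nonneg _))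
  refine ⟨(K+1)⁻¹, by positivity, fun x => ?_⟩
  have hx : x = A⁻¹.mulVec (A.mulVec x) := by
    rw [Matrix.mulVec_mulVec, Matrix.nonsing_inv_mul _ (Ne.isUnit hA), Matrix.one_mulVec]
  have h1 : ∑ i, (x i)^2 ≤ K * qf A x := by
    rw [hK, Finset.sum_mul]
    refine Finset.sum_le_sum (fun i _ => ?_)
    conv_lhs => rw [hx]
    exact Finset.sum_mul_sq_le_sq_mul_sq Finset.univ (fun a => A⁻¹ i a) (A.mulVec x)
  rw [inv_mul_le_iff₀ (by positivity)]
  nlinarith [qf_nonneg A x]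

lemma summ_qf {A : Matrix (Fin n) (Fin n) ℝ} (hA : A.det ≠ 0) {t : ℝ} (ht : 0 < t) :
    Summable (fun k : Fin n → ℤ => Real.exp (-t * qf A (ev k))) := by
  obtain ⟨c, hc, h⟩ := coercive hA
  refine Summable.of_nonneg_of_le (fun _ => (Real.exp_pos _).le) (fun k => ?_)
    (summ_gauss (mul_pos ht hc) n)
  apply Real.exp_le_exp.2
  have := h (ev k)
  simp only [ev] at this ⊢
  nlinarith [mul_le_mul_of_nonneg_left this ht.le]

/-- The Gaussian attached to `A`. -/
noncomputable def gA (A : Matrix (Fin n) (Fin n) ℝ) (x : Fin n → ℝ) : ℂ :=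
  Complex.exp (-(Real.pi * qf A x : ℝ))

lemma norm_gA (A : Matrix (Fin n) (Fin n) ℝ) (x : Fin n → ℝ) :
    ‖gA A x‖ = Real.exp (-(Real.pi * qf A x)) := by
  rw [gA, ← Complex.ofReal_neg, ← Complex.ofReal_exp, Complex.norm_real, Real.norm_eq_abs,
    abs_of_pos (Real.exp_pos _)]

lemma continuous_qf (A : Matrix (Fin n) (Fin n) ℝ) : Continuous (qf A) := by
  unfold qf Matrix.mulVec dotProduct
  fun_prop

lemma continuous_gA (A : Matrix (Fin n) (Fin n) ℝ) : Continuous (gA A) := by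
  unfold gA
  have := continuous_qf A
  fun_prop

lemma gA_bound {A : Matrix (Fin n) (Fin n) ℝ} (hA : A.det ≠ 0) (R : ℝ) :
    ∃ u : (Fin n → ℤ) → ℝ, Summable u ∧ ∀ k, ∀ x : Fin n → ℝ, (∀ i, |x i| ≤ R) →
      ‖gA A (x + ev k)‖ ≤ u k := by
  obtain ⟨c, hc, h⟩ := coercive hA
  refine ⟨fun k => Real.exp (Real.pi * c * n * R^2) * Real.exp (-(Real.pi * c / 2) * ∑ i, (k i:ℝ)^2),
    (summ_gauss (by positivity) n).mul_left _, fun k x hx => ?_⟩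
  rw [norm_gA]
  beta_reduce
  rw [← Real.exp_add]
  apply Real.exp_le_exp.2
  have h1 := h (x + ev k)
  have h2 : (1/2) * ∑ i, (k i:ℝ)^2 - n * R^2 ≤ ∑ i, ((x + ev k) i)^2 := by
    have : (n:ℝ) * R^2 = ∑ i : Fin n, R^2 := by simp
    rw [this, Finset.mul_sum, ← Finset.sum_sub_distrib]
    refine Finset.sum_le_sum (fun i _ => ?_)
    simp only [Pi.add_apply, ev]
    have : (x i)^2 ≤ R^2 := sq_le_sq.2 ((hx i).trans (le_abs_self R))
    nlinarith [sq_nonneg (2 * x i + k i)]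
  have hp : 0 < Real.pi * c := mul_pos Real.pi_pos hc
  have h3 := mul_le_mul_of_nonneg_left h2 hp.le
  have h4 := mul_le_mul_of_nonneg_left h1 Real.pi_pos.le
  nlinarith

/-- periodization -/
noncomputable def per (A : Matrix (Fin n) (Fin n) ℝ) (x : Fin n → ℝ) : ℂ :=
  ∑' k : Fin n → ℤ, gA A (x + ev k)

lemma continuous_per {A : Matrix (Fin n) (Fin n) ℝ} (hA : A.det ≠ 0) : Continuous (per A) := by
  rw [continuous_iff_continuousAt]
  intro x
  obtain ⟨u, hu, hb⟩ := gA_bound hA (‖x‖ + 1)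
  have : ContinuousOn (per A) (Metric.closedBall x 1) := by
    refine continuousOn_tsum (fun k => ?_) hu (fun k y hy => hb k y (fun i => ?_))
    · exact ((continuous_gA A).comp (continuous_id.add continuous_const)).continuousOn
    · have h1 : ‖y‖ ≤ ‖x‖ + 1 := by
        have := mem_closedBall_iff_norm.1 hy
        calc ‖y‖ = ‖x + (y - x)‖ := by congr 1; abel
          _ ≤ _ := (norm_add_le _ _).trans (by linarith)
      exact (norm_le_pi_norm y i).trans h1
  exact this.continuousAt (Metric.closedBall_mem_nhds x one_pos)

lemma per_add (A : Matrix (Fin n) (Fin n) ℝ) (x : Fin n → ℝ) (k : Fin n → ℤ) :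
    per A (x + ev k) = per A x := by
  unfold per
  rw [← (Equiv.addLeft k).tsum_eq (fun l => gA A (x + ev l))]
  refine tsum_congr (fun l => ?_)
  congr 1
  ext i; simp [ev]; ring

/-- projection to the torus -/
def prT : (Fin n → ℝ) → UnitAddTorus (Fin n) := Pi.map (fun _ => (QuotientAddGroup.mk : ℝ → UnitAddCircle))

lemma prT_quot : IsOpenQuotientMap (prT (n := n)) :=
  IsOpenQuotientMap.piMap (fun _ => QuotientAddGroup.isOpenQuotientMap_mk)

lemma per_factors (A : Matrix (Fin n) (Fin n) ℝ) {x y : Fin n → ℝ} (h : prT x = prT y) :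
    per A x = per A y := by
  have : ∀ i, ∃ m : ℤ, y i + m = x i := fun i => by
    have hi : ((x i : ℝ) : UnitAddCircle) = (y i : ℝ) := congrFun h i
    have h0 : ((x i - y i : ℝ) : UnitAddCircle) = 0 := by
      rw [AddCircle.coe_sub, hi, sub_self]
    obtain ⟨m, hm⟩ := (AddCircle.coe_eq_zero_iff (1:ℝ)).1 h0
    refine ⟨m, ?_⟩
    simp at hm
    linarith
  choose k hk using this
  have : x = y + ev k := by ext i; simp [ev, hk i]
  rw [this, per_add]


/-- bundled projection -/
def prC : C(Fin n → ℝ, UnitAddTorus (Fin n)) := ⟨prT, prT_quot.continuous⟩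

/-- periodization on the torus -/
noncomputable def perT {A : Matrix (Fin n) (Fin n) ℝ} (hA : A.det ≠ 0) :
    C(UnitAddTorus (Fin n), ℂ) :=
  Topology.IsQuotientMap.lift (f := prC) (prT_quot (n := n)).isQuotientMap
    (⟨per A, continuous_per hA⟩ : C(Fin n → ℝ, ℂ))
    (fun _ _ h => per_factors A h)

lemma perT_apply {A : Matrix (Fin n) (Fin n) ℝ} (hA : A.det ≠ 0) (x : Fin n → ℝ) :
    perT hA (fun i => (x i : UnitAddCircle)) = per A x :=
  DFunLike.congr_fun (Topology.IsQuotientMap.lift_comp (f := prC) (prT_quot (n := n)).isQuotientMap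
    (⟨per A, continuous_per hA⟩ : C(Fin n → ℝ, ℂ))
    (fun _ _ h => per_factors A h)) x

/-- the character -/
noncomputable def chr (l : Fin n → ℤ) (x : Fin n → ℝ) : ℂ :=
  Complex.exp (-(2 * Real.pi * (∑ i, (l i:ℝ) * x i) : ℝ) * Complex.I)

lemma norm_chr (l : Fin n → ℤ) (x : Fin n → ℝ) : ‖chr l x‖ = 1 := by
  rw [chr, ← Complex.ofReal_neg]
  exact Complex.norm_exp_ofReal_mul_I _

lemma continuous_chr (l : Fin n → ℤ) : Continuous (chr l) := by
  unfold chr; fun_prop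

lemma chr_add (l : Fin n → ℤ) (x : Fin n → ℝ) (k : Fin n → ℤ) : chr l (x + ev k) = chr l x := by
  unfold chr
  have h : ∑ i, (l i:ℝ) * (x + ev k) i = ∑ i, (l i:ℝ) * x i + ((∑ i, l i * k i : ℤ) : ℝ) := by
    push_cast
    rw [← Finset.sum_add_distrib]
    refine Finset.sum_congr rfl (fun i _ => ?_)
    simp [ev]; ring
  rw [h, Complex.exp_eq_exp_iff_exists_int]
  refine ⟨-(∑ i, l i * k i : ℤ), ?_⟩
  push_cast
  ring

lemma mFourier_chr (l : Fin n → ℤ) (x : Fin n → ℝ) :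
    UnitAddTorus.mFourier (-l) (fun i => (x i : UnitAddCircle)) = chr l x := by
  simp only [UnitAddTorus.mFourier, ContinuousMap.coe_mk, fourier_coe_apply, chr]
  rw [← Complex.exp_sum]
  congr 1
  push_cast
  rw [Finset.mul_sum, ← Finset.sum_neg_distrib, Finset.sum_mul]
  refine Finset.sum_congr rfl (fun i _ => ?_)
  simp; ring

open MeasureTheory

lemma chg {A : Matrix (Fin n) (Fin n) ℝ} (hA : A.det ≠ 0) (G : (Fin n → ℝ) → ℂ)
    (hG : Continuous G) :
    ∫ x, G (A.mulVec x) = ((|A.det|⁻¹ : ℝ) : ℂ) * ∫ y, G y := by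
  have h := Real.map_matrix_volume_pi_eq_smul_volume_pi hA
  have h2 : ∫ y, G y ∂(Measure.map (⇑(Matrix.toLin' A)) volume) = ∫ x, G (A.mulVec x) := by
    rw [integral_map (LinearMap.continuous_of_finiteDimensional _).aemeasurable
      hG.aestronglyMeasurable]
    rfl
  rw [← h2, h, integral_smul_measure, abs_inv, ENNReal.toReal_ofReal (by positivity)]
  simp

lemma integrable_gA {A : Matrix (Fin n) (Fin n) ℝ} (hA : A.det ≠ 0) : Integrable (gA A) := by
  obtain ⟨c, hc, h⟩ := coercive hA
  have h1 := GaussianFourier.integrable_cexp_neg_mul_sum_add (ι := Fin n) (b := ((Real.pi * c : ℝ) : ℂ))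
    (by rw [Complex.ofReal_re]; positivity) (fun _ => 0)
  refine h1.norm.mono' (continuous_gA A).aestronglyMeasurable (Filter.Eventually.of_forall fun x => ?_)
  rw [norm_gA, Complex.norm_exp]
  apply Real.exp_le_exp.2
  have := mul_le_mul_of_nonneg_left (h x) Real.pi_pos.le
  simp only [zero_mul, Finset.sum_const_zero, add_zero]
  have e : (-((Real.pi * c : ℝ) : ℂ) * ∑ i, ((x i : ℝ) : ℂ)^2).re = -(Real.pi * c) * ∑ i, (x i)^2 := by
    rw [← Complex.ofReal_re (-(Real.pi * c) * ∑ i, (x i)^2)]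
    congr 1; push_cast; rfl
  rw [e]
  linarith

lemma ft_gA {A : Matrix (Fin n) (Fin n) ℝ} (hA : A.det ≠ 0) (l : Fin n → ℤ) :
    ∫ x, chr l x * gA A x = ((|A.det|⁻¹ : ℝ) : ℂ) * gA (A⁻¹)ᵀ (ev l) := by
  set w : Fin n → ℝ := (A⁻¹)ᵀ.mulVec (ev l) with hw
  set G : (Fin n → ℝ) → ℂ := fun y => Complex.exp (-(Real.pi : ℂ) * ∑ a, (y a : ℂ)^2 +
    ∑ a, (-(2 * Real.pi * w a : ℝ) * Complex.I : ℂ) * y a) with hG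
  have hGc : Continuous G := by rw [hG]; fun_prop
  have e : ∀ x, chr l x * gA A x = G (A.mulVec x) := fun x => by
    rw [chr, gA, ← Complex.exp_add]
    simp only [hG]
    congr 1
    have hx : x = A⁻¹.mulVec (A.mulVec x) := by
      rw [Matrix.mulVec_mulVec, Matrix.nonsing_inv_mul _ (Ne.isUnit hA), Matrix.one_mulVec]
    have : ∑ i, (l i:ℝ) * x i = ∑ a, w a * A.mulVec x a := by
      change ev l ⬝ᵥ x = w ⬝ᵥ A.mulVec x
      conv_lhs => rw [hx]
      rw [Matrix.dotProduct_mulVec, hw, Matrix.mulVec_transpose]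
    rw [this, qf, add_comm]
    congr 1
    · push_cast; ring
    · push_cast; rw [Finset.mul_sum, ← Finset.sum_neg_distrib, Finset.sum_mul]
      refine Finset.sum_congr rfl (fun i _ => ?_); ring
  simp_rw [e]
  rw [chg hA G hGc]
  congr 1
  rw [hG, GaussianFourier.integral_cexp_neg_mul_sum_add (by simpa using Real.pi_pos)]
  rw [div_self (by exact_mod_cast Real.pi_ne_zero), Complex.one_cpow, one_mul, gA, qf, ← hw]
  congr 1
  push_cast
  simp only [mul_pow, neg_sq, Complex.I_sq]
  rw [Finset.mul_sum, ← Finset.sum_neg_distrib, Finset.sum_div]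
  refine Finset.sum_congr rfl (fun i _ => ?_)
  have : (Real.pi : ℂ) ≠ 0 := by exact_mod_cast Real.pi_ne_zero
  field_simp
  ring


/-- unit box -/
def bx (k : Fin n → ℤ) : Set (Fin n → ℝ) := {x | ∀ i, x i ∈ Set.Ioc (k i : ℝ) (k i + 1)}

lemma bx_meas (k : Fin n → ℤ) : MeasurableSet (bx k) := by
  have : bx k = Set.univ.pi (fun i => Set.Ioc (k i : ℝ) (k i + 1)) := by
    ext x; simp [bx]
  rw [this]
  exact MeasurableSet.univ_pi (fun i => measurableSet_Ioc)

lemma bx_iff (k : Fin n → ℤ) (x : Fin n → ℝ) : x ∈ bx k ↔ ∀ i, ⌈x i⌉ = k i + 1 := by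
  simp only [bx, Set.mem_setOf_eq, Set.mem_Ioc]
  refine forall_congr' fun i => ?_
  rw [Int.ceil_eq_iff]; push_cast; constructor <;> rintro ⟨h1, h2⟩ <;> constructor <;> linarith

lemma bx_disj : Pairwise (Function.onFun Disjoint (bx (n := n))) := by
  intro k l hkl
  rw [Function.onFun, Set.disjoint_left]
  intro x hk hl
  apply hkl
  ext i
  have h1 := (bx_iff k x).1 hk i
  have h2 := (bx_iff l x).1 hl i
  omega

lemma bx_union : (⋃ k, bx (n := n) k) = Set.univ := by
  rw [Set.eq_univ_iff_forall]
  intro x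
  rw [Set.mem_iUnion]
  exact ⟨fun i => ⌈x i⌉ - 1, (bx_iff _ x).2 (fun i => by ring)⟩

lemma bx_shift {E : Type*} [NormedAddCommGroup E] [NormedSpace ℝ E] (f : (Fin n → ℝ) → E)
    (k : Fin n → ℤ) : ∫ x in bx k, f x = ∫ x in bx 0, f (x + ev k) := by
  rw [← integral_indicator (bx_meas _), ← integral_indicator (bx_meas _),
    ← integral_add_right_eq_self _ (ev k)]
  refine integral_congr_ae (Filter.Eventually.of_forall fun x => ?_)
  have : x + ev k ∈ bx k ↔ x ∈ bx 0 := by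
    simp only [bx, ev, Set.mem_setOf_eq, Set.mem_Ioc, Pi.add_apply, Pi.zero_apply, Int.cast_zero]
    refine forall_congr' fun i => ?_
    constructor <;> rintro ⟨h1, h2⟩ <;> constructor <;> linarith
  by_cases h : x ∈ bx 0
  · simp [Set.indicator_of_mem h, Set.indicator_of_mem (this.2 h)]
  · simp [Set.indicator_of_notMem h, Set.indicator_of_notMem (fun hh => h (this.1 hh))]

lemma coef {A : Matrix (Fin n) (Fin n) ℝ} (hA : A.det ≠ 0) (l : Fin n → ℤ) :
    UnitAddTorus.mFourierCoeff (perT hA) l = ((|A.det|⁻¹ : ℝ) : ℂ) * gA (A⁻¹)ᵀ (ev l) := by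
  rw [UnitAddTorus.mFourierCoeff_eq_integral _ _ 0, ← ft_gA hA]
  have hIntg : Integrable (fun x => chr l x * gA A x) := by
    refine (integrable_gA hA).bdd_mul (c := 1) (continuous_chr l).aestronglyMeasurable ?_
    exact Filter.Eventually.of_forall fun x => (norm_chr l x).le
  have hset : {x : Fin n → ℝ | ∀ i, x i ∈ Set.Ioc ((0 : Fin n → ℝ) i) ((0 : Fin n → ℝ) i + 1)} = bx 0 := by
    simp [bx]
  rw [hset]
  have e1 : ∫ x, chr l x * gA A x = ∑' k, ∫ x in bx k, chr l x * gA A x := by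
    rw [← integral_iUnion bx_meas bx_disj (hIntg.integrableOn), bx_union, setIntegral_univ]
  have e2 : Summable (fun k => ∫ x in bx k, ‖chr l x * gA A x‖) := by
    exact (hasSum_integral_iUnion bx_meas bx_disj hIntg.norm.integrableOn).summable
  rw [e1]
  simp_rw [bx_shift (fun x => chr l x * gA A x)]
  rw [integral_tsum_of_summable_integral_norm]
  · refine integral_congr_ae (Filter.Eventually.of_forall fun x => ?_)
    simp only [mFourier_chr, perT_apply, chr_add, smul_eq_mul, per]
    rw [tsum_mul_left]
  · intro k
    exact (hIntg.comp_add_right (ev k)).integrableOn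
  · refine e2.congr (fun k => ?_)
    rw [bx_shift]

/-- The theta identity. -/
theorem theta {A : Matrix (Fin n) (Fin n) ℝ} (hA : A.det ≠ 0) :
    ∑' k : Fin n → ℤ, Real.exp (-Real.pi * qf A (ev k)) =
      |A.det|⁻¹ * ∑' l : Fin n → ℤ, Real.exp (-Real.pi * qf (A⁻¹)ᵀ (ev l)) := by
  have hB : ((A⁻¹)ᵀ).det ≠ 0 := by
    rw [Matrix.det_transpose, Matrix.det_nonsing_inv]
    simpa using hA
  have hs : Summable (fun l : Fin n → ℤ => gA (A⁻¹)ᵀ (ev l)) := by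
    refine Summable.of_norm ((summ_qf hB Real.pi_pos).congr (fun l => ?_))
    rw [norm_gA]; congr 1; ring
  have hsum : Summable (UnitAddTorus.mFourierCoeff (perT hA)) := by
    refine (hs.mul_left ((|A.det|⁻¹ : ℝ) : ℂ)).congr (fun l => (coef hA l).symm)
  have h := (UnitAddTorus.hasSum_mFourier_series_apply_of_summable hsum
    (fun i => ((0:ℝ) : UnitAddCircle))).tsum_eq
  rw [perT_apply hA (fun _ => 0)] at h
  have h0 : ∀ l : Fin n → ℤ, UnitAddTorus.mFourier l (fun i => ((0:ℝ) : UnitAddCircle)) = 1 := by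
    intro l
    have := mFourier_chr (-l) (fun _ => (0:ℝ))
    rw [neg_neg] at this
    rw [this, chr]; simp
  simp_rw [h0, coef hA, smul_eq_mul, mul_one] at h
  rw [tsum_mul_left, per] at h
  have hg : ∀ (M : Matrix (Fin n) (Fin n) ℝ) (x : Fin n → ℝ),
      gA M x = ((Real.exp (-Real.pi * qf M x) : ℝ) : ℂ) := by
    intro M x; rw [gA]; push_cast; congr 1; ring
  have hz : ∀ k : Fin n → ℤ, (fun _ => (0:ℝ)) + ev k = ev k := by intro k; ext i; simp
  simp_rw [hg, hz] at h
  rw [← Complex.ofReal_tsum, ← Complex.ofReal_tsum, ← Complex.ofReal_mul] at h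
  exact (Complex.ofReal_injective h).symm

end TR
end

section
namespace TR
open Finset Matrix
variable {n : ℕ}

/-- `π (A k)_a ^ 2` -/
noncomputable def vv (A : Matrix (Fin n) (Fin n) ℝ) (k : Fin n → ℤ) (a : Fin n) : ℝ :=
  Real.pi * (A.mulVec (ev k) a)^2

/-- inverse transpose -/
noncomputable def dual (A : Matrix (Fin n) (Fin n) ℝ) : Matrix (Fin n) (Fin n) ℝ := (A⁻¹)ᵀ

lemma dual_det_ne {A : Matrix (Fin n) (Fin n) ℝ} (hA : A.det ≠ 0) : (dual A).det ≠ 0 := by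
  rw [dual, Matrix.det_transpose, Matrix.det_nonsing_inv]
  simpa using hA

lemma dual_dual {A : Matrix (Fin n) (Fin n) ℝ} (hA : A.det ≠ 0) : dual (dual A) = A := by
  rw [dual, dual, ← Matrix.transpose_nonsing_inv, Matrix.transpose_transpose,
    Matrix.nonsing_inv_nonsing_inv _ (Ne.isUnit hA)]

lemma vv_nonneg (A : Matrix (Fin n) (Fin n) ℝ) (k : Fin n → ℤ) (a : Fin n) : 0 ≤ vv A k a :=
  mul_nonneg Real.pi_pos.le (sq_nonneg _)

lemma sum_vv (A : Matrix (Fin n) (Fin n) ℝ) (k : Fin n → ℤ) :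
    ∑ a, vv A k a = Real.pi * qf A (ev k) := by
  simp [vv, qf, Finset.mul_sum]

lemma summ_vv {A : Matrix (Fin n) (Fin n) ℝ} (hA : A.det ≠ 0) {t : ℝ} (ht : 0 < t) :
    Summable (fun k : Fin n → ℤ => Real.exp (-t * ∑ a, vv A k a)) := by
  refine (summ_qf hA (mul_pos ht Real.pi_pos)).congr (fun k => ?_)
  rw [sum_vv]; congr 1; ring

lemma vv_diag (A : Matrix (Fin n) (Fin n) ℝ) (d : Fin n → ℝ) (k : Fin n → ℤ) (a : Fin n) :
    vv (Matrix.diagonal d * A) k a = d a ^ 2 * vv A k a := by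
  rw [vv, vv, ← Matrix.mulVec_mulVec, Matrix.mulVec_diagonal]; ring

lemma dual_diag {A : Matrix (Fin n) (Fin n) ℝ} (d : Fin n → ℝ) (hd : ∀ a, d a ≠ 0) :
    dual (Matrix.diagonal d * A) = Matrix.diagonal (fun a => (d a)⁻¹) * dual A := by
  have : (Matrix.diagonal d)⁻¹ = Matrix.diagonal (fun a => (d a)⁻¹) := by
    apply Matrix.inv_eq_right_inv
    rw [Matrix.diagonal_mul_diagonal]
    simp [hd]
  rw [dual, dual, Matrix.mul_inv_rev, Matrix.transpose_mul, this, Matrix.diagonal_transpose]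

lemma theta_diag {A : Matrix (Fin n) (Fin n) ℝ} (hA : |A.det| = 1) (d : Fin n → ℝ)
    (hd : ∀ a, 0 < d a) :
    ∑' k, Real.exp (-∑ a, d a ^ 2 * vv A k a) =
      (∏ a, d a)⁻¹ * ∑' l, Real.exp (-∑ a, (d a)⁻¹ ^ 2 * vv (dual A) l a) := by
  have hp : 0 < ∏ a, d a := Finset.prod_pos (fun a _ => hd a)
  have hA0 : A.det ≠ 0 := by intro h; rw [h] at hA; simp at hA
  have hdet : (Matrix.diagonal d * A).det = (∏ a, d a) * A.det := by
    rw [Matrix.det_mul, Matrix.det_diagonal]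
  have h := theta (A := Matrix.diagonal d * A) (by rw [hdet]; exact mul_ne_zero hp.ne' hA0)
  rw [hdet, abs_mul, hA, mul_one, abs_of_pos hp] at h
  have hc : ∀ (M : Matrix (Fin n) (Fin n) ℝ) (k : Fin n → ℤ),
    -Real.pi * qf M (ev k) = -∑ a, vv M k a := fun M k => by rw [sum_vv]; ring
  change _ = _ * ∑' l : Fin n → ℤ, Real.exp (-Real.pi * qf (dual _) (ev l)) at h
  rw [dual_diag d (fun a => (hd a).ne')] at h
  simp_rw [hc, vv_diag] at h
  exact h

open Polynomial

lemma poly_bound (r : ℝ[X]) : ∃ C, 0 ≤ C ∧ ∀ V, 0 ≤ V → |r.eval V| ≤ C * Real.exp (V/2) := by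
  induction r using Polynomial.induction_on' with
  | add p q hp hq =>
    obtain ⟨C, hC, h1⟩ := hp
    obtain ⟨C', hC', h2⟩ := hq
    refine ⟨C + C', by positivity, fun V hV => ?_⟩
    rw [eval_add, add_mul]
    exact (abs_add_le _ _).trans (add_le_add (h1 V hV) (h2 V hV))
  | monomial k c =>
    refine ⟨|c| * (2^k * k.factorial), by positivity, fun V hV => ?_⟩
    rw [eval_monomial, abs_mul, mul_assoc]
    refine mul_le_mul_of_nonneg_left ?_ (abs_nonneg _)
    have := Real.pow_div_factorial_le_exp (V/2) (by positivity) k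
    rw [div_pow, div_div, div_le_iff₀ (by positivity)] at this
    rw [abs_of_nonneg (by positivity)]
    linarith

/-- the termwise summand -/
noncomputable def Et (A : Matrix (Fin n) (Fin n) ℝ) (a : Fin n) (r : ℝ[X]) (k : Fin n → ℤ) (t : ℝ) : ℝ :=
  Real.exp (t/4) * r.eval (Real.exp t * vv A k a) *
    Real.exp (-(Real.exp t * vv A k a + (∑ b, vv A k b - vv A k a)))

/-- the derivative operator -/
noncomputable def Lop (r : ℝ[X]) : ℝ[X] := C (1/4) * r + X * derivative r - X * r

lemma Et_deriv (A : Matrix (Fin n) (Fin n) ℝ) (a : Fin n) (r : ℝ[X]) (k : Fin n → ℤ) (t : ℝ) :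
    HasDerivAt (Et A a r k) (Et A a (Lop r) k t) t := by
  unfold Et
  set v := vv A k a
  set u := ∑ b, vv A k b - v
  have h1 : HasDerivAt (fun t : ℝ => Real.exp (t/4)) (Real.exp (t/4) * (1/4)) t :=
    ((hasDerivAt_id t).div_const 4).exp
  have h2 : HasDerivAt (fun t : ℝ => Real.exp t * v) (Real.exp t * v) t :=
    (Real.hasDerivAt_exp t).mul_const v
  have h3 : HasDerivAt (fun t : ℝ => r.eval (Real.exp t * v))
      ((derivative r).eval (Real.exp t * v) * (Real.exp t * v)) t :=
    HasDerivAt.comp (h₂ := fun y => r.eval y) t (r.hasDerivAt (Real.exp t * v)) h2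
  have h4 : HasDerivAt (fun t : ℝ => Real.exp (-(Real.exp t * v + u)))
      (Real.exp (-(Real.exp t * v + u)) * (-(Real.exp t * v))) t := by
    exact ((h2.add_const u).neg).exp
  convert! (h1.mul h3).mul h4 using 1
  simp only [Lop, eval_sub, eval_add, eval_mul, eval_C, eval_X, Pi.mul_apply]
  ring

lemma Et_bound (A : Matrix (Fin n) (Fin n) ℝ) (a : Fin n) (r : ℝ[X]) :
    ∃ C, ∀ k, ∀ t ∈ Set.Ioo (-(1/2):ℝ) (1/2), ‖Et A a r k t‖ ≤ C * Real.exp (-(1/4) * ∑ b, vv A k b) := by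
  obtain ⟨C, hC, h⟩ := poly_bound r
  refine ⟨Real.exp 1 * C, fun k t ht => ?_⟩
  have hv := vv_nonneg A k a
  have hu : 0 ≤ ∑ b, vv A k b - vv A k a := by
    rw [sub_nonneg]
    exact Finset.single_le_sum (f := fun b => vv A k b) (fun b _ => vv_nonneg A k b) (Finset.mem_univ a)
  unfold Et
  set v := vv A k a
  set S := ∑ b, vv A k b
  have he : (1/2 : ℝ) ≤ Real.exp t := by
    have := Real.add_one_le_exp t
    linarith [ht.1]
  rw [norm_mul, norm_mul, Real.norm_eq_abs, Real.norm_eq_abs, Real.norm_eq_abs,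
    abs_of_pos (Real.exp_pos _), abs_of_pos (Real.exp_pos _)]
  have h1 : Real.exp (t/4) ≤ Real.exp 1 := Real.exp_le_exp.2 (by linarith [ht.2])
  calc _ ≤ Real.exp 1 * (C * Real.exp (Real.exp t * v / 2)) *
        Real.exp (-(Real.exp t * v + (S - v))) := by
        gcongr
        exact h _ (by positivity)
    _ = (Real.exp 1 * C) * (Real.exp (Real.exp t * v / 2) * Real.exp (-(Real.exp t * v + (S - v)))) := by ring
    _ ≤ _ := by
        rw [← Real.exp_add]
        gcongr
        nlinarith [mul_le_mul_of_nonneg_right he hv]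

lemma Et_summ {A : Matrix (Fin n) (Fin n) ℝ} (hA : A.det ≠ 0) (a : Fin n) (r : ℝ[X]) {t : ℝ}
    (ht : t ∈ Set.Ioo (-(1/2):ℝ) (1/2)) : Summable (fun k => Et A a r k t) := by
  obtain ⟨C, h⟩ := Et_bound A a r
  exact Summable.of_norm_bounded ((summ_vv hA (by norm_num : (0:ℝ) < 1/4)).mul_left C) (fun k => h k t ht)

lemma T_deriv {A : Matrix (Fin n) (Fin n) ℝ} (hA : A.det ≠ 0) (a : Fin n) (r : ℝ[X]) {t : ℝ}
    (ht : t ∈ Set.Ioo (-(1/2):ℝ) (1/2)) :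
    HasDerivAt (fun t => ∑' k, Et A a r k t) (∑' k, Et A a (Lop r) k t) t := by
  obtain ⟨C, h⟩ := Et_bound A a (Lop r)
  exact hasDerivAt_tsum_of_isPreconnected
    ((summ_vv hA (by norm_num : (0:ℝ) < 1/4)).mul_left C) isOpen_Ioo isPreconnected_Ioo
    (fun k y _ => Et_deriv A a r k y) (fun k y hy => h k y hy) ht (Et_summ hA a r ht) ht

lemma T_step {A B : Matrix (Fin n) (Fin n) ℝ} (hA : A.det ≠ 0) (hB : B.det ≠ 0) (a : Fin n) (r : ℝ[X])
    (s : ℝ) (h : ∀ t ∈ Set.Ioo (-(1/2):ℝ) (1/2), ∑' k, Et A a r k t = s * ∑' k, Et B a r k (-t)) :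
    ∀ t ∈ Set.Ioo (-(1/2):ℝ) (1/2), ∑' k, Et A a (Lop r) k t = (-s) * ∑' k, Et B a (Lop r) k (-t) := by
  intro t ht
  have ht' : -t ∈ Set.Ioo (-(1/2):ℝ) (1/2) := ⟨by linarith [ht.2], by linarith [ht.1]⟩
  have h1 := T_deriv hA a r ht
  have h2 : HasDerivAt (fun t => s * ∑' k, Et B a r k (-t)) (s * ((∑' k, Et B a (Lop r) k (-t)) * (-1))) t :=
    ((T_deriv hB a r ht').comp t (hasDerivAt_neg t)).const_mul s
  have h3 : HasDerivAt (fun t => ∑' k, Et A a r k t) (s * ((∑' k, Et B a (Lop r) k (-t)) * (-1))) t :=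
    h2.congr_of_eventuallyEq (Filter.eventually_of_mem (isOpen_Ioo.mem_nhds ht) h)
  rw [h1.unique h3]; ring

lemma T_base {A : Matrix (Fin n) (Fin n) ℝ} (hA : |A.det| = 1) (a : Fin n) (t : ℝ) :
    ∑' k, Et A a 1 k t = ∑' k, Et (dual A) a 1 k (-t) := by
  have h := theta_diag hA (fun b => if b = a then Real.exp (t/2) else 1)
    (fun b => by split_ifs <;> positivity)
  have hs : ∀ (M : Matrix (Fin n) (Fin n) ℝ) (k : Fin n → ℤ) (c : ℝ),
      ∑ b, (if b = a then c else 1)^2 * vv M k b = c^2 * vv M k a + (∑ b, vv M k b - vv M k a) := by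
    intro M k c
    rw [← Finset.sum_erase_add _ _ (Finset.mem_univ a), ← Finset.sum_erase_add _ _ (Finset.mem_univ a)]
    rw [Finset.sum_congr rfl (g := fun b => vv M k b)]
    · simp; ring
    · intro b hb
      simp [Finset.ne_of_mem_erase hb]
  have hi : ∀ b : Fin n, (if b = a then Real.exp (t/2) else 1)⁻¹ = if b = a then (Real.exp (t/2))⁻¹ else 1 := by
    intro b; split_ifs <;> simp
  simp_rw [hi, hs] at h
  rw [Finset.prod_ite_eq' Finset.univ a (fun _ => Real.exp (t/2))] at h
  simp only [Finset.mem_univ, if_true] at h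
  have e1 : Real.exp (t/2)^2 = Real.exp t := by rw [← Real.exp_nat_mul]; congr 1; push_cast; ring
  have e2 : (Real.exp (t/2))⁻¹^2 = Real.exp (-t) := by
    rw [← Real.exp_neg, ← Real.exp_nat_mul]; congr 1; push_cast; ring
  rw [e1] at h
  simp_rw [e2] at h
  simp only [Et, eval_one, mul_one]
  rw [tsum_mul_left, tsum_mul_left, h, ← mul_assoc, ← Real.exp_neg, ← Real.exp_add]
  congr 2; ring

/-- the cubic polynomial -/
noncomputable def fp (ε v : ℝ) : ℝ := 8*v^3 - 30*v^2 + 15*v + ε*(1-4*v)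

lemma fp_summ {A : Matrix (Fin n) (Fin n) ℝ} (hA : A.det ≠ 0) (a : Fin n) (r : ℝ[X]) :
    Summable (fun k => r.eval (vv A k a) * Real.exp (-∑ b, vv A k b)) := by
  refine (Et_summ hA a r (t := 0) (by constructor <;> norm_num)).congr (fun k => ?_)
  simp [Et]

theorem cubic_identity {A : Matrix (Fin n) (Fin n) ℝ} (hA : |A.det| = 1) (ε : ℝ) (a : Fin n) :
    ∑' k, fp ε (vv A k a) * Real.exp (-∑ b, vv A k b) +
      ∑' k, fp ε (vv (dual A) k a) * Real.exp (-∑ b, vv (dual A) k b) = 0 := by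
  have hA0 : A.det ≠ 0 := by intro h; rw [h] at hA; simp at hA
  have hB0 := dual_det_ne hA0
  have h0 : ∀ t ∈ Set.Ioo (-(1/2):ℝ) (1/2), ∑' k, Et A a 1 k t = 1 * ∑' k, Et (dual A) a 1 k (-t) := by
    intro t _; rw [one_mul, T_base hA a t]
  have h1 := T_step hA0 hB0 a _ _ h0
  have h3 := T_step hA0 hB0 a _ _ (T_step hA0 hB0 a _ _ h1)
  have hm : (0:ℝ) ∈ Set.Ioo (-(1/2):ℝ) (1/2) := by constructor <;> norm_num
  have e1 := h1 0 hm
  have e3 := h3 0 hm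
  rw [neg_zero] at e1 e3
  have key : ∀ (M : Matrix (Fin n) (Fin n) ℝ), M.det ≠ 0 →
      ∑' k, fp ε (vv M k a) * Real.exp (-∑ b, vv M k b) =
        -8 * ∑' k, Et M a (Lop (Lop (Lop 1))) k 0 + (1/2 + 4*ε) * ∑' k, Et M a (Lop 1) k 0 := by
    intro M hM
    rw [← tsum_mul_left, ← tsum_mul_left, ← Summable.tsum_add ((Et_summ hM a _ hm).mul_left _)
      ((Et_summ hM a _ hm).mul_left _)]
    refine tsum_congr (fun k => ?_)
    simp only [Et, Lop, fp, derivative_add, derivative_sub, derivative_mul, derivative_X,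
      derivative_C, derivative_one, eval_add, eval_sub, eval_mul, eval_X, eval_C, eval_one, eval_zero,
      Real.exp_zero, one_mul, zero_div, derivative_zero, add_sub_cancel]
    ring
  rw [key A hA0, key _ hB0, e1, e3]
  ring

end TR
end

section
namespace TR
open Finset Matrix
variable {n : ℕ}

/-- all nonzero lattice points have product of coordinates at least `μ^n` -/
def Big (μ : ℝ) (A : Matrix (Fin n) (Fin n) ℝ) : Prop := ∀ k : Fin n → ℤ, k ≠ 0 → μ^n ≤ ∏ a, vv A k a

lemma amgm {μ : ℝ} (hμ : 0 < μ) (v : Fin n → ℝ) (hv : ∀ a, 0 < v a) (h : μ^n ≤ ∏ a, v a) :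
    n * μ ≤ ∑ a, v a := by
  have h1 : 0 ≤ ∑ a, Real.log (v a / μ) := by
    rw [← Real.log_prod (fun a _ => (div_pos (hv a) hμ).ne')]
    apply Real.log_nonneg
    rw [Finset.prod_div_distrib, Finset.prod_const, Finset.card_univ, Fintype.card_fin]
    rwa [le_div_iff₀ (by positivity), one_mul]
  have h2 : ∑ a, Real.log (v a / μ) ≤ ∑ a, (v a / μ - 1) :=
    Finset.sum_le_sum (fun a _ => Real.log_le_sub_one_of_pos (div_pos (hv a) hμ))
  rw [Finset.sum_sub_distrib, ← Finset.sum_div] at h2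
  simp at h2
  have h3 : (n:ℝ) ≤ (∑ a, v a) / μ := by linarith
  rwa [le_div_iff₀ hμ] at h3

lemma Big.pos {μ : ℝ} (hμ : 0 < μ) {A : Matrix (Fin n) (Fin n) ℝ} (h : Big μ A) {k : Fin n → ℤ} (hk : k ≠ 0)
    (a : Fin n) : 0 < vv A k a := by
  refine lt_of_le_of_ne (vv_nonneg A k a) (fun h0 => ?_)
  have := h k hk
  rw [Finset.prod_eq_zero (Finset.mem_univ a) h0.symm] at this
  linarith [pow_pos hμ n]

/-- theta function -/
noncomputable def th (A : Matrix (Fin n) (Fin n) ℝ) (t : ℝ) : ℝ := ∑' k, Real.exp (-t * ∑ a, vv A k a)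

lemma vv_zero (A : Matrix (Fin n) (Fin n) ℝ) (a : Fin n) : vv A 0 a = 0 := by
  have : ev (0 : Fin n → ℤ) = 0 := by ext i; simp [ev]
  simp [vv, this]

lemma th_two {A : Matrix (Fin n) (Fin n) ℝ} (hA : A.det ≠ 0) {μ : ℝ} (hμ : 0 < μ) (h : Big μ A) :
    th A 2 - 1 ≤ Real.exp (-(3/2) * (n * μ)) * (th A (1/2) - 1) := by
  have e : ∀ t : ℝ, 0 < t → th A t - 1 = ∑' k : Fin n → ℤ, (if k = 0 then 0 else Real.exp (-t * ∑ a, vv A k a)) := by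
    intro t ht
    rw [th, (summ_vv hA ht).tsum_eq_add_tsum_ite 0]
    simp [vv_zero]
  have hs : ∀ t : ℝ, 0 < t → Summable (fun k : Fin n → ℤ => (if k = 0 then 0 else Real.exp (-t * ∑ a, vv A k a))) := by
    intro t ht
    refine Summable.of_nonneg_of_le (fun k => ?_) (fun k => ?_) (summ_vv hA ht)
    · split_ifs <;> positivity
    · split_ifs
      · positivity
      · exact le_rfl
  rw [e 2 (by norm_num), e (1/2) (by norm_num), ← tsum_mul_left]
  refine Summable.tsum_le_tsum (fun k => ?_) (hs 2 (by norm_num)) ((hs (1/2) (by norm_num)).mul_left _)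
  split_ifs with hk
  · simp
  · rw [← Real.exp_add]
    apply Real.exp_le_exp.2
    have := amgm hμ (vv A k) (h.pos hμ hk) (h k hk)
    linarith

lemma th_fe {A : Matrix (Fin n) (Fin n) ℝ} (hA : |A.det| = 1) : th A (1/2) = (Real.sqrt 2)^n * th (dual A) 2 := by
  have h := theta_diag hA (fun _ => (Real.sqrt 2)⁻¹) (fun a => by positivity)
  simp only [inv_inv, inv_pow, Real.sq_sqrt (by norm_num : (0:ℝ) ≤ 2), ← Finset.mul_sum, Finset.prod_const,
    Finset.card_univ, Fintype.card_fin] at h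
  rw [th, th]
  have q1 : ∀ x : ℝ, -(1/2) * x = -((2:ℝ)⁻¹ * x) := fun x => by ring
  simp_rw [q1, neg_mul]
  exact h

theorem unif (n : ℕ) (hn : 0 < n) : ∃ C, ∀ A : Matrix (Fin n) (Fin n) ℝ, |A.det| = 1 →
    Big (46135/100000) A → Big (46135/100000) (dual A) → th A (1/2) ≤ C := by
  set μ : ℝ := 46135/100000 with hμd
  have hμ : 0 < μ := by norm_num [hμd]
  set r := (Real.sqrt 2)^n with hr
  set q := Real.exp (-(3/2) * (n * μ)) with hq
  have hr0 : 0 < r := by positivity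
  have hρ : r * q < 1 := by
    have : r * q = (Real.sqrt 2 * Real.exp (-(3/2)*μ))^n := by
      rw [hr, hq, mul_pow, ← Real.exp_nat_mul]; congr 2; ring
    rw [this]
    refine pow_lt_one₀ (by positivity) ?_ hn.ne'
    have h2 : Real.sqrt 2 < 3/2 := by
      rw [Real.sqrt_lt' (by norm_num)]; norm_num
    have h3 : (1.69:ℝ) ≤ Real.exp ((3/2)*μ) := by
      have := Real.add_one_le_exp ((3/2)*μ)
      refine le_trans ?_ this
      norm_num [hμd]
    rw [show -(3/2)*μ = -((3/2)*μ) by ring, Real.exp_neg, ← div_eq_mul_inv, div_lt_one (Real.exp_pos _)]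
    linarith
  refine ⟨1 + 2 * r / (1 - r*q), fun A hA h1 h2 => ?_⟩
  have hA0 : A.det ≠ 0 := by intro h; rw [h] at hA; simp at hA
  have hdd : |(dual A).det| = 1 := by
    rw [dual, Matrix.det_transpose, Matrix.det_nonsing_inv, Ring.inverse_eq_inv', abs_inv, hA, inv_one]
  have a1 := th_fe hA
  have a2 := th_fe hdd
  rw [dual_dual hA0] at a2
  have b1 := th_two hA0 hμ h1
  have b2 := th_two (dual_det_ne hA0) hμ h2
  rw [← hr] at a1 a2
  rw [← hq] at b1 b2
  have c1 := mul_le_mul_of_nonneg_left b1 hr0.le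
  have c2 := mul_le_mul_of_nonneg_left b2 hr0.le
  have pos : ∀ M : Matrix (Fin n) (Fin n) ℝ, M.det ≠ 0 → 1 ≤ th M (1/2) := by
    intro M hM
    have := (summ_vv hM (by norm_num : (0:ℝ) < 1/2)).le_tsum 0 (fun _ _ => (Real.exp_pos _).le)
    have e : Real.exp (-(1/2) * ∑ a, vv M 0 a) = 1 := by simp [vv_zero]
    rw [e] at this; exact this
  have p1 := pos A hA0
  have p2 := pos _ (dual_det_ne hA0)
  have : th A (1/2) - 1 ≤ 2 * r / (1 - r*q) := by
    rw [le_div_iff₀ (by linarith)]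
    nlinarith [mul_nonneg (by linarith : 0 ≤ th (dual A) (1/2) - 1) (by linarith : 0 ≤ 1 - r*q)]
  linarith

open MeasureTheory

/-- flux through a large box -/
lemma box_flux {n : ℕ} (G : (Fin (n+1) → ℝ) → ℝ) (hG : ContDiff ℝ 1 G) (C : ℝ) (hC : ∀ x, |G x| ≤ C)
    (R : ℝ) (hR : 0 < R) (a : Fin (n+1)) :
    |∫ x in Set.Icc (0 : Fin (n+1) → ℝ) (fun _ => R), fderiv ℝ G x (Pi.single a 1)| ≤ 2 * C * R^n := by
  have hle : (0 : Fin (n+1) → ℝ) ≤ (fun _ => R) := fun _ => hR.le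
  have hc : Continuous (fun x => fderiv ℝ G x (Pi.single a 1)) :=
    (hG.continuous_fderiv (by norm_num)).clm_apply continuous_const
  have h := integral_divergence_of_hasFDerivAt_off_countable' (E := ℝ) (0 : Fin (n+1) → ℝ) (fun _ => R) hle
    (fun i x => if i = a then G x else 0) (fun i x => if i = a then fderiv ℝ G x else 0) ∅
    Set.countable_empty
    (fun i => by
      by_cases hi : i = a
      · simp only [hi, if_true]; exact hG.continuous.continuousOn
      · simp only [hi, if_false]; exact continuousOn_const)
    (fun x _ i => by
      by_cases hi : i = a
      · simp only [hi, if_true]; exact (hG.differentiable (by norm_num) x).hasFDerivAt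
      · simp only [hi, if_false]; exact hasFDerivAt_const _ _)
    (by
      refine (Continuous.continuousOn ?_).integrableOn_compact isCompact_Icc
      refine continuous_finsetSum _ (fun i _ => ?_)
      by_cases hi : i = a
      · subst hi; simpa using hc
      · simp only [hi, if_false]; simpa using continuous_const)
  have e : ∀ x, ∑ i, (if i = a then fderiv ℝ G x else 0) (Pi.single i 1) = fderiv ℝ G x (Pi.single a 1) := by
    intro x
    rw [Finset.sum_eq_single a]
    · simp
    · intro b _ hb; simp [hb]
    · simp
  simp_rw [e] at h
  rw [h, Finset.sum_eq_single a]
  · simp only [if_true]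
    have hv : (volume : Measure (Fin n → ℝ)).real (Set.Icc ((0 : Fin (n+1) → ℝ) ∘ a.succAbove) ((fun _ => R) ∘ a.succAbove)) = R^n := by
      rw [measureReal_def, Real.volume_Icc_pi_toReal]
      · simp
      · intro i; exact hR.le
    have hb : ∀ c : ℝ, ‖∫ x in Set.Icc ((0 : Fin (n+1) → ℝ) ∘ a.succAbove) ((fun _ => R) ∘ a.succAbove),
        G (a.insertNth c x)‖ ≤ C * R^n := by
      intro c
      rw [← hv]
      refine norm_setIntegral_le_of_norm_le_const ?_ (fun x _ => hC _)
      exact isCompact_Icc.measure_lt_top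
    have := abs_sub (∫ x in Set.Icc ((0 : Fin (n+1) → ℝ) ∘ a.succAbove) ((fun _ => R) ∘ a.succAbove),
        G (a.insertNth R x)) (∫ x in Set.Icc ((0 : Fin (n+1) → ℝ) ∘ a.succAbove) ((fun _ => R) ∘ a.succAbove),
        G (a.insertNth 0 x))
    have h1 := hb R
    have h2 := hb 0
    rw [Real.norm_eq_abs] at h1 h2
    refine le_trans this ?_
    linarith
  · intro b _ hb; simp [hb]
  · simp

end TR
end

section
namespace TR
open Finset Matrix
variable {n : ℕ}

/-- first building block of the exact form -/
def hA (c : Fin 7 → ℝ) (x y : ℝ) : ℝ :=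
  c 1 * (1) +
  c 2 * (x + y + 1) +
  c 3 * (x^2 + x*y + 2*x + y^2 + 2*y + 2) +
  c 4 * (x^3 + x^2*y + 3*x^2 + x*y^2 + 4*x*y + 6*x + y^3 + 3*y^2 + 6*y + 6) +
  c 5 * (x^4 + x^3*y + 4*x^3 + x^2*y^2 + 6*x^2*y + 12*x^2 + x*y^3 + 6*x*y^2 + 18*x*y + 24*x + y^4 + 4*y^3 + 12*y^2 + 24*y + 24) +
  c 6 * (x^5 + x^4*y + 5*x^4 + x^3*y^2 + 8*x^3*y + 20*x^3 + x^2*y^3 + 9*x^2*y^2 + 36*x^2*y + 60*x^2 + x*y^4 + 8*x*y^3 + 36*x*y^2 + 96*x*y + 120*x + y^5 + 5*y^4 + 20*y^3 + 60*y^2 + 120*y + 120)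
/-- second building block of the exact form -/
def hB (c : Fin 7 → ℝ) (x y : ℝ) : ℝ :=
  c 3 * (-x + y) +
  c 4 * (-2*x^2 - 4*x + 2*y^2 + 4*y) +
  c 5 * (-3*x^3 - x^2*y - 11*x^2 + x*y^2 - 18*x + 3*y^3 + 11*y^2 + 18*y) +
  c 6 * (-4*x^4 - 2*x^3*y - 21*x^3 - 9*x^2*y - 63*x^2 + 2*x*y^3 + 9*x*y^2 - 96*x + 4*y^4 + 21*y^3 + 63*y^2 + 96*y)
/-- the divergence correction -/
def hD (c : Fin 7 → ℝ) (x : ℝ) : ℝ :=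
  c 1 * (1) +
  c 2 * (2*x + 1) +
  c 3 * (3*x^2 + 3*x + 2) +
  c 4 * (4*x^3 + 6*x^2 + 8*x + 6) +
  c 5 * (5*x^4 + 10*x^3 + 20*x^2 + 30*x + 24) +
  c 6 * (6*x^5 + 15*x^4 + 40*x^3 + 90*x^2 + 144*x + 120)
/-- the multiplier of the logarithm -/
def hP (c : Fin 7 → ℝ) (x : ℝ) : ℝ :=
  c 1 * x^1 + c 2 * x^2 + c 3 * x^3 + c 4 * x^4 + c 5 * x^5 + c 6 * x^6

lemma dmono {X Y : ℝ → ℝ} {τ t : ℝ} (hX : HasDerivAt X (τ * X t) t) (hY : HasDerivAt Y (-(τ * Y t)) t)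
    (r : ℝ) (i j : ℕ) :
    HasDerivAt (fun t => r * (X t ^ i * Y t ^ j)) (r * (τ * ((i:ℝ) - j) * (X t ^ i * Y t ^ j))) t := by
  have h := ((hX.fun_pow i).fun_mul (hY.fun_pow j)).const_mul r
  refine h.congr_deriv ?_
  rcases i with _ | i <;> rcases j with _ | j <;>
    (simp only [Nat.add_sub_cancel, pow_succ, pow_zero, Nat.cast_add, Nat.cast_one, Nat.cast_zero]; ring)

/-- evaluation of a list of monomials -/
def ml (l : List (ℝ × ℕ × ℕ)) (x y : ℝ) : ℝ := (l.map (fun p => p.1 * (x ^ p.2.1 * y ^ p.2.2))).sum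

lemma dml {X Y : ℝ → ℝ} {τ t : ℝ} (hX : HasDerivAt X (τ * X t) t) (hY : HasDerivAt Y (-(τ * Y t)) t)
    (l : List (ℝ × ℕ × ℕ)) :
    HasDerivAt (fun t => ml l (X t) (Y t))
      (τ * ml (l.map (fun p => (p.1 * ((p.2.1:ℝ) - p.2.2), p.2))) (X t) (Y t)) t := by
  induction l with
  | nil => simpa [ml] using hasDerivAt_const t (0:ℝ)
  | cons p l ih =>
    have := (dmono hX hY p.1 p.2.1 p.2.2).fun_add ih
    refine this.congr_deriv ?_ |>.congr_of_eventuallyEq ?_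
    · simp [ml]; ring
    · exact Filter.Eventually.of_forall (fun t => by simp [ml])

/-- monomials of `hA` -/
def lA (c : Fin 7 → ℝ) : List (ℝ × ℕ × ℕ) := [(1*c 1,0,0),
  (1*c 2,1,0), (1*c 2,0,1), (1*c 2,0,0),
  (1*c 3,2,0), (1*c 3,1,1), (2*c 3,1,0), (1*c 3,0,2), (2*c 3,0,1), (2*c 3,0,0),
  (1*c 4,3,0), (1*c 4,2,1), (3*c 4,2,0), (1*c 4,1,2), (4*c 4,1,1), (6*c 4,1,0), (1*c 4,0,3), (3*c 4,0,2), (6*c 4,0,1), (6*c 4,0,0),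
  (1*c 5,4,0), (1*c 5,3,1), (4*c 5,3,0), (1*c 5,2,2), (6*c 5,2,1), (12*c 5,2,0), (1*c 5,1,3), (6*c 5,1,2), (18*c 5,1,1), (24*c 5,1,0), (1*c 5,0,4), (4*c 5,0,3), (12*c 5,0,2), (24*c 5,0,1), (24*c 5,0,0),
  (1*c 6,5,0), (1*c 6,4,1), (5*c 6,4,0), (1*c 6,3,2), (8*c 6,3,1), (20*c 6,3,0), (1*c 6,2,3), (9*c 6,2,2), (36*c 6,2,1), (60*c 6,2,0), (1*c 6,1,4), (8*c 6,1,3), (36*c 6,1,2), (96*c 6,1,1), (120*c 6,1,0), (1*c 6,0,5), (5*c 6,0,4), (20*c 6,0,3), (60*c 6,0,2), (120*c 6,0,1), (120*c 6,0,0)]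
/-- monomials of `hB` -/
def lB (c : Fin 7 → ℝ) : List (ℝ × ℕ × ℕ) := [(-1*c 3,1,0), (1*c 3,0,1),
  (-2*c 4,2,0), (-4*c 4,1,0), (2*c 4,0,2), (4*c 4,0,1),
  (-3*c 5,3,0), (-1*c 5,2,1), (-11*c 5,2,0), (1*c 5,1,2), (-18*c 5,1,0), (3*c 5,0,3), (11*c 5,0,2), (18*c 5,0,1),
  (-4*c 6,4,0), (-2*c 6,3,1), (-21*c 6,3,0), (-9*c 6,2,1), (-63*c 6,2,0), (2*c 6,1,3), (9*c 6,1,2), (-96*c 6,1,0), (4*c 6,0,4), (21*c 6,0,3), (63*c 6,0,2), (96*c 6,0,1)]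

lemma lA_eq (c : Fin 7 → ℝ) (x y : ℝ) : ml (lA c) x y = hA c x y := by
  simp [ml, lA, hA]; ring
lemma lB_eq (c : Fin 7 → ℝ) (x y : ℝ) : ml (lB c) x y = hB c x y := by
  simp [ml, lB, hB]; ring

lemma keyA (c : Fin 7 → ℝ) (x y : ℝ) :
    (x - y) * hA c x y - ml ((lA c).map (fun p => (p.1 * ((p.2.1:ℝ) - p.2.2), p.2))) x y = hP c x - hP c y := by
  simp [ml, lA, hA, hP]; ring
lemma keyB (c : Fin 7 → ℝ) (x y : ℝ) :
    (x - y) * hB c x y - ml ((lB c).map (fun p => (p.1 * ((p.2.1:ℝ) - p.2.2), p.2))) x y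
      = 2 * hA c x y - hD c x - hD c y := by
  simp [ml, lB, hA, hB, hD]; ring

/-- mean -/
noncomputable def mean (s : Fin n → ℝ) : ℝ := (∑ a, s a) / n

/-- logarithm of the coordinates along the flow -/
noncomputable def LL (w : Fin n → ℝ) (τ : ℝ) (s : Fin n → ℝ) (a : Fin n) : ℝ := w a + τ * (s a - mean s)

/-- the flux -/
noncomputable def GG (c : Fin 7 → ℝ) (w : Fin n → ℝ) (τ : ℝ) (a b : Fin n) (s : Fin n → ℝ) : ℝ :=
  (hA c (Real.exp (LL w τ s a)) (Real.exp (LL w τ s b)) * (LL w τ s a - LL w τ s b)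
    + hB c (Real.exp (LL w τ s a)) (Real.exp (LL w τ s b))) * Real.exp (-∑ i, Real.exp (LL w τ s i))

lemma GG_smooth (c : Fin 7 → ℝ) (w : Fin n → ℝ) (τ : ℝ) (a b : Fin n) : ContDiff ℝ 1 (GG c w τ a b) := by
  unfold GG hA hB LL mean
  fun_prop

lemma GG_deriv (c : Fin 7 → ℝ) (w : Fin n → ℝ) (τ : ℝ) {a b : Fin n} (hab : a ≠ b) (s : Fin n → ℝ) :
    fderiv ℝ (GG c w τ a b) s (Pi.single a 1) - fderiv ℝ (GG c w τ a b) s (Pi.single b 1) =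
    τ * ((hD c (Real.exp (LL w τ s a)) + hD c (Real.exp (LL w τ s b)))
      - (hP c (Real.exp (LL w τ s a)) - hP c (Real.exp (LL w τ s b))) * (LL w τ s a - LL w τ s b))
      * Real.exp (-∑ i, Real.exp (LL w τ s i)) := by
  rw [← map_sub]
  set e : Fin n → ℝ := Pi.single a 1 - Pi.single b 1 with he
  have hd : HasDerivAt (fun t : ℝ => GG c w τ a b (s + t • e)) (fderiv ℝ (GG c w τ a b) s e) 0 := by
    have h1 := ((GG_smooth c w τ a b).differentiable (by norm_num) s).hasFDerivAt
    exact h1.hasLineDerivAt e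
  have hm : ∀ t : ℝ, mean (s + t • e) = mean s := by
    intro t
    simp [mean, he, Finset.sum_add_distrib, ← Finset.mul_sum]
  have hL : ∀ (t : ℝ) i, LL w τ (s + t • e) i = LL w τ s i + τ * t * e i := by
    intro t i
    rw [LL, hm, LL]; simp; ring
  have ea : e a = 1 := by simp [he, hab]
  have eb : e b = -1 := by simp [he, hab.symm]
  have ei : ∀ i, i ≠ a → i ≠ b → e i = 0 := by intro i h1 h2; simp [he, h1, h2]
  have hLd : ∀ i, HasDerivAt (fun t : ℝ => LL w τ (s + t • e) i) (τ * e i) 0 := by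
    intro i
    simp_rw [hL]
    have := (((hasDerivAt_id (0:ℝ)).const_mul τ).mul_const (e i)).const_add (LL w τ s i)
    simpa using this
  have h0 : s + (0:ℝ) • e = s := by simp
  have hX : HasDerivAt (fun t : ℝ => Real.exp (LL w τ (s + t • e) a)) (τ * Real.exp (LL w τ (s + (0:ℝ) • e) a)) 0 := by
    have := (hLd a).exp
    rw [ea] at this
    refine this.congr_deriv (by ring)
  have hY : HasDerivAt (fun t : ℝ => Real.exp (LL w τ (s + t • e) b)) (-(τ * Real.exp (LL w τ (s + (0:ℝ) • e) b))) 0 := by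
    have := (hLd b).exp
    rw [eb] at this
    refine this.congr_deriv (by ring)
  have dA := dml hX hY (lA c)
  have dB := dml hX hY (lB c)
  have dV : HasDerivAt (fun t : ℝ => ∑ i, Real.exp (LL w τ (s + t • e) i))
      (τ * (Real.exp (LL w τ s a) - Real.exp (LL w τ s b))) 0 := by
    have h := HasDerivAt.fun_sum (u := Finset.univ) (fun i (_ : i ∈ Finset.univ) => (hLd i).exp)
    refine h.congr_deriv ?_
    rw [h0, Finset.sum_eq_add a b hab (fun i _ h => by rw [ei i h.1 h.2]; simp) (by simp) (by simp), ea, eb]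
    ring
  simp_rw [lA_eq] at dA
  simp_rw [lB_eq] at dB
  have tot := ((dA.fun_mul ((hLd a).fun_sub (hLd b))).fun_add dB).fun_mul dV.fun_neg.exp
  have := hd.unique tot
  rw [this]
  rw [h0, ea, eb]
  set x := Real.exp (LL w τ s a)
  set y := Real.exp (LL w τ s b)
  have kA := keyA c x y
  have kB := keyB c x y
  set dAA := ml ((lA c).map (fun p => (p.1 * ((p.2.1:ℝ) - p.2.2), p.2))) x y
  set dBB := ml ((lB c).map (fun p => (p.1 * ((p.2.1:ℝ) - p.2.2), p.2))) x y
  have e1 : dAA = (x - y) * hA c x y - (hP c x - hP c y) := by linarith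
  have e2 : dBB = (x - y) * hB c x y - (2 * hA c x y - hD c x - hD c y) := by linarith
  rw [e1, e2]
  ring

/-- the flux inequality -/
lemma flux_sum (c : Fin 7 → ℝ) (w : Fin n → ℝ) (τ : ℝ) (s : Fin n → ℝ) :
    ∑ a, ∑ b, (fderiv ℝ (GG c w τ a b) s (Pi.single a 1) - fderiv ℝ (GG c w τ a b) s (Pi.single b 1)) =
    2 * τ * Real.exp (-∑ i, Real.exp (LL w τ s i)) *
     (((n:ℝ) - 1) * ∑ a, hD c (Real.exp (LL w τ s a)) -
      (n * ∑ a, hP c (Real.exp (LL w τ s a)) * LL w τ s a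
        - (∑ a, hP c (Real.exp (LL w τ s a))) * ∑ a, LL w τ s a)) := by
  set E := Real.exp (-∑ i, Real.exp (LL w τ s i))
  have h : ∀ a b, fderiv ℝ (GG c w τ a b) s (Pi.single a 1) - fderiv ℝ (GG c w τ a b) s (Pi.single b 1) =
      τ * E * ((hD c (Real.exp (LL w τ s a)) + hD c (Real.exp (LL w τ s b)))
      - (hP c (Real.exp (LL w τ s a)) * LL w τ s a - hP c (Real.exp (LL w τ s a)) * LL w τ s b
        - hP c (Real.exp (LL w τ s b)) * LL w τ s a + hP c (Real.exp (LL w τ s b)) * LL w τ s b))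
      - if a = b then τ * E * (2 * hD c (Real.exp (LL w τ s a))) else 0 := by
    intro a b
    by_cases hab : a = b
    · subst hab; simp; ring
    · rw [GG_deriv c w τ hab, if_neg hab]; ring
  simp_rw [h]
  obtain ⟨p, hp⟩ : ∃ p : Fin n → ℝ, ∀ a, hP c (Real.exp (LL w τ s a)) * LL w τ s a = p a := ⟨_, fun _ => rfl⟩
  simp_rw [hp]
  simp only [Finset.sum_sub_distrib, Finset.sum_add_distrib, ← Finset.mul_sum, ← Finset.sum_mul, Finset.sum_ite_eq,
    Finset.mem_univ, if_true, Finset.sum_const, Finset.card_univ, Fintype.card_fin, nsmul_eq_mul]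
  ring

end TR
end

section
namespace TR
open Finset Matrix MeasureTheory
variable {n : ℕ}

lemma ml_bound (l : List (ℝ × ℕ × ℕ)) (K : ℝ) (hl : ∀ p ∈ l, p.2.1 + p.2.2 ≤ 5 ∧ |p.1| ≤ K) {x y V : ℝ}
    (hx : 0 ≤ x) (hy : 0 ≤ y) (hxV : x ≤ V) (hyV : y ≤ V) : |ml l x y| ≤ l.length * K * (1 + V)^5 := by
  induction l with
  | nil => simp [ml]
  | cons p l ih =>
    have h1 := ih (fun q hq => hl q (List.mem_cons_of_mem _ hq))
    obtain ⟨h2, h3⟩ := hl p List.mem_cons_self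
    have hK : 0 ≤ K := (abs_nonneg _).trans h3
    have h4 : |p.1 * (x ^ p.2.1 * y ^ p.2.2)| ≤ K * (1 + V)^5 := by
      rw [abs_mul, abs_of_nonneg (by positivity : 0 ≤ x ^ p.2.1 * y ^ p.2.2)]
      refine mul_le_mul h3 ?_ (by positivity) hK
      calc x ^ p.2.1 * y ^ p.2.2 ≤ (1+V)^p.2.1 * (1+V)^p.2.2 := by
            have : 0 ≤ V := hx.trans hxV
            gcongr <;> linarith
        _ = (1+V)^(p.2.1+p.2.2) := (pow_add _ _ _).symm
        _ ≤ (1+V)^5 := pow_le_pow_right₀ (by linarith) h2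
    have e : ml (p :: l) x y = p.1 * (x ^ p.2.1 * y ^ p.2.2) + ml l x y := by simp [ml]
    rw [e]
    refine (abs_add_le _ _).trans ?_
    push_cast [List.length_cons]
    linarith

lemma sum_LL (hn : 0 < n) (w : Fin n → ℝ) (τ : ℝ) (s : Fin n → ℝ) : ∑ a, LL w τ s a = ∑ a, w a := by
  have : (n:ℝ) ≠ 0 := by positivity
  simp only [LL, mean, Finset.sum_add_distrib, ← Finset.mul_sum, Finset.sum_sub_distrib, Finset.sum_const,
    Finset.card_univ, Fintype.card_fin, nsmul_eq_mul]
  field_simp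
  ring

lemma hA_bound (c : Fin 7 → ℝ) (M : ℝ) (hc : ∀ k, |c k| ≤ M) {x y V : ℝ}
    (hx : 0 ≤ x) (hy : 0 ≤ y) (hxV : x ≤ V) (hyV : y ≤ V) : |hA c x y| ≤ 100 * (200 * M) * (1 + V)^5 := by
  have hM : 0 ≤ M := (abs_nonneg _).trans (hc 0)
  have hV : 0 ≤ V := hx.trans hxV
  rw [← lA_eq]
  refine (ml_bound (lA c) (200 * M) ?_ hx hy hxV hyV).trans ?_
  · intro p hp
    have key : ∀ (q : ℝ) (k : Fin 7), |q| ≤ 200 → |q * c k| ≤ 200 * M := fun q k hq => by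
      rw [abs_mul]; exact mul_le_mul hq (hc k) (abs_nonneg _) (by norm_num)
    simp only [lA, List.mem_cons, List.not_mem_nil, or_false] at hp
    rcases hp with rfl|rfl|rfl|rfl|rfl|rfl|rfl|rfl|rfl|rfl|rfl|rfl|rfl|rfl|rfl|rfl|rfl|rfl|rfl|rfl|rfl|rfl|rfl|rfl|rfl|rfl|rfl|rfl|rfl|rfl|rfl|rfl|rfl|rfl|rfl|rfl|rfl|rfl|rfl|rfl|rfl|rfl|rfl|rfl|rfl|rfl|rfl|rfl|rfl|rfl|rfl|rfl|rfl|rfl|rfl|rfl <;>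
      exact ⟨by norm_num, key _ _ (by norm_num)⟩
  · gcongr
    simp only [lA, List.length_cons, List.length_nil]; norm_num

lemma hB_bound (c : Fin 7 → ℝ) (M : ℝ) (hc : ∀ k, |c k| ≤ M) {x y V : ℝ}
    (hx : 0 ≤ x) (hy : 0 ≤ y) (hxV : x ≤ V) (hyV : y ≤ V) : |hB c x y| ≤ 100 * (200 * M) * (1 + V)^5 := by
  have hM : 0 ≤ M := (abs_nonneg _).trans (hc 0)
  have hV : 0 ≤ V := hx.trans hxV
  rw [← lB_eq]
  refine (ml_bound (lB c) (200 * M) ?_ hx hy hxV hyV).trans ?_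
  · intro p hp
    have key : ∀ (q : ℝ) (k : Fin 7), |q| ≤ 200 → |q * c k| ≤ 200 * M := fun q k hq => by
      rw [abs_mul]; exact mul_le_mul hq (hc k) (abs_nonneg _) (by norm_num)
    simp only [lB, List.mem_cons, List.not_mem_nil, or_false] at hp
    rcases hp with rfl|rfl|rfl|rfl|rfl|rfl|rfl|rfl|rfl|rfl|rfl|rfl|rfl|rfl|rfl|rfl|rfl|rfl|rfl|rfl|rfl|rfl|rfl|rfl|rfl|rfl <;>
      exact ⟨by norm_num, key _ _ (by norm_num)⟩
  · gcongr
    simp only [lB, List.length_cons, List.length_nil]; norm_num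


/-- the constant -/
noncomputable def mu : ℝ := 46135/100000

lemma mu_pos : 0 < mu := by norm_num [mu]

lemma GG_bound (hn : 0 < n) (M : ℝ) (hM : 0 ≤ M) : ∃ C, 0 ≤ C ∧ ∀ c : Fin 7 → ℝ, (∀ k, |c k| ≤ M) →
    ∀ (w : Fin n → ℝ) (τ : ℝ) (a b : Fin n) (s : Fin n → ℝ), n * Real.log mu ≤ ∑ i, w i →
    |GG c w τ a b s| ≤ C * Real.exp (-(1/2) * ∑ i, Real.exp (LL w τ s i)) := by
  obtain ⟨C, hC0, hC⟩ := poly_bound (Polynomial.C (100 * (200 * M)) * (1 + Polynomial.X)^5 *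
    (Polynomial.C (n:ℝ) * Polynomial.X - Polynomial.C (n * Real.log mu) + 1))
  refine ⟨C, hC0, fun c hc w τ a b s hw => ?_⟩
  set V := ∑ i, Real.exp (LL w τ s i) with hV
  have hV0 : 0 ≤ V := Finset.sum_nonneg (fun i _ => (Real.exp_pos _).le)
  have hle : ∀ i, Real.exp (LL w τ s i) ≤ V := fun i =>
    Finset.single_le_sum (f := fun i => Real.exp (LL w τ s i)) (fun i _ => (Real.exp_pos _).le) (Finset.mem_univ i)
  have hL : ∀ i, LL w τ s i ≤ V := fun i => by
    have := Real.add_one_le_exp (LL w τ s i)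
    linarith [hle i]
  have hlog : Real.log mu < 0 := Real.log_neg mu_pos (by norm_num [mu])
  have hLL : ∀ i, n * Real.log mu - (n - 1) * V ≤ LL w τ s i := by
    intro i
    have h1 := sum_LL hn w τ s
    rw [← Finset.sum_erase_add _ _ (Finset.mem_univ i)] at h1
    have h2 : ∑ x ∈ univ.erase i, LL w τ s x ≤ ∑ x ∈ univ.erase i, V := Finset.sum_le_sum (fun j _ => hL j)
    rw [Finset.sum_const, Finset.card_erase_of_mem (Finset.mem_univ i), Finset.card_univ, Fintype.card_fin,
      nsmul_eq_mul, Nat.cast_sub (by omega)] at h2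
    push_cast at h2
    linarith
  have hd : |LL w τ s a - LL w τ s b| ≤ n * V - n * Real.log mu := by
    rw [abs_le]
    constructor <;> linarith [hL a, hL b, hLL a, hLL b]
  have bA := hA_bound c M hc (Real.exp_pos (LL w τ s a)).le (Real.exp_pos (LL w τ s b)).le (hle a) (hle b)
  have bB := hB_bound c M hc (Real.exp_pos (LL w τ s a)).le (Real.exp_pos (LL w τ s b)).le (hle a) (hle b)
  set T := 100 * (200 * M) * (1 + V)^5 with hT
  have hT0 : 0 ≤ T := by positivity
  have hr := hC V hV0
  have e : Polynomial.eval V (Polynomial.C (100 * (200 * M)) * (1 + Polynomial.X)^5 *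
    (Polynomial.C (n:ℝ) * Polynomial.X - Polynomial.C (n * Real.log mu) + 1)) = T * (n * V - n * Real.log mu + 1) := by
    simp only [Polynomial.eval_mul, Polynomial.eval_C, Polynomial.eval_pow, Polynomial.eval_add, Polynomial.eval_one,
      Polynomial.eval_X, Polynomial.eval_sub]
    rw [hT]
  rw [e] at hr
  have hr' := (le_abs_self _).trans hr
  rw [GG, abs_mul, abs_of_pos (Real.exp_pos _), ← hV]
  have h3 : |hA c (Real.exp (LL w τ s a)) (Real.exp (LL w τ s b)) * (LL w τ s a - LL w τ s b)
    + hB c (Real.exp (LL w τ s a)) (Real.exp (LL w τ s b))| ≤ C * Real.exp (V/2) := by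
    refine (abs_add_le _ _).trans (le_trans ?_ hr')
    rw [abs_mul]
    have := mul_le_mul bA hd (abs_nonneg _) hT0
    linarith
  calc _ ≤ C * Real.exp (V/2) * Real.exp (-V) := by gcongr
    _ = C * Real.exp (-(1/2) * V) := by rw [mul_assoc, ← Real.exp_add]; congr 2; ring

/-- the certificate -/
def Cert (n : ℕ) (ε : ℝ) : Prop := ∃ M : ℝ, 0 ≤ M ∧ ∀ m : ℝ, mu ≤ m → ∃ c : Fin 7 → ℝ, (∀ k, |c k| ≤ M) ∧
  ∀ v : ℝ, 0 < v → 0 ≤ fp ε v + (c 0 + hP c v) * (Real.log v - Real.log m) - (((n:ℝ) - 1)/n) * hD c v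

lemma pointwise (hn : 0 < n) {ε : ℝ} {c : Fin 7 → ℝ} {m : ℝ}
    (hc : ∀ v : ℝ, 0 < v → 0 ≤ fp ε v + (c 0 + hP c v) * (Real.log v - Real.log m) - (((n:ℝ) - 1)/n) * hD c v)
    (w : Fin n → ℝ) (τ : ℝ) (hτ : τ ≠ 0) (hw : ∑ i, w i = n * Real.log m) (s : Fin n → ℝ) :
    (2 * τ * n)⁻¹ * ∑ a, ∑ b, (fderiv ℝ (GG c w τ a b) s (Pi.single a 1) - fderiv ℝ (GG c w τ a b) s (Pi.single b 1))
    ≤ ∑ a, fp ε (Real.exp (LL w τ s a)) * Real.exp (-∑ i, Real.exp (LL w τ s i)) := by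
  have hs := sum_LL hn w τ s
  rw [flux_sum, ← Finset.sum_mul, hs, hw]
  have hn' : (n:ℝ) ≠ 0 := by positivity
  have h1 : 0 ≤ ∑ a, (fp ε (Real.exp (LL w τ s a)) + (c 0 + hP c (Real.exp (LL w τ s a))) *
      (LL w τ s a - Real.log m) - (((n:ℝ) - 1)/n) * hD c (Real.exp (LL w τ s a))) := by
    refine Finset.sum_nonneg (fun a _ => ?_)
    have := hc _ (Real.exp_pos (LL w τ s a))
    rwa [Real.log_exp] at this
  have e : ∑ a, (fp ε (Real.exp (LL w τ s a)) + (c 0 + hP c (Real.exp (LL w τ s a))) *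
      (LL w τ s a - Real.log m) - (((n:ℝ) - 1)/n) * hD c (Real.exp (LL w τ s a))) =
      ∑ a, fp ε (Real.exp (LL w τ s a)) + c 0 * (∑ a, LL w τ s a - n * Real.log m)
       + (∑ a, hP c (Real.exp (LL w τ s a)) * LL w τ s a - (∑ a, hP c (Real.exp (LL w τ s a))) * Real.log m)
       - (((n:ℝ) - 1)/n) * ∑ a, hD c (Real.exp (LL w τ s a)) := by
    have : ∀ a, (fp ε (Real.exp (LL w τ s a)) + (c 0 + hP c (Real.exp (LL w τ s a))) *
      (LL w τ s a - Real.log m) - (((n:ℝ) - 1)/n) * hD c (Real.exp (LL w τ s a))) =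
      fp ε (Real.exp (LL w τ s a)) + c 0 * (LL w τ s a - Real.log m) +
      (hP c (Real.exp (LL w τ s a)) * LL w τ s a - hP c (Real.exp (LL w τ s a)) * Real.log m)
      - (((n:ℝ) - 1)/n) * hD c (Real.exp (LL w τ s a)) := fun a => by ring
    simp_rw [this]
    simp only [Finset.sum_sub_distrib, Finset.sum_add_distrib, ← Finset.mul_sum, ← Finset.sum_mul,
      Finset.sum_const, Finset.card_univ, Fintype.card_fin, nsmul_eq_mul]
  rw [e, hs, hw, sub_self, mul_zero, add_zero] at h1
  have hE := (Real.exp_pos (-∑ i, Real.exp (LL w τ s i)))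
  have h2 := mul_nonneg h1 hE.le
  rw [← sub_nonneg]
  refine h2.trans_eq ?_
  field_simp
  ring

end TR
end

section
namespace TR
open Finset Matrix MeasureTheory
variable {n : ℕ}

/-- the flowed lattice -/
noncomputable def As (A : Matrix (Fin n) (Fin n) ℝ) (τ : ℝ) (s : Fin n → ℝ) : Matrix (Fin n) (Fin n) ℝ :=
  Matrix.diagonal (fun a => Real.exp (τ/2 * (s a - mean s))) * A

lemma vv_As (A : Matrix (Fin n) (Fin n) ℝ) (τ : ℝ) (s : Fin n → ℝ) (k : Fin n → ℤ) (a : Fin n) :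
    vv (As A τ s) k a = Real.exp (τ * (s a - mean s)) * vv A k a := by
  rw [As, vv_diag, ← Real.exp_nat_mul]; congr 2; push_cast; ring

lemma sum_mean (hn : 0 < n) (s : Fin n → ℝ) : ∑ a, (s a - mean s) = 0 := by
  have h := sum_LL hn (fun _ => 0) 1 s
  simpa [LL] using h

lemma det_As (hn : 0 < n) (A : Matrix (Fin n) (Fin n) ℝ) (τ : ℝ) (s : Fin n → ℝ) : (As A τ s).det = A.det := by
  rw [As, Matrix.det_mul, Matrix.det_diagonal, ← Real.exp_sum, ← Finset.mul_sum, sum_mean hn]; simp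

lemma dual_As (A : Matrix (Fin n) (Fin n) ℝ) (τ : ℝ) (s : Fin n → ℝ) : dual (As A τ s) = As (dual A) (-τ) s := by
  rw [As, dual_diag _ (fun a => (Real.exp_pos _).ne'), As]
  congr 2
  ext a
  simp [← Real.exp_neg]
  ring

lemma Big_As (hn : 0 < n) {A : Matrix (Fin n) (Fin n) ℝ} {μ : ℝ} (h : Big μ A) (τ : ℝ) (s : Fin n → ℝ) :
    Big μ (As A τ s) := by
  intro k hk
  simp_rw [vv_As]
  rw [Finset.prod_mul_distrib, ← Real.exp_sum, ← Finset.mul_sum, sum_mean hn]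
  simpa using h k hk

/-- the box integrand for one lattice point -/
noncomputable def FF (ε : ℝ) (A : Matrix (Fin n) (Fin n) ℝ) (τ : ℝ) (k : Fin n → ℤ) (s : Fin n → ℝ) : ℝ :=
  ∑ a, fp ε (vv (As A τ s) k a) * Real.exp (-∑ b, vv (As A τ s) k b)

lemma FF_cont (ε : ℝ) (A : Matrix (Fin n) (Fin n) ℝ) (τ : ℝ) (k : Fin n → ℤ) : Continuous (FF ε A τ k) := by
  unfold FF fp
  simp_rw [vv_As]
  unfold mean
  fun_prop

lemma FF_zero (ε : ℝ) (A : Matrix (Fin n) (Fin n) ℝ) (τ : ℝ) (s : Fin n → ℝ) : FF ε A τ 0 s = n * ε := by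
  simp [FF, vv_zero, fp]

lemma FF_bound (n : ℕ) (ε : ℝ) : ∃ C, 0 ≤ C ∧ ∀ (A : Matrix (Fin n) (Fin n) ℝ) (τ : ℝ) (k : Fin n → ℤ) (s : Fin n → ℝ),
    |FF ε A τ k s| ≤ C * Real.exp (-(1/2) * ∑ b, vv (As A τ s) k b) := by
  obtain ⟨C, hC0, hC⟩ := poly_bound (Polynomial.C 8 * Polynomial.X^3 + Polynomial.C 30 * Polynomial.X^2
    + Polynomial.C 15 * Polynomial.X + Polynomial.C |ε| * (1 + Polynomial.C 4 * Polynomial.X))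
  refine ⟨n * C, by positivity, fun A τ k s => ?_⟩
  set V := ∑ b, vv (As A τ s) k b with hV
  have hV0 : 0 ≤ V := Finset.sum_nonneg (fun b _ => vv_nonneg _ _ _)
  have h1 : ∀ a ∈ (Finset.univ : Finset (Fin n)), |fp ε (vv (As A τ s) k a) * Real.exp (-V)| ≤ C * Real.exp (-(1/2) * V) := by
    intro a _
    set v := vv (As A τ s) k a
    have hv : 0 ≤ v := vv_nonneg _ _ _
    have hvV : v ≤ V := Finset.single_le_sum (f := fun b => vv (As A τ s) k b)
      (fun b _ => vv_nonneg _ _ _) (Finset.mem_univ a)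
    have h2 : |fp ε v| ≤ 8 * V^3 + 30 * V^2 + 15 * V + |ε| * (1 + 4 * V) := by
      have q1 : v^3 ≤ V^3 := by gcongr
      have q2 : v^2 ≤ V^2 := by gcongr
      have q3 : |ε * (1 - 4*v)| ≤ |ε| * (1 + 4 * V) := by
        rw [abs_mul]
        have : |1 - 4*v| ≤ 1 + 4*V := by rw [abs_le]; constructor <;> linarith
        gcongr
      have q4 := abs_le.1 q3
      have q5 : 0 ≤ v^3 := by positivity
      have q6 : 0 ≤ v^2 := by positivity
      unfold fp
      rw [abs_le]; constructor <;> linarith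
    have h3 := (le_abs_self _).trans (hC V hV0)
    simp only [Polynomial.eval_add, Polynomial.eval_mul, Polynomial.eval_C, Polynomial.eval_pow, Polynomial.eval_X,
      Polynomial.eval_one] at h3
    rw [abs_mul, abs_of_pos (Real.exp_pos _)]
    calc _ ≤ C * Real.exp (V/2) * Real.exp (-V) := by gcongr; exact h2.trans h3
      _ = C * Real.exp (-(1/2) * V) := by rw [mul_assoc, ← Real.exp_add]; congr 2; ring
  refine (Finset.abs_sum_le_sum_abs _ _).trans ((Finset.sum_le_sum h1).trans ?_)
  simp [mul_assoc]

lemma mean_mem (hn : 0 < n) {R : ℝ} {s : Fin n → ℝ} (hs : s ∈ Set.Icc (0 : Fin n → ℝ) (fun _ => R)) :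
    0 ≤ mean s ∧ mean s ≤ R := by
  have h0 : ∀ a, 0 ≤ s a := fun a => hs.1 a
  have h1 : ∀ a, s a ≤ R := fun a => hs.2 a
  have hn' : (0:ℝ) < n := by positivity
  constructor
  · exact div_nonneg (Finset.sum_nonneg (fun a _ => h0 a)) hn'.le
  · rw [mean, div_le_iff₀ hn']
    refine (Finset.sum_le_sum (fun a _ => h1 a)).trans ?_
    simp [mul_comm]

lemma FF_box (hn : 0 < n) (ε : ℝ) {A : Matrix (Fin n) (Fin n) ℝ} (hA : A.det ≠ 0) (τ R : ℝ) :
    ∃ u : (Fin n → ℤ) → ℝ, Summable u ∧ ∀ k, ∀ s ∈ Set.Icc (0 : Fin n → ℝ) (fun _ => R), |FF ε A τ k s| ≤ u k := by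
  obtain ⟨C, hC0, hC⟩ := FF_bound n ε
  refine ⟨fun k => C * Real.exp (-(1/2 * Real.exp (-(|τ| * R))) * ∑ b, vv A k b), (summ_vv hA (by positivity)).mul_left C,
    fun k s hs => (hC A τ k s).trans ?_⟩
  obtain ⟨m0, m1⟩ := mean_mem hn hs
  have h0 : ∀ a, 0 ≤ s a := fun a => hs.1 a
  have h1 : ∀ a, s a ≤ R := fun a => hs.2 a
  refine mul_le_mul_of_nonneg_left (Real.exp_le_exp.2 ?_) hC0
  have : Real.exp (-(|τ| * R)) * ∑ b, vv A k b ≤ ∑ b, vv (As A τ s) k b := by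
    rw [Finset.mul_sum]
    refine Finset.sum_le_sum (fun b _ => ?_)
    rw [vv_As]
    refine mul_le_mul_of_nonneg_right (Real.exp_le_exp.2 ?_) (vv_nonneg _ _ _)
    have h2 : |τ * (s b - mean s)| ≤ |τ| * R := by
      rw [abs_mul]
      refine mul_le_mul_of_nonneg_left ?_ (abs_nonneg _)
      rw [abs_le]; constructor <;> linarith [h0 b, h1 b]
    linarith [(abs_le.1 h2).1]
  nlinarith

lemma box_vol (n : ℕ) {R : ℝ} (hR : 0 < R) : (volume : Measure (Fin n → ℝ)).real (Set.Icc 0 (fun _ => R)) = R^n := by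
  rw [measureReal_def, Real.volume_Icc_pi_toReal]
  · simp
  · intro i; exact hR.le

lemma FF_hasSum (hn : 0 < n) (ε : ℝ) {A : Matrix (Fin n) (Fin n) ℝ} (hA : A.det ≠ 0) (τ R : ℝ) (hR : 0 < R) :
    HasSum (fun k => ∫ s in Set.Icc (0 : Fin n → ℝ) (fun _ => R), FF ε A τ k s)
      (∫ s in Set.Icc (0 : Fin n → ℝ) (fun _ => R), ∑' k, FF ε A τ k s) := by
  obtain ⟨u, hu, hb⟩ := FF_box hn ε hA τ R
  refine hasSum_integral_of_summable_integral_norm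
    (fun k => (FF_cont ε A τ k).continuousOn.integrableOn_compact isCompact_Icc) ?_
  refine Summable.of_nonneg_of_le (fun k => integral_nonneg (fun s => norm_nonneg _)) (fun k => ?_) (hu.mul_right (R^n))
  have := norm_setIntegral_le_of_norm_le_const (μ := volume) (s := Set.Icc (0 : Fin n → ℝ) (fun _ => R))
    (f := fun s => ‖FF ε A τ k s‖) (C := u k) isCompact_Icc.measure_lt_top
    (fun s hs => by rw [norm_norm]; exact hb k s hs)
  rw [box_vol n hR] at this
  exact (le_abs_self _).trans this

lemma half {N : ℕ} {ε : ℝ} (hc : Cert (N+1) ε) {A : Matrix (Fin (N+1)) (Fin (N+1)) ℝ} (hA : |A.det| = 1)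
    (h1 : Big mu A) (h2 : Big mu (dual A)) {τ : ℝ} (hτ : τ ≠ 0) :
    ∃ C, ∀ R > 0, ((N+1 : ℕ):ℝ) * ε * R^(N+1) - C * R^N ≤
      ∫ s in Set.Icc (0 : Fin (N+1) → ℝ) (fun _ => R), ∑' k, FF ε A τ k s := by
  have hn : 0 < N + 1 := Nat.succ_pos _
  have hA0 : A.det ≠ 0 := by intro h; rw [h] at hA; simp at hA
  obtain ⟨M, hM, hcert⟩ := hc
  obtain ⟨C1, hC1, hG⟩ := GG_bound hn M hM
  obtain ⟨C2, hU⟩ := unif (N+1) hn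
  -- choose the data for each lattice vector
  have hdata : ∀ k : Fin (N+1) → ℤ, ∃ (c : Fin 7 → ℝ), (∀ i, |c i| ≤ M) ∧ (k ≠ 0 → ∀ s,
      (2 * τ * ((N+1 : ℕ):ℝ))⁻¹ * ∑ a, ∑ b, (fderiv ℝ (GG c (fun a => Real.log (vv A k a)) τ a b) s (Pi.single a 1)
        - fderiv ℝ (GG c (fun a => Real.log (vv A k a)) τ a b) s (Pi.single b 1)) ≤ FF ε A τ k s) := by
    intro k
    by_cases hk : k = 0
    · exact ⟨0, by simpa using hM, fun h => absurd hk h⟩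
    have hpos := h1.pos mu_pos hk
    have hw : (((N+1 : ℕ):ℝ)) * Real.log mu ≤ ∑ i, Real.log (vv A k i) := by
      rw [← Real.log_prod (fun a _ => (hpos a).ne'), ← Real.log_pow]
      exact Real.log_le_log (pow_pos mu_pos _) (h1 k hk)
    have hm : mu ≤ Real.exp ((∑ i, Real.log (vv A k i)) / ((N+1 : ℕ):ℝ)) := by
      rw [← Real.log_le_iff_le_exp mu_pos, le_div_iff₀ (by positivity)]
      linarith
    obtain ⟨c, hcM, hcv⟩ := hcert _ hm
    refine ⟨c, hcM, fun _ s => (pointwise hn hcv _ τ hτ ?_ s).trans_eq ?_⟩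
    · rw [Real.log_exp]; field_simp
    · have e : ∀ a, Real.exp (LL (fun a => Real.log (vv A k a)) τ s a) = vv (As A τ s) k a := by
        intro a
        rw [LL, vv_As, Real.exp_add, Real.exp_log (hpos a), mul_comm]
      simp_rw [e]; rfl
  choose c hcM hcF using hdata
  set w : (Fin (N+1) → ℤ) → Fin (N+1) → ℝ := fun k a => Real.log (vv A k a) with hwdef
  set C := |(2 * τ * ((N+1 : ℕ):ℝ))⁻¹| * ((N+1 : ℕ) * ((N+1 : ℕ) * (4 * (C1 * C2)))) with hCdef
  refine ⟨C, fun R hR => ?_⟩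
  have hS := FF_hasSum hn ε hA0 τ R hR
  refine ge_of_tendsto hS ?_
  filter_upwards [Filter.eventually_ge_atTop {0}] with T hT
  rw [← Finset.sum_erase_add T _ (hT (Finset.mem_singleton_self _))]
  simp_rw [FF_zero]
  rw [setIntegral_const, box_vol _ hR, smul_eq_mul]
  suffices h : -(C * R^N) ≤ ∑ k ∈ T.erase 0, ∫ s in Set.Icc (0 : Fin (N+1) → ℝ) (fun _ => R), FF ε A τ k s by
    linarith
  set T' := T.erase 0
  have hT0 : ∀ k ∈ T', k ≠ 0 := fun k hk => Finset.ne_of_mem_erase hk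
  -- the total flux
  set H : Fin (N+1) → Fin (N+1) → (Fin (N+1) → ℝ) → ℝ := fun a b s => ∑ k ∈ T', GG (c k) (w k) τ a b s with hH
  have hHs : ∀ a b, ContDiff ℝ 1 (H a b) := fun a b => ContDiff.sum (fun k _ => GG_smooth _ _ _ _ _)
  have hHd : ∀ a b s e, fderiv ℝ (H a b) s e = ∑ k ∈ T', fderiv ℝ (GG (c k) (w k) τ a b) s e := by
    intro a b s e
    rw [hH, fderiv_fun_sum (fun k _ => (GG_smooth _ _ _ _ _).differentiable (by norm_num) s)]
    simp
  have hHb : ∀ a b s, |H a b s| ≤ C1 * C2 := by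
    intro a b s
    have hAs : |(As A τ s).det| = 1 := by rw [det_As hn]; exact hA
    have hAs0 : (As A τ s).det ≠ 0 := by rw [det_As hn]; exact hA0
    have hu := hU (As A τ s) hAs (Big_As hn h1 τ s) (by rw [dual_As]; exact Big_As hn h2 _ s)
    calc |H a b s| ≤ ∑ k ∈ T', |GG (c k) (w k) τ a b s| := Finset.abs_sum_le_sum_abs _ _
      _ ≤ ∑ k ∈ T', C1 * Real.exp (-(1/2) * ∑ i, vv (As A τ s) k i) := by
        refine Finset.sum_le_sum (fun k hk => ?_)
        have hpos := h1.pos mu_pos (hT0 k hk)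
        have e : ∀ a, Real.exp (LL (fun a => Real.log (vv A k a)) τ s a) = vv (As A τ s) k a := by
          intro a
          rw [LL, vv_As, Real.exp_add, Real.exp_log (hpos a), mul_comm]
        have := hG (c k) (hcM k) (w k) τ a b s (by
          rw [← Real.log_prod (fun a _ => (hpos a).ne'), ← Real.log_pow]
          exact Real.log_le_log (pow_pos mu_pos _) (h1 k (hT0 k hk)))
        simp_rw [hwdef, e] at this
        exact this
      _ = C1 * ∑ k ∈ T', Real.exp (-(1/2) * ∑ i, vv (As A τ s) k i) := by rw [Finset.mul_sum]
      _ ≤ C1 * th (As A τ s) (1/2) := by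
        refine mul_le_mul_of_nonneg_left ?_ hC1
        exact (summ_vv hAs0 (by norm_num)).sum_le_tsum _ (fun _ _ => (Real.exp_pos _).le)
      _ ≤ C1 * C2 := mul_le_mul_of_nonneg_left hu hC1
  have hcont : ∀ a b e, Continuous (fun s => fderiv ℝ (H a b) s e) := fun a b e =>
    ((hHs a b).continuous_fderiv (by norm_num)).clm_apply continuous_const
  have hIntg : ∀ f : (Fin (N+1) → ℝ) → ℝ, Continuous f → IntegrableOn f (Set.Icc 0 (fun _ => R)) volume :=
    fun f hf => hf.continuousOn.integrableOn_compact isCompact_Icc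
  have hcd : ∀ a b, Continuous (fun s => fderiv ℝ (H a b) s (Pi.single a 1) - fderiv ℝ (H a b) s (Pi.single b 1)) :=
    fun a b => (hcont a b _).fun_sub (hcont a b _)
  have hcs : ∀ a, Continuous (fun s => ∑ b, (fderiv ℝ (H a b) s (Pi.single a 1) - fderiv ℝ (H a b) s (Pi.single b 1))) :=
    fun a => continuous_finsetSum _ (fun b _ => hcd a b)
  have hlow : ∫ s in Set.Icc (0 : Fin (N+1) → ℝ) (fun _ => R), (2 * τ * ((N+1 : ℕ):ℝ))⁻¹ *
      ∑ a, ∑ b, (fderiv ℝ (H a b) s (Pi.single a 1) - fderiv ℝ (H a b) s (Pi.single b 1)) ≤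
      ∑ k ∈ T', ∫ s in Set.Icc (0 : Fin (N+1) → ℝ) (fun _ => R), FF ε A τ k s := by
    rw [← integral_finsetSum _ (fun k _ => hIntg _ (FF_cont ε A τ k))]
    refine setIntegral_mono (hIntg _ ?_) (hIntg _ ?_) ?_
    · exact continuous_const.mul (continuous_finsetSum _ (fun a _ => hcs a))
    · exact continuous_finsetSum _ (fun k _ => FF_cont ε A τ k)
    · intro s
      simp only
      have : ∑ a, ∑ b, (fderiv ℝ (H a b) s (Pi.single a 1) - fderiv ℝ (H a b) s (Pi.single b 1)) =
        ∑ k ∈ T', ∑ a, ∑ b, (fderiv ℝ (GG (c k) (w k) τ a b) s (Pi.single a 1) - fderiv ℝ (GG (c k) (w k) τ a b) s (Pi.single b 1)) := by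
        simp_rw [hHd, ← Finset.sum_sub_distrib]
        rw [Finset.sum_comm]
        simp_rw [Finset.sum_comm (s := (Finset.univ : Finset (Fin (N+1)))) (t := T')]
        rw [Finset.sum_congr rfl (fun k _ => Finset.sum_comm)]
      rw [this, Finset.mul_sum]
      exact Finset.sum_le_sum (fun k hk => hcF k (hT0 k hk) s)
  refine le_trans ?_ hlow
  rw [integral_const_mul, integral_finsetSum _ (fun a _ => hIntg _ (hcs a))]
  have hterm : ∀ a b, |∫ s in Set.Icc (0 : Fin (N+1) → ℝ) (fun _ => R),
      (fderiv ℝ (H a b) s (Pi.single a 1) - fderiv ℝ (H a b) s (Pi.single b 1))| ≤ 4 * (C1 * C2) * R^N := by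
    intro a b
    rw [integral_sub (hIntg _ (hcont a b _)) (hIntg _ (hcont a b _))]
    have q1 := box_flux (H a b) (hHs a b) (C1 * C2) (hHb a b) R hR a
    have q2 := box_flux (H a b) (hHs a b) (C1 * C2) (hHb a b) R hR b
    refine (abs_sub _ _).trans ?_
    linarith
  have habs : |(2 * τ * ((N+1 : ℕ):ℝ))⁻¹ * ∑ a, ∫ s in Set.Icc (0 : Fin (N+1) → ℝ) (fun _ => R),
      ∑ b, (fderiv ℝ (H a b) s (Pi.single a 1) - fderiv ℝ (H a b) s (Pi.single b 1))| ≤ C * R^N := by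
    rw [abs_mul, hCdef, mul_assoc (|(2 * τ * ((N+1 : ℕ):ℝ))⁻¹|)]
    refine mul_le_mul_of_nonneg_left ?_ (abs_nonneg _)
    have : ∀ a ∈ (Finset.univ : Finset (Fin (N+1))), |∫ s in Set.Icc (0 : Fin (N+1) → ℝ) (fun _ => R),
      ∑ b, (fderiv ℝ (H a b) s (Pi.single a 1) - fderiv ℝ (H a b) s (Pi.single b 1))| ≤
       ((N+1 : ℕ):ℝ) * (4 * (C1 * C2) * R^N) := by
      intro a _
      rw [integral_finsetSum _ (fun b _ => hIntg _ (hcd a b))]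
      refine (Finset.abs_sum_le_sum_abs _ _).trans (le_trans (Finset.sum_le_sum (fun b _ => hterm a b)) ?_)
      simp
    refine (Finset.abs_sum_le_sum_abs _ _).trans (le_trans (Finset.sum_le_sum this) ?_)
    simp only [Finset.sum_const, Finset.card_univ, Fintype.card_fin, nsmul_eq_mul]
    apply le_of_eq; ring
  exact (abs_le.1 habs).1

theorem no_lattice {N : ℕ} {ε : ℝ} (hε : 0 < ε) (hc : Cert (N+1) ε) {A : Matrix (Fin (N+1)) (Fin (N+1)) ℝ}
    (hA : |A.det| = 1) (h1 : Big mu A) (h2 : Big mu (dual A)) : False := by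
  have hn : 0 < N + 1 := Nat.succ_pos _
  have hA0 : A.det ≠ 0 := by intro h; rw [h] at hA; simp at hA
  have hdd : |(dual A).det| = 1 := by
    rw [dual, Matrix.det_transpose, Matrix.det_nonsing_inv, Ring.inverse_eq_inv', abs_inv, hA, inv_one]
  obtain ⟨C, hC⟩ := half hc hA h1 h2 (τ := 2) (by norm_num)
  obtain ⟨C', hC'⟩ := half hc hdd h2 (by rw [dual_dual hA0]; exact h1) (τ := -2) (by norm_num)
  have hR0 : 0 < (|C| + |C'| + 1) / ε := by positivity
  set R := (|C| + |C'| + 1) / ε with hR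
  have e1 := hC R hR0
  have e2 := hC' R hR0
  have hsumm : ∀ (M : Matrix (Fin (N+1)) (Fin (N+1)) ℝ), M.det ≠ 0 → ∀ a,
      Summable (fun k => fp ε (vv M k a) * Real.exp (-∑ b, vv M k b)) := by
    intro M hM a
    refine (fp_summ hM a (Polynomial.C 8 * Polynomial.X^3 - Polynomial.C 30 * Polynomial.X^2
      + Polynomial.C 15 * Polynomial.X + Polynomial.C ε * (1 - Polynomial.C 4 * Polynomial.X))).congr (fun k => ?_)
    simp [fp]
  have hz : ∀ s, ∑' k, FF ε A 2 k s + ∑' k, FF ε (dual A) (-2) k s = 0 := by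
    intro s
    have d1 : (As A 2 s).det ≠ 0 := by rw [det_As hn]; exact hA0
    have d2 : (As (dual A) (-2) s).det ≠ 0 := by rw [det_As hn]; exact dual_det_ne hA0
    unfold FF
    rw [Summable.tsum_finsetSum (fun a _ => hsumm _ d1 a), Summable.tsum_finsetSum (fun a _ => hsumm _ d2 a),
      ← Finset.sum_add_distrib]
    refine Finset.sum_eq_zero (fun a _ => ?_)
    rw [← dual_As]
    exact cubic_identity (by rw [det_As hn]; exact hA) ε a
  have hz' : ∀ s, ∑' k, FF ε (dual A) (-2) k s = -∑' k, FF ε A 2 k s := fun s => by linarith [hz s]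
  simp_rw [hz', integral_neg] at e2
  have hRN : 0 < R^N := by positivity
  have h3 : 2 * (((N+1 : ℕ):ℝ) * ε * R^(N+1)) ≤ (C + C') * R^N := by linarith
  have h4 : ((N+1 : ℕ):ℝ) * ε * R^(N+1) = ((N+1 : ℕ):ℝ) * (|C| + |C'| + 1) * R^N := by
    rw [hR, pow_succ]; field_simp
  rw [h4] at h3
  have h5 : (2 * (((N+1 : ℕ):ℝ) * (|C| + |C'| + 1))) ≤ C + C' := by
    by_contra hcon
    push Not at hcon
    have := mul_lt_mul_of_pos_right hcon hRN
    linarith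
  have h6 : (1:ℝ) ≤ ((N+1 : ℕ):ℝ) := by push_cast; linarith [(Nat.cast_nonneg N : (0:ℝ) ≤ N)]
  nlinarith [le_abs_self C, le_abs_self C', abs_nonneg C, abs_nonneg C']

end TR
end

section
namespace TR

/-! ### polynomials as lists -/

/-- force evaluation of a natural number -/
def fN {β : Type} (n : ℕ) (k : ℕ → β) : β := Nat.casesOn n (k 0) (fun m => k (m+1))
/-- force evaluation of an integer -/
def fZ {β : Type} (z : ℤ) (k : ℤ → β) : β :=
  Int.casesOn z (fun n => fN n (fun m => k (Int.ofNat m))) (fun n => fN n (fun m => k (Int.negSucc m)))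
/-- force evaluation of a list -/
def fL {β : Type} : List ℤ → (List ℤ → β) → β
  | [], k => k []
  | a :: l, k => fZ a (fun a' => fL l (fun l' => k (a' :: l')))

@[simp] lemma fN_eq {β : Type} (n : ℕ) (k : ℕ → β) : fN n k = k n := by cases n <;> rfl
@[simp] lemma fZ_eq {β : Type} (n : ℤ) (k : ℤ → β) : fZ n k = k n := by cases n <;> simp [fZ]
@[simp] lemma fL_eq {β : Type} (l : List ℤ) (k : List ℤ → β) : fL l k = k l := by
  induction l generalizing k with
  | nil => rfl
  | cons a l ih => simp [fL, ih]

/-- evaluation of an integer list -/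
def eZ (l : List ℤ) (w : ℝ) : ℝ := l.foldr (fun a r => (a:ℝ) + w * r) 0
/-- evaluation of a rational list -/
def eQ (l : List ℚ) (w : ℝ) : ℝ := l.foldr (fun a r => (a:ℝ) + w * r) 0

@[simp] lemma eZ_nil (w : ℝ) : eZ [] w = 0 := rfl
@[simp] lemma eZ_cons (a : ℤ) (l : List ℤ) (w : ℝ) : eZ (a :: l) w = a + w * eZ l w := rfl
@[simp] lemma eQ_nil (w : ℝ) : eQ [] w = 0 := rfl
@[simp] lemma eQ_cons (a : ℚ) (l : List ℚ) (w : ℝ) : eQ (a :: l) w = a + w * eQ l w := rfl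

/-- lower bound on `[0,1]` -/
def lbZ : List ℤ → ℤ
  | [] => 0
  | a :: l => fZ (lbZ l) (fun t : ℤ => a + if t < 0 then t else 0)

lemma lbZ_le (l : List ℤ) {w : ℝ} (h0 : 0 ≤ w) (h1 : w ≤ 1) : (lbZ l : ℝ) ≤ eZ l w := by
  induction l with
  | nil => simp [lbZ]
  | cons a l ih =>
    simp only [lbZ, eZ_cons, fZ_eq]
    push_cast
    split_ifs with h
    · have h' : (lbZ l : ℝ) < 0 := by exact_mod_cast h
      nlinarith
    · have h' : (0:ℝ) ≤ (lbZ l : ℝ) := by exact_mod_cast (not_lt.1 h)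
      push_cast
      nlinarith [mul_nonneg h0 (h'.trans ih)]

/-- substitute `w/2` and clear denominators -/
def dbl : List ℤ → List ℤ
  | [] => []
  | a :: l => (a * ((2 ^ l.length : ℕ) : ℤ)) :: dbl l

lemma dbl_eval (l : List ℤ) (w : ℝ) : 2 * eZ (dbl l) w = 2 ^ l.length * eZ l (w/2) := by
  induction l with
  | nil => simp [dbl]
  | cons a l ih =>
    simp only [dbl, eZ_cons, List.length_cons, pow_succ]
    push_cast
    linear_combination w * ih

/-- addition -/
def addZ : List ℤ → List ℤ → List ℤ
  | [], m => m
  | l, [] => l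
  | a :: l, b :: m => Int.add a b :: addZ l m

lemma addZ_eval (l m : List ℤ) (w : ℝ) : eZ (addZ l m) w = eZ l w + eZ m w := by
  induction l generalizing m with
  | nil => simp [addZ]
  | cons a l ih =>
    cases m with
    | nil => simp [addZ]
    | cons b m => rw [addZ, show Int.add a b = a + b from rfl]; simp [ih]; ring

/-- substitute `1 + w` -/
def shZ : List ℤ → List ℤ
  | [] => []
  | a :: l => fL (shZ l) (fun t => addZ (a :: t) t)

lemma shZ_eval (l : List ℤ) (w : ℝ) : eZ (shZ l) w = eZ l (1 + w) := by
  induction l with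
  | nil => simp [shZ]
  | cons a l ih => simp [shZ, addZ_eval, ih]; ring

/-- adaptive positivity check on `[0,1]` -/
def posZ : ℕ → List ℤ → Bool
  | 0, l => decide (0 ≤ lbZ l)
  | f+1, l => if 0 ≤ lbZ l then true else fL (dbl l) (fun d => posZ f d && fL (shZ d) (fun e => posZ f e))

lemma posZ_sound (f : ℕ) (l : List ℤ) (h : posZ f l = true) {w : ℝ} (h0 : 0 ≤ w) (h1 : w ≤ 1) : 0 ≤ eZ l w := by
  induction f generalizing l w with
  | zero =>
    simp only [posZ, decide_eq_true_eq] at h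
    have := lbZ_le l h0 h1
    have h' : (0:ℝ) ≤ lbZ l := by exact_mod_cast h
    linarith
  | succ f ih =>
    rw [posZ] at h
    split_ifs at h with hl
    · have := lbZ_le l h0 h1
      have h' : (0:ℝ) ≤ lbZ l := by exact_mod_cast hl
      linarith
    · simp only [Bool.and_eq_true, fL_eq] at h
      have hp : (0:ℝ) < 2 ^ l.length := by positivity
      by_cases hw : w ≤ 1/2
      · have q := ih _ h.1 (w := 2 * w) (by linarith) (by linarith)
        have e := dbl_eval l (2 * w)
        rw [show 2 * w / 2 = w by ring] at e
        by_contra hcon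
        push Not at hcon
        nlinarith [mul_neg_of_pos_of_neg hp hcon]
      · have q := ih _ h.2 (w := 2 * w - 1) (by linarith) (by linarith)
        rw [shZ_eval] at q
        have e := dbl_eval l (2 * w)
        rw [show 2 * w / 2 = w by ring] at e
        rw [show 1 + (2 * w - 1) = 2 * w by ring] at q
        by_contra hcon
        push Not at hcon
        nlinarith [mul_neg_of_pos_of_neg hp hcon]

/-- addition -/
def addQ : List ℚ → List ℚ → List ℚ
  | [], m => m
  | l, [] => l
  | a :: l, b :: m => (a + b) :: addQ l m

lemma addQ_eval (l m : List ℚ) (w : ℝ) : eQ (addQ l m) w = eQ l w + eQ m w := by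
  induction l generalizing m with
  | nil => simp [addQ]
  | cons a l ih =>
    cases m with
    | nil => simp [addQ]
    | cons b m => simp [addQ, ih]; ring

/-- scalar multiplication -/
def smQ (q : ℚ) (l : List ℚ) : List ℚ := l.map (fun a => q * a)

lemma smQ_eval (q : ℚ) (l : List ℚ) (w : ℝ) : eQ (smQ q l) w = q * eQ l w := by
  induction l with
  | nil => simp [smQ]
  | cons a l ih => simp only [smQ, List.map_cons, eQ_cons] at ih ⊢; rw [ih]; push_cast; ring

/-- multiplication -/
def mulQ : List ℚ → List ℚ → List ℚ
  | [], _ => []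
  | a :: l, m => addQ (smQ a m) (0 :: mulQ l m)

lemma mulQ_eval (l m : List ℚ) (w : ℝ) : eQ (mulQ l m) w = eQ l w * eQ m w := by
  induction l with
  | nil => simp [mulQ]
  | cons a l ih => simp [mulQ, addQ_eval, smQ_eval, ih]; ring

/-- substitute `α + β w` -/
def afQ (α β : ℚ) : List ℚ → List ℚ
  | [] => []
  | a :: l => (fun t => addQ (a :: smQ β t) (smQ α t)) (afQ α β l)

lemma afQ_eval (α β : ℚ) (l : List ℚ) (w : ℝ) : eQ (afQ α β l) w = eQ l (α + β * w) := by
  induction l with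
  | nil => simp [afQ]
  | cons a l ih => simp [afQ, addQ_eval, smQ_eval, ih]; ring

/-- sum of absolute values -/
def absQ (l : List ℚ) : ℚ := l.foldr (fun a r => |a| + r) 0

lemma absQ_le (l : List ℚ) {w : ℝ} (h0 : 0 ≤ w) (h1 : w ≤ 1) : |eQ l w| ≤ (absQ l : ℝ) := by
  induction l with
  | nil => simp [absQ]
  | cons a l ih =>
    have e : absQ (a :: l) = |a| + absQ l := rfl
    rw [e, eQ_cons]
    push_cast
    refine (abs_add_le _ _).trans ?_
    rw [abs_mul, abs_of_nonneg h0]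
    nlinarith [abs_nonneg (eQ l w)]

/-- rounding down -/
def flQ (l : List ℚ) : List ℤ := l.map (fun a => (a * 2^40).floor)

lemma flQ_le (l : List ℚ) {w : ℝ} (h0 : 0 ≤ w) : eZ (flQ l) w ≤ 2^40 * eQ l w := by
  induction l with
  | nil => simp [flQ]
  | cons a l ih =>
    simp only [flQ, List.map_cons, eZ_cons, eQ_cons] at ih ⊢
    have h1 : (((a * 2^40).floor : ℤ) : ℝ) ≤ 2^40 * a := by
      have := Int.floor_le (a * 2^40 : ℚ)
      have h2 : (((⌊a * 2^40⌋ : ℤ) : ℚ) : ℝ) ≤ ((a * 2^40 : ℚ) : ℝ) := by exact_mod_cast this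
      push_cast at h2
      linarith [show (((a * 2^40).floor : ℤ) : ℝ) = ((⌊a * 2^40⌋ : ℤ) : ℝ) from rfl]
    nlinarith [mul_le_mul_of_nonneg_left ih h0]

/-- positivity check on `[0,1]` for rational polynomials -/
def posQ (l : List ℚ) : Bool := posZ 14 (flQ l)

lemma posQ_sound (l : List ℚ) (h : posQ l = true) {w : ℝ} (h0 : 0 ≤ w) (h1 : w ≤ 1) : 0 ≤ eQ l w := by
  have a := posZ_sound _ _ h h0 h1
  have b := flQ_le l h0
  nlinarith

/-- all coefficients nonnegative -/
def nnQ (l : List ℚ) : Bool := l.all (fun a => decide (0 ≤ a))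

lemma nnQ_sound (l : List ℚ) (h : nnQ l = true) {w : ℝ} (h0 : 0 ≤ w) : 0 ≤ eQ l w := by
  induction l with
  | nil => simp
  | cons a l ih =>
    simp only [nnQ, List.all_cons, Bool.and_eq_true, decide_eq_true_eq] at h ih
    rw [eQ_cons]
    have h1 : (0:ℝ) ≤ a := by exact_mod_cast h.1
    have := ih h.2
    positivity

/-- scalar multiplication -/
def smZ (q : ℤ) : List ℤ → List ℤ
  | [] => []
  | a :: l => Int.mul q a :: smZ q l

lemma smZ_eval (q : ℤ) (l : List ℤ) (w : ℝ) : eZ (smZ q l) w = q * eZ l w := by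
  induction l with
  | nil => simp [smZ]
  | cons a l ih => rw [smZ, show Int.mul q a = q * a from rfl]; simp only [eZ_cons, ih]; push_cast; ring

/-- multiplication -/
def mulZ : List ℤ → List ℤ → List ℤ
  | [], _ => []
  | a :: l, m => addZ (smZ a m) (0 :: mulZ l m)

lemma mulZ_eval (l m : List ℤ) (w : ℝ) : eZ (mulZ l m) w = eZ l w * eZ m w := by
  induction l with
  | nil => simp [mulZ]
  | cons a l ih => simp [mulZ, addZ_eval, smZ_eval, ih]; ring

/-- pointwise product -/
def zipZ : List ℤ → List ℤ → List ℤ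
  | a :: l, b :: m => Int.mul a b :: zipZ l m
  | _, _ => []

/-- weights for the substitution of `9/7 y` -/
def Ws : List ℤ := [117649, 151263, 194481, 250047, 321489, 413343, 531441]

/-- linear combination -/
def comb : List ℤ → List (List ℤ) → List ℤ
  | a :: l, b :: m => addZ (smZ a b) (comb l m)
  | _, _ => []

/-- weights for the substitution of `1 + 2/7 w` -/
def Ks : List (List ℤ) := [[117649], [117649, 33614], [117649, 67228, 9604], [117649, 100842, 28812, 2744], [117649, 134456, 57624, 10976, 784], [117649, 168070, 96040, 27440, 3920, 224], [117649, 201684, 144060, 54880, 11760, 1344, 64]]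

lemma len7 (l : List ℤ) (h : l.length = 7) : ∃ a b c d e f g, l = [a, b, c, d, e, f, g] := by
  match l, h with
  | [a, b, c, d, e, f, g], _ => exact ⟨a, b, c, d, e, f, g, rfl⟩

lemma zipZ_eval (l : List ℤ) (h : l.length = 7) (y : ℝ) : eZ (zipZ l Ws) y = 7^6 * eZ l (9/7 * y) := by
  obtain ⟨a, b, c, d, e, f, g, rfl⟩ := len7 l h
  have hm : ∀ a b : ℤ, Int.mul a b = a * b := fun _ _ => rfl
  simp only [zipZ, Ws, eZ_cons, eZ_nil, hm]
  push_cast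
  ring

lemma zipZ_len (l : List ℤ) (h : l.length = 7) : (zipZ l Ws).length = 7 := by
  obtain ⟨a, b, c, d, e, f, g, rfl⟩ := len7 l h
  simp [zipZ, Ws]

lemma comb_eval (l : List ℤ) (h : l.length = 7) (w : ℝ) : eZ (comb l Ks) w = 7^6 * eZ l (1 + 2/7 * w) := by
  obtain ⟨a, b, c, d, e, f, g, rfl⟩ := len7 l h
  simp only [comb, Ks, addZ_eval, smZ_eval, eZ_cons, eZ_nil]
  push_cast
  ring

/-- sum of absolute values -/
def absZ : List ℤ → ℤ
  | [] => 0
  | a :: l => (if a < 0 then -a else a) + absZ l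

lemma absZ_le (l : List ℤ) {w : ℝ} (h0 : 0 ≤ w) (h1 : w ≤ 1) : |eZ l w| ≤ (absZ l : ℝ) := by
  induction l with
  | nil => simp [absZ]
  | cons a l ih =>
    have e : absZ (a :: l) = |a| + absZ l := by
      simp only [absZ]
      split_ifs with h
      · rw [abs_of_neg h]
      · rw [abs_of_nonneg (not_lt.1 h)]
    rw [e, eZ_cons]
    push_cast
    refine (abs_add_le _ _).trans ?_
    rw [abs_mul, abs_of_nonneg h0]
    nlinarith [abs_nonneg (eZ l w)]

end TR
end

section
namespace TR

/-- lower bound for `log (9/7)` -/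
def lr : ℚ := 212935852471/847288609443

/-- integer multiple of the Taylor polynomial of the logarithm -/
def logZ (j : ℤ) : List ℤ := [1288909456023706934550000 * j, 1465335066901684752900000, -209333580985954964700000, 39873063044943802800000, -8544227795345100600000, 1952966353221737280000, -464991988862318400000, 113875589109139200000, -28468897277284800000]

/-- check one piece -/
def piece (Q P : List ℤ) (j : ℤ) : Bool :=
  fL (comb P Ks) (fun p => fL (addZ [-(102573454683117932703 * absZ p)] (addZ (smZ 5128672734155896635150000 (comb Q Ks))
    (mulZ (logZ j) p))) (fun l => posZ 14 l))

/-- check consecutive pieces -/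
def loop : ℕ → List ℤ → List ℤ → ℤ → Bool
  | 0, _, _, _ => true
  | k+1, Q, P, j => piece Q P j && fL (zipZ Q Ws) (fun Q' => fL (zipZ P Ws) (fun P' => fZ (j + 1) (fun j' => loop k Q' P' j')))

/-- integer multiples -/
def toZ (l : List ℚ) : List ℤ := l.map (fun a => (a * (42000 * 3^73)).floor)

/-- check that `toZ` is exact -/
def exQ (l : List ℚ) (m : List ℤ) : Bool := decide (m.map (fun a : ℤ => (a:ℚ)) = l.map (fun a => a * (42000 * 3^73)))

/-- check near zero -/
def tail0 (Q P : List ℚ) (I : ℕ) : Bool :=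
  (fun P0 => posQ (smQ (-1) P0) && posQ (addQ (afQ 0 ((7/9)^I) Q) (smQ (-(I * lr)) P0))) (afQ 0 ((7/9)^I) P)

/-- check near infinity -/
def tail1 (Q P : List ℚ) (J : ℕ) : Bool :=
  (fun P0 Q0 => (nnQ P0 && nnQ (addQ Q0 (smQ (J * lr) P0))) ||
    (nnQ (smQ (-1) P0) && nnQ (addQ Q0 (mulQ [J * (lr + 1/10^11), 1] P0))))
    (afQ ((9/7)^J) ((9/7)^J) P) (afQ ((9/7)^J) ((9/7)^J) Q)

/-- scaling to the start of the grid -/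
def stI (I : ℕ) (l : List ℚ) : List ℚ := smQ (9^(6*I)) (afQ 0 ((7/9)^I) l)

/-- the complete check -/
def chk (Q P : List ℚ) (I J : ℕ) : Bool :=
  tail0 Q P I && tail1 Q P J && (fun Q0 P0 => fL (toZ Q0) (fun q => fL (toZ P0) (fun p => exQ Q0 q && exQ P0 p &&
    decide (q.length = 7) && decide (p.length = 7) && loop (I + J) q p (-(I : ℤ))))) (stI I Q) (stI I P)

/-- scaled polynomial multiplying the logarithm -/
def PP (c : Fin 7 → ℚ) (m : ℚ) : List ℚ := afQ 0 m [c 0, c 1, c 2, c 3, c 4, c 5, c 6]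

/-- scaled polynomial part -/
def QQ (c : Fin 7 → ℚ) (η m : ℚ) : List ℚ := afQ 0 m
  [1/1000 - η * (c 1 + c 2 + 2 * c 3 + 6 * c 4 + 24 * c 5 + 120 * c 6),
   15 - 4/1000 - η * (2 * c 2 + 3 * c 3 + 8 * c 4 + 30 * c 5 + 144 * c 6),
   -30 - η * (3 * c 3 + 6 * c 4 + 20 * c 5 + 90 * c 6),
   8 - η * (4 * c 4 + 10 * c 5 + 40 * c 6),
   - η * (5 * c 5 + 15 * c 6),
   - η * (6 * c 6), 0]

/-- the check for a given parameter -/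
def chkm (c : Fin 7 → ℚ) (η m : ℚ) (I J : ℕ) : Bool := chk (QQ c η m) (PP c m) I J

end TR
end

section
namespace TR

lemma log_rho : (lr : ℝ) ≤ Real.log (9/7) ∧ Real.log (9/7) ≤ (lr : ℝ) + 1/10^11 := by
  have h := Real.abs_log_sub_add_sum_range_le (x := -(2/7 : ℝ)) (by norm_num [abs_lt]) 30
  rw [show (1:ℝ) - -(2/7) = 9/7 by norm_num, abs_le] at h
  obtain ⟨h1, h2⟩ := h
  norm_num [Finset.sum_range_succ, lr] at h1 h2 ⊢
  constructor <;> linarith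

lemma logZ_eval {j : ℤ} {r : ℝ} (hr : 0 < r) {w : ℝ} (h0 : 0 ≤ w) (h1 : w ≤ 1)
    (hL : |Real.log r - j * lr| ≤ 1/10^8) :
    |5128672734155896635150000 * Real.log (r * (1 + 2/7 * w)) - eZ (logZ j) w| ≤ 102573454683117932703 := by
  rw [Real.log_mul hr.ne' (by positivity)]
  have h := Real.abs_log_sub_add_sum_range_le (x := -(2/7 * w)) (by rw [abs_neg, abs_of_nonneg (by positivity)]; linarith) 8
  rw [abs_neg, abs_of_nonneg (by positivity : 0 ≤ 2/7 * w), sub_neg_eq_add] at h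
  have hb : (2/7 * w)^(8+1) / (1 - 2/7 * w) ≤ 19/10^6 := by
    rw [div_le_iff₀ (by linarith)]
    have : (2/7 * w)^9 ≤ (2/7)^9 := by
      apply pow_le_pow_left₀ (by positivity)
      linarith
    norm_num at this ⊢
    linarith
  have h' := h.trans hb
  rw [abs_le] at h' hL ⊢
  have e2 : eZ (logZ j) w = 5128672734155896635150000 * (j * lr - ∑ i ∈ Finset.range 8, (-(2/7*w))^(i+1)/((i:ℝ)+1)) := by
    simp only [logZ, Finset.sum_range_succ, Finset.sum_range_zero, eZ_cons, eZ_nil, lr]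
    push_cast
    ring
  rw [e2]
  constructor <;> norm_num at h' hL ⊢ <;> linarith [h'.1, h'.2, hL.1, hL.2]

lemma piece_sound {Q P : List ℤ} {j : ℤ} (h : piece Q P j = true) (hQ : Q.length = 7) (hP : P.length = 7)
    {f g : ℝ → ℝ} {C r : ℝ} (hC : 0 < C) (hr : 0 < r) (hf : ∀ y, eZ Q y = C * f (r * y)) (hg : ∀ y, eZ P y = C * g (r * y))
    (hL : |Real.log r - j * lr| ≤ 1/10^8) {x : ℝ} (hx0 : r ≤ x) (hx1 : x ≤ r * (9/7)) :
    0 ≤ f x + g x * Real.log x := by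
  set w := (x / r - 1) * (7/2) with hw
  have hxw : r * (1 + 2/7 * w) = x := by rw [hw]; field_simp; ring
  have h0 : 0 ≤ w := by
    have : 1 ≤ x / r := by rwa [le_div_iff₀ hr, one_mul]
    linarith
  have h1 : w ≤ 1 := by
    have : x / r ≤ 9/7 := by rw [div_le_iff₀ hr]; linarith
    linarith
  simp only [piece, fL_eq] at h
  have q := posZ_sound _ _ h h0 h1
  have hT := logZ_eval hr h0 h1 hL
  have hA := absZ_le (comb P Ks) h0 h1
  rw [addZ_eval, addZ_eval, mulZ_eval, smZ_eval, comb_eval _ hQ, comb_eval _ hP, hf, hg, hxw] at q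
  rw [comb_eval _ hP, hg, hxw] at hA
  rw [hxw] at hT
  simp only [eZ_cons, eZ_nil, mul_zero, add_zero] at q
  push_cast at q
  set X := (7:ℝ)^6 * (C * g x) with hX
  have hm : |X * (5128672734155896635150000 * Real.log x - eZ (logZ j) w)| ≤
      (absZ (comb P Ks) : ℝ) * 102573454683117932703 := by
    rw [abs_mul]
    exact mul_le_mul hA hT (abs_nonneg _) ((abs_nonneg _).trans hA)
  have := (abs_le.1 hm).1
  rw [mul_sub] at this
  have h3 : 0 ≤ (5128672734155896635150000 * 7^6 * C) * (f x + g x * Real.log x) := by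
    have e : (5128672734155896635150000 * 7^6 * C) * (f x + g x * Real.log x) =
      5128672734155896635150000 * (7^6 * (C * f x)) + X * (5128672734155896635150000 * Real.log x) := by
      rw [hX]; ring
    rw [e]
    linarith
  exact nonneg_of_mul_nonneg_right h3 (by positivity)

lemma loop_sound {f g : ℝ → ℝ} (k : ℕ) : ∀ {Q P : List ℤ} {j : ℤ} {C r : ℝ} (δ : ℝ), loop k Q P j = true →
    Q.length = 7 → P.length = 7 → 0 < C → 0 < r → (∀ y, eZ Q y = C * f (r * y)) → (∀ y, eZ P y = C * g (r * y)) →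
    |Real.log r - j * lr| ≤ δ → δ + k * (1/10^11) ≤ 1/10^8 → ∀ {x : ℝ}, r ≤ x → x ≤ r * (9/7)^k →
    0 < k → 0 ≤ f x + g x * Real.log x := by
  induction k with
  | zero => intro Q P j C r δ _ _ _ _ _ _ _ _ _ x _ _ h; omega
  | succ k ih =>
    intro Q P j C r δ h hQ hP hC hr hf hg hL hδ x h0 h1 _
    simp only [loop, Bool.and_eq_true, fL_eq, fZ_eq] at h
    by_cases hx : x ≤ r * (9/7)
    · refine piece_sound h.1 hQ hP hC hr hf hg (hL.trans ?_) h0 hx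
      have : (0:ℝ) ≤ ((k+1 : ℕ):ℝ) * (1/10^11) := by positivity
      linarith
    · have hk : 0 < k := by
        rcases Nat.eq_zero_or_pos k with rfl | h'
        · simp at h1 hx; linarith
        · exact h'
      push Not at hx
      refine ih (C := 7^6 * C) (r := r * (9/7)) (δ + 1/10^11) h.2 (zipZ_len _ hQ) (zipZ_len _ hP) (by positivity) (by positivity) ?_ ?_ ?_
        (by push_cast at hδ ⊢; linarith) hx.le (by rw [pow_succ] at h1; linarith) hk
      · intro y
        rw [zipZ_eval _ hQ, hf, mul_assoc r, mul_assoc]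
      · intro y
        rw [zipZ_eval _ hP, hg, mul_assoc r, mul_assoc]
      push_cast
      rw [Real.log_mul hr.ne' (by norm_num)]
      have := log_rho
      rw [abs_le] at hL ⊢
      constructor <;> linarith [hL.1, hL.2, this.1, this.2]

lemma exQ_sound {l : List ℚ} {m : List ℤ} (h : exQ l m = true) (w : ℝ) : eZ m w = 42000 * 3^73 * eQ l w := by
  simp only [exQ, decide_eq_true_eq] at h
  induction l generalizing m with
  | nil =>
    cases m with
    | nil => simp
    | cons b m => simp at h
  | cons a l ih =>
    cases m with
    | nil => simp at h
    | cons b m =>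
      simp only [List.map_cons, List.cons.injEq] at h
      rw [eZ_cons, eQ_cons, ih h.2]
      have : ((b:ℚ):ℝ) = ((a * (42000 * 3^73) : ℚ) : ℝ) := by rw [h.1]
      push_cast at this
      rw [this]; ring

lemma chk_sound {Q P : List ℚ} {I J : ℕ} (hIJ : 2 * I + J ≤ 100) (hI : 0 < I) (h : chk Q P I J = true) {x : ℝ} (hx : 0 < x) :
    0 ≤ eQ Q x + eQ P x * Real.log x := by
  simp only [chk, Bool.and_eq_true] at h
  obtain ⟨⟨ha, hb⟩, hc⟩ := h
  obtain ⟨r1, r2⟩ := log_rho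
  have hlog : Real.log (7/9) = -Real.log (9/7) := by rw [← Real.log_inv]; norm_num
  have hIc : (I:ℝ) ≤ 100 := by exact_mod_cast (by omega : I ≤ 100)
  have hIJc : 2 * (I:ℝ) + J ≤ 100 := by exact_mod_cast hIJ
  rcases le_total x ((7/9)^I) with h1 | h1
  · -- near zero
    simp only [tail0, Bool.and_eq_true] at ha
    have hp : (0:ℝ) < (7/9)^I := by positivity
    set w := x / (7/9)^I with hw
    have hxw : (7/9)^I * w = x := by rw [hw]; field_simp
    have w0 : 0 ≤ w := by positivity
    have w1 : w ≤ 1 := by rw [hw, div_le_one hp]; exact h1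
    have q1 := posQ_sound _ ha.1 w0 w1
    have q2 := posQ_sound _ ha.2 w0 w1
    rw [smQ_eval, afQ_eval] at q1
    rw [addQ_eval, smQ_eval, afQ_eval, afQ_eval] at q2
    push_cast at q1 q2
    rw [zero_add, hxw] at q1 q2
    have hl : Real.log x ≤ -(I * lr) := by
      have := Real.log_le_log hx h1
      rw [Real.log_pow, hlog] at this
      have h3 : (I:ℝ) * lr ≤ I * Real.log (9/7) := by gcongr
      linarith
    nlinarith
  rcases le_total x ((9/7)^J) with h2 | h2
  · simp only [fL_eq, Bool.and_eq_true, decide_eq_true_eq] at hc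
    obtain ⟨⟨⟨⟨e1, e2⟩, e3⟩, e4⟩, hc⟩ := hc
    refine loop_sound (f := eQ Q) (g := eQ P) (I+J) (C := 42000 * 3^73 * 9^(6*I)) (r := (7/9)^I) (I * (1/10^11)) hc e3 e4 (by positivity) (by positivity) ?_ ?_ ?_ ?_ h1 ?_ (by omega)
    · intro y
      rw [exQ_sound e1, stI, smQ_eval, afQ_eval]
      push_cast
      rw [zero_add]; ring
    · intro y
      rw [exQ_sound e2, stI, smQ_eval, afQ_eval]
      push_cast
      rw [zero_add]; ring
    · push_cast
      rw [Real.log_pow, hlog, abs_le]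
      have h3 : (I:ℝ) * lr ≤ I * Real.log (9/7) := by gcongr
      have h4 : (I:ℝ) * Real.log (9/7) ≤ I * (lr + 1/10^11) := by gcongr
      have h5 : (0:ℝ) ≤ I * (1/10^11) := by positivity
      constructor <;> linarith
    · push_cast
      norm_num
      linarith
    · rw [pow_add, ← mul_assoc, ← mul_pow]
      norm_num at h2 ⊢
      exact h2
  · have hp : (0:ℝ) < (9/7)^J := by positivity
    set u := x / (9/7)^J - 1 with hu
    have hxu : (9/7)^J + (9/7)^J * u = x := by rw [hu]; field_simp; ring
    have u0 : 0 ≤ u := by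
      have : 1 ≤ x / (9/7)^J := by rwa [le_div_iff₀ hp, one_mul]
      linarith
    have hl : Real.log x = J * Real.log (9/7) + Real.log (1 + u) := by
      rw [← hxu, ← Real.log_pow, ← Real.log_mul hp.ne' (by positivity)]; congr 1; ring
    have hl0 : 0 ≤ Real.log (1 + u) := Real.log_nonneg (by linarith)
    have hl1 : Real.log (1 + u) ≤ u := by
      have := Real.log_le_sub_one_of_pos (by linarith : 0 < 1 + u)
      linarith
    have h3 : (J:ℝ) * lr ≤ J * Real.log (9/7) := by gcongr
    have h4 : (J:ℝ) * Real.log (9/7) ≤ J * (lr + 1/10^11) := by gcongr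
    simp only [tail1, Bool.or_eq_true, Bool.and_eq_true] at hb
    rcases hb with hb | hb
    · have q1 := nnQ_sound _ hb.1 u0
      have q2 := nnQ_sound _ hb.2 u0
      rw [afQ_eval] at q1
      rw [addQ_eval, smQ_eval, afQ_eval, afQ_eval] at q2
      push_cast at q1 q2
      rw [hxu] at q1 q2
      nlinarith
    · have q1 := nnQ_sound _ hb.1 u0
      have q2 := nnQ_sound _ hb.2 u0
      rw [smQ_eval, afQ_eval] at q1
      rw [addQ_eval, mulQ_eval, afQ_eval, afQ_eval] at q2
      push_cast at q1 q2
      rw [hxu] at q1 q2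
      simp only [eQ_cons, eQ_nil] at q2
      push_cast at q2
      nlinarith

/-- real version of the coefficient vector -/
noncomputable def cR (c : Fin 7 → ℚ) : Fin 7 → ℝ := fun i => (c i : ℝ)

/-- the certificate function -/
noncomputable def ph (c : Fin 7 → ℝ) (η L v : ℝ) : ℝ :=
  fp (1/1000) v + (c 0 + hP c v) * (Real.log v - L) - η * hD c v

lemma chkm_sound {c : Fin 7 → ℚ} {η m : ℚ} (hm : 0 < m) {I J : ℕ} (hIJ : 2 * I + J ≤ 100) (hI : 0 < I)
    (h : chkm c η m I J = true) {v : ℝ} (hv : 0 < v) : 0 ≤ ph (cR c) η (Real.log m) v := by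
  have hm' : (0:ℝ) < m := by exact_mod_cast hm
  have := chk_sound hIJ hI h (div_pos hv hm')
  rw [PP, QQ, afQ_eval, afQ_eval, Real.log_div hv.ne' hm'.ne'] at this
  push_cast at this
  rw [zero_add, mul_div_cancel₀ _ hm'.ne'] at this
  refine this.trans_eq ?_
  simp only [ph, fp, hP, hD, cR, eQ_cons, eQ_nil]
  push_cast
  ring

lemma ph_interp {c : Fin 7 → ℝ} {η L1 L2 v : ℝ} (h1 : 0 ≤ ph c η L1 v) (h2 : 0 ≤ ph c η L2 v) {L : ℝ}
    (hL1 : L1 ≤ L) (hL2 : L ≤ L2) : 0 ≤ ph c η L v := by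
  unfold ph at *
  by_contra hcon
  push Not at hcon
  rcases le_total 0 (c 0 + hP c v) with h | h
  · nlinarith
  · nlinarith

lemma ph_eta {c : Fin 7 → ℝ} {η1 η2 L v : ℝ} (h1 : 0 ≤ ph c η1 L v) (h2 : 0 ≤ ph c η2 L v) {η : ℝ}
    (hL1 : η1 ≤ η) (hL2 : η ≤ η2) : 0 ≤ ph c η L v := by
  unfold ph at *
  by_contra hcon
  push Not at hcon
  rcases le_total 0 (hD c v) with h | h
  · nlinarith
  · nlinarith

/-- the last vector -/
def cLast : Fin 7 → ℚ := ![0, -40, 0, 0, 0, 0, 0]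

/-- coefficient vector -/
def cA0 : Fin 7 → ℚ := ![-1095922/1594323, 2469992/1594323, 12457814/1594323, -7677262/1594323, 857350/1594323, -28075/531441, 3431/1594323]
/-- coefficient vector -/
def cA1 : Fin 7 → ℚ := ![-1099166/1594323, 843037/531441, 4149763/531441, -7716592/1594323, 289408/531441, -85727/1594323, 3506/1594323]
/-- coefficient vector -/
def cA2 : Fin 7 → ℚ := ![-1111702/1594323, 888202/531441, 12415961/1594323, -7795069/1594323, 893843/1594323, -3313/59049, 3694/1594323]
/-- coefficient vector -/
def cA3 : Fin 7 → ℚ := ![-137209/177147, 3151945/1594323, 12042181/1594323, -7737473/1594323, 98107/177147, -29624/531441, 3692/1594323]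
/-- coefficient vector -/
def cA4 : Fin 7 → ℚ := ![-457466/531441, 4050875/1594323, 11119955/1594323, -7475911/1594323, 824206/1594323, -27761/531441, 3490/1594323]
/-- coefficient vector -/
def cA5 : Fin 7 → ℚ := ![-904933/531441, 9358651/1594323, 4733272/1594323, -4519507/1594323, 29404/531441, 0, 0]
/-- coefficient vector -/
def cA6 : Fin 7 → ℚ := ![-2424517/1594323, 10506064/1594323, 3375343/1594323, -4457270/1594323, 72787/1594323, 0, 0]
/-- coefficient vector -/
def cA7 : Fin 7 → ℚ := ![-1141012/1594323, 8890934/1594323, 3361496/1594323, -4904785/1594323, 93617/1594323, 0, 0]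
/-- coefficient vector -/
def cA8 : Fin 7 → ℚ := ![-2005459/531441, 4990271/531441, -44195/531441, -541028/177147, 93907/1594323, 0, 0]
/-- coefficient vector -/
def cA9 : Fin 7 → ℚ := ![-5502485/531441, 3233585/177147, -845845/177147, -3951565/1594323, 50326/1594323, 0, 0]
/-- coefficient vector -/
def cB0 : Fin 7 → ℚ := ![-28835/59049, 26686/59049, 14278043/1594323, -8719555/1594323, 377921/531441, -117887/1594323, 4966/1594323]
/-- coefficient vector -/
def cB1 : Fin 7 → ℚ := ![-862475/1594323, 1122482/1594323, 4690274/531441, -8803525/1594323, 1166713/1594323, -41063/531441, 5249/1594323]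
/-- coefficient vector -/
def cB2 : Fin 7 → ℚ := ![-115874/177147, 2347849/1594323, 12674909/1594323, -2772592/531441, 1046192/1594323, -110203/1594323, 524/177147]
/-- coefficient vector -/
def cB3 : Fin 7 → ℚ := ![-897896/531441, 8811241/1594323, 4717517/1594323, -1517990/531441, 29992/531441, 0, 0]
/-- coefficient vector -/
def cB4 : Fin 7 → ℚ := ![-727951/531441, 9890089/1594323, 3249619/1594323, -167923/59049, 75952/1594323, 0, 0]
/-- coefficient vector -/
def cB5 : Fin 7 → ℚ := ![-1293902/1594323, 9076207/1594323, 108559/59049, -1672720/531441, 3775/59049, 0, 0]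
/-- coefficient vector -/
def cB6 : Fin 7 → ℚ := ![-17634314/1594323, 28033193/1594323, -1939409/531441, -4040485/1594323, 16843/531441, 0, 0]
/-- coefficient vector -/
def cB7 : Fin 7 → ℚ := ![-15995065/1594323, 365387/19683, -8815399/1594323, -414059/177147, 44563/1594323, 0, 0]

/-- table row: coefficients and endpoint interval -/
def tabA : List ((Fin 7 → ℚ) × ℚ × ℚ) := [(cA0, 27242/59049, 9178/19683), (cA1, 9178/19683, 27977/59049), (cA2, 27977/59049, 28874/59049), (cA3, 28874/59049, 30262/59049), (cA4, 30262/59049, 33173/59049), (cA5, 33173/59049, 39556/59049), (cA6, 39556/59049, 54779/59049), (cA7, 54779/59049, 87646/59049), (cA8, 87646/59049, 46745/19683), (cA9, 46745/19683, 4)]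
/-- table row: coefficients and endpoint interval -/
def tabB : List ((Fin 7 → ℚ) × ℚ × ℚ) := [(cB0, 27242/59049, 28160/59049), (cB1, 28160/59049, 30055/59049), (cB2, 30055/59049, 34100/59049), (cB3, 34100/59049, 43277/59049), (cB4, 43277/59049, 66565/59049), (cB5, 66565/59049, 11834/6561), (cB6, 11834/6561, 56803/19683), (cB7, 56803/19683, 5)]

/-- endpoint checks for one row -/
def rowOK (η1 η2 : ℚ) (t : (Fin 7 → ℚ) × ℚ × ℚ) : Bool :=
  decide (0 < t.2.1) && decide (0 < t.2.2) && (chkm t.1 η1 t.2.1 11 20 && chkm t.1 η1 t.2.2 11 20) &&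
    (decide (η1 = η2) || (chkm t.1 η2 t.2.1 11 20 && chkm t.1 η2 t.2.2 11 20))

lemma rowOK_sound {η1 η2 : ℚ} {t : (Fin 7 → ℚ) × ℚ × ℚ} (h : rowOK η1 η2 t = true) {η m : ℝ}
    (he1 : (η1:ℝ) ≤ η) (he2 : η ≤ η2) (hm1 : (t.2.1 : ℝ) ≤ m) (hm2 : m ≤ (t.2.2 : ℝ)) {v : ℝ} (hv : 0 < v) :
    0 ≤ ph (cR t.1) η (Real.log m) v := by
  simp only [rowOK, Bool.and_eq_true, Bool.or_eq_true, decide_eq_true_eq] at h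
  obtain ⟨⟨⟨p1, p2⟩, a1, a2⟩, hb⟩ := h
  have p1' : (0:ℝ) < t.2.1 := by exact_mod_cast p1
  have l1 := Real.log_le_log p1' hm1
  have l2 := Real.log_le_log (p1'.trans_le hm1) hm2
  have hb' : chkm t.1 η2 t.2.1 11 20 = true ∧ chkm t.1 η2 t.2.2 11 20 = true := by
    rcases hb with hb | hb
    · rw [← hb]; exact ⟨a1, a2⟩
    · exact hb
  obtain ⟨b1, b2⟩ := hb'
  exact ph_eta
    (ph_interp (chkm_sound p1 (by norm_num) (by norm_num) a1 hv) (chkm_sound p2 (by norm_num) (by norm_num) a2 hv) l1 l2)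
    (ph_interp (chkm_sound p1 (by norm_num) (by norm_num) b1 hv) (chkm_sound p2 (by norm_num) (by norm_num) b2 hv) l1 l2)
    he1 he2

lemma tabA_ok : (tabA.all (rowOK (5/6) (5/6))) = true := by decide +kernel
lemma tabB_ok : (tabB.all (rowOK (6/7) 1)) = true := by decide +kernel
lemma last_ok : (chkm cLast (5/6) 3 11 20 && chkm cLast 1 3 11 20) = true := by decide +kernel

lemma last_sound {η m : ℝ} (he1 : 5/6 ≤ η) (he2 : η ≤ 1) (hm : 3 ≤ m) {v : ℝ} (hv : 0 < v) :
    0 ≤ ph (cR cLast) η (Real.log m) v := by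
  have h := last_ok
  simp only [Bool.and_eq_true] at h
  have a := chkm_sound (by norm_num) (by norm_num) (by norm_num) h.1 hv
  have b := chkm_sound (by norm_num) (by norm_num) (by norm_num) h.2 hv
  have q := ph_eta a b (η := η) (by push_cast; exact he1) (by push_cast; exact he2)
  have l : Real.log ((3:ℚ):ℝ) ≤ Real.log m := Real.log_le_log (by norm_num) (by push_cast; exact hm)
  have hneg : (cR cLast 0 + hP (cR cLast) v) ≤ 0 := by
    simp [cR, cLast, hP]; exact hv.le
  unfold ph at q ⊢
  have := mul_le_mul_of_nonpos_left l hneg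
  rw [mul_sub] at q ⊢
  clear a b
  generalize Real.log ((3:ℚ):ℝ) = T at *
  linarith

/-- consecutive intervals cover -/
def chain : ℚ → List ((Fin 7 → ℚ) × ℚ × ℚ) → Bool
  | s, [] => decide (3 ≤ s)
  | s, t :: l => decide (t.2.1 ≤ s) && chain t.2.2 l

lemma chain_sound {η1 η2 : ℚ} {η : ℝ} (he1 : (η1:ℝ) ≤ η) (he2 : η ≤ η2) (h5 : 5/6 ≤ η) (h6 : η ≤ 1) (l : List ((Fin 7 → ℚ) × ℚ × ℚ)) :
    ∀ (s : ℚ), chain s l = true → l.all (rowOK η1 η2) = true → ∀ m : ℝ, (s:ℝ) ≤ m →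
    ∃ c ∈ cLast :: l.map (fun t => t.1), ∀ v : ℝ, 0 < v → 0 ≤ ph (cR c) η (Real.log m) v := by
  induction l with
  | nil =>
    intro s hs _ m hm
    simp only [chain, decide_eq_true_eq] at hs
    have hs' : (3:ℝ) ≤ s := by exact_mod_cast hs
    exact ⟨cLast, by simp, fun v hv => last_sound h5 h6 (hs'.trans hm) hv⟩
  | cons t l ih =>
    intro s hs hall m hm
    simp only [chain, Bool.and_eq_true, decide_eq_true_eq] at hs
    simp only [List.all_cons, Bool.and_eq_true] at hall
    have hs1 : (t.2.1 : ℝ) ≤ s := by exact_mod_cast hs.1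
    rcases le_total m (t.2.2 : ℝ) with h | h
    · exact ⟨t.1, by simp, fun v hv => rowOK_sound hall.1 he1 he2 (hs1.trans hm) h hv⟩
    · obtain ⟨c, hc, hh⟩ := ih _ hs.2 hall.2 m h
      refine ⟨c, ?_, hh⟩
      simp only [List.map_cons, List.mem_cons] at hc ⊢
      tauto

lemma bound_list (l : List (Fin 7 → ℚ)) : ∃ M : ℝ, 0 ≤ M ∧ ∀ c ∈ l, ∀ k, |cR c k| ≤ M := by
  induction l with
  | nil => exact ⟨0, le_rfl, by simp⟩
  | cons a l ih =>
    obtain ⟨M, h0, hM⟩ := ih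
    refine ⟨M + ∑ k, |cR a k|, by positivity, fun c hc k => ?_⟩
    have hs : |cR a k| ≤ ∑ k, |cR a k| :=
      Finset.single_le_sum (f := fun k => |cR a k|) (fun _ _ => abs_nonneg _) (Finset.mem_univ k)
    have h1 : 0 ≤ ∑ k, |cR a k| := Finset.sum_nonneg (fun _ _ => abs_nonneg _)
    rcases List.mem_cons.1 hc with rfl | hc
    · linarith
    · linarith [hM c hc k]

theorem cert_all (n : ℕ) (hn : 6 ≤ n) : Cert n (1/1000) := by
  have main : ∃ L : List (Fin 7 → ℚ), ∀ m : ℝ, mu ≤ m → ∃ c ∈ L, ∀ v : ℝ, 0 < v →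
      0 ≤ ph (cR c) (((n:ℝ) - 1)/n) (Real.log m) v := by
    have hmu : (((46135/100000 : ℚ)) : ℝ) = mu := by norm_num [mu]
    rcases hn.eq_or_lt with h | h
    · subst h
      exact ⟨_, fun m hm => chain_sound (η1 := 5/6) (η2 := 5/6) (by norm_num) (by norm_num) (by norm_num) (by norm_num) tabA
        (46135/100000) (by decide +kernel) tabA_ok m (by rw [hmu]; exact hm)⟩
    · have hn7 : (7:ℝ) ≤ n := by exact_mod_cast h
      have e1 : (6/7 : ℝ) ≤ ((n:ℝ) - 1)/n := by rw [le_div_iff₀ (by linarith)]; linarith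
      have e2 : ((n:ℝ) - 1)/n ≤ 1 := by rw [div_le_one (by linarith)]; linarith
      exact ⟨_, fun m hm => chain_sound (η1 := 6/7) (η2 := 1) (by push_cast; exact e1) (by push_cast; exact e2) (by linarith) e2 tabB
        (46135/100000) (by decide +kernel) tabB_ok m (by rw [hmu]; exact hm)⟩
  obtain ⟨L, hL⟩ := main
  obtain ⟨M, h0, hM⟩ := bound_list L
  refine ⟨M, h0, fun m hm => ?_⟩
  obtain ⟨c, hc, hv⟩ := hL m hm
  exact ⟨cR c, hM c hc, fun v hv' => hv v hv'⟩

end TR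
end

section
namespace TR
open NumberField

/-- The real embeddings of a totally real field, indexed by `Fin n`. -/
lemma exists_rho (k : Type*) [Field k] [NumberField k] (hreal : ∀ v : InfinitePlace k, v.IsReal)
    (n : ℕ) (hn : Module.finrank ℚ k = n) :
    ∃ ρ : Fin n → k →+* ℝ, (∀ x : k, ((Algebra.trace ℚ k x : ℚ) : ℝ) = ∑ a, ρ a x) ∧
      (∀ x : k, ((Algebra.norm ℚ x : ℚ) : ℝ) = ∏ a, ρ a x) := by
  have hr : ∀ φ : k →+* ℂ, ComplexEmbedding.IsReal φ := fun φ =>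
    InfinitePlace.isReal_of_mk_isReal (hreal (InfinitePlace.mk φ))
  have hc : Fintype.card (k →ₐ[ℚ] ℂ) = n := by rw [AlgHom.card, hn]
  let e : Fin n ≃ (k →ₐ[ℚ] ℂ) := (Fintype.equivFinOfCardEq hc).symm
  refine ⟨fun a => (hr (e a : k →+* ℂ)).embedding, fun x => ?_, fun x => ?_⟩
  · have h := trace_eq_sum_embeddings ℂ (K := ℚ) (x := x)
    apply Complex.ofReal_injective
    push_cast
    rw [eq_ratCast] at h
    rw [h, ← e.sum_comp]
    refine Finset.sum_congr rfl fun a _ => ?_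
    rw [ComplexEmbedding.IsReal.coe_embedding_apply]; rfl
  · have h := Algebra.norm_eq_prod_embeddings ℚ ℂ x
    apply Complex.ofReal_injective
    push_cast
    rw [eq_ratCast] at h
    rw [h, ← e.prod_comp]
    refine Finset.prod_congr rfl fun a _ => ?_
    rw [ComplexEmbedding.IsReal.coe_embedding_apply]; rfl

section
variable {k : Type*} [Field k] [NumberField k] {n : ℕ} {ρ : Fin n → k →+* ℝ}

/-- The embedding matrix. -/
noncomputable def BM (ρ : Fin n → k →+* ℝ) (ω : Module.Basis (Fin n) ℤ (𝓞 k)) :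
    Matrix (Fin n) (Fin n) ℝ := fun a j => ρ a (ω j : k)

lemma det_BM (ht : ∀ x : k, ((Algebra.trace ℚ k x : ℚ) : ℝ) = ∑ a, ρ a x)
    (ω : Module.Basis (Fin n) ℤ (𝓞 k)) : (BM ρ ω).det ^ 2 = (discr k : ℝ) := by
  have h : ((BM ρ ω).transpose * BM ρ ω) = (Algebra.traceMatrix ℤ ω).map (Int.cast : ℤ → ℝ) := by
    ext i j
    rw [Matrix.mul_apply, Matrix.map_apply, Algebra.traceMatrix_apply, Algebra.traceForm_apply]
    have h1 := Algebra.coe_trace_int (K := k) (ω i * ω j)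
    have h2 := ht ((ω i * ω j : 𝓞 k) : k)
    rw [← h1] at h2
    push_cast at h2
    rw [h2]
    refine Finset.sum_congr rfl fun a _ => ?_
    simp [BM, Matrix.transpose_apply]
  have h3 := congrArg Matrix.det h
  rw [Matrix.det_mul, Matrix.det_transpose, ← pow_two] at h3
  rw [h3, ← NumberField.discr_eq_discr k ω, Algebra.discr_def]
  exact (RingHom.map_det (Int.castRingHom ℝ) _).symm

lemma det_BM_ne (ht : ∀ x : k, ((Algebra.trace ℚ k x : ℚ) : ℝ) = ∑ a, ρ a x)
    (ω : Module.Basis (Fin n) ℤ (𝓞 k)) : (BM ρ ω).det ≠ 0 := by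
  intro h
  have := det_BM ht ω
  rw [h] at this
  have h2 := NumberField.discr_ne_zero k
  apply h2
  have : (discr k : ℝ) = 0 := by rw [← this]; simp
  exact_mod_cast this

lemma rho_sum (ω : Module.Basis (Fin n) ℤ (𝓞 k)) (l : Fin n → ℤ) (a : Fin n) :
    ρ a ((∑ j, l j • ω j : 𝓞 k) : k) = ∑ j, (l j : ℝ) * ρ a (ω j : k) := by
  have : ∀ x : 𝓞 k, ρ a (x : k) = ((ρ a).comp (algebraMap (𝓞 k) k)) x := fun x => rfl
  rw [this, map_sum]
  refine Finset.sum_congr rfl fun j _ => ?_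
  rw [map_zsmul, zsmul_eq_mul, this]

lemma BM_mulVec (ω : Module.Basis (Fin n) ℤ (𝓞 k)) (l : Fin n → ℤ) (a : Fin n) :
    (BM ρ ω).mulVec (ev l) a = ρ a ((∑ j, l j • ω j : 𝓞 k) : k) := by
  simp only [Matrix.mulVec, dotProduct, BM, ev]
  rw [rho_sum]
  exact Finset.sum_congr rfl fun j _ => mul_comm _ _

lemma BM_norm (hN : ∀ x : k, ((Algebra.norm ℚ x : ℚ) : ℝ) = ∏ a, ρ a x)
    (ω : Module.Basis (Fin n) ℤ (𝓞 k)) (l : Fin n → ℤ) (hl : l ≠ 0) : 1 ≤ |∏ a, (BM ρ ω).mulVec (ev l) a| := by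
  set x : 𝓞 k := ∑ j, l j • ω j with hx
  have hx0 : x ≠ 0 := by
    intro h0
    apply hl
    have := Fintype.linearIndependent_iff.1 ω.linearIndependent l (by rw [← hx]; exact h0)
    exact funext this
  have h1 : (∏ a, (BM ρ ω).mulVec (ev l) a) = ((Algebra.norm ℤ x : ℤ) : ℝ) := by
    simp_rw [BM_mulVec]
    rw [← hN, ← hx, ← Algebra.coe_norm_int]; simp
  rw [h1]
  have : Algebra.norm ℤ x ≠ 0 := by rwa [Ne, Algebra.norm_eq_zero_iff]
  exact_mod_cast Int.one_le_abs this

lemma BM_dual_norm (ht : ∀ x : k, ((Algebra.trace ℚ k x : ℚ) : ℝ) = ∑ a, ρ a x)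
    (ω : Module.Basis (Fin n) ℤ (𝓞 k)) (l : Fin n → ℤ) (hl : l ≠ 0) :
    1 ≤ (BM ρ ω).det ^ 2 * |∏ a, (dual (BM ρ ω)).mulVec (ev l) a| := by
  set B := BM ρ ω with hB
  have hdet : B.det ≠ 0 := det_BM_ne ht ω
  have hu : IsUnit B.det := hdet.isUnit
  set y := (dual B).mulVec (ev l) with hy
  have hBy : B.transpose.mulVec y = ev l := by
    rw [hy, Matrix.mulVec_mulVec, dual, ← Matrix.transpose_mul, Matrix.nonsing_inv_mul _ hu,
      Matrix.transpose_one, Matrix.one_mulVec]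
  -- y is the image of an element of k
  have hfin : n = Module.finrank ℚ k := by
    rw [← RingOfIntegers.rank, Module.finrank_eq_card_basis ω, Fintype.card_fin]
  let ωq : Module.Basis (Fin n) ℚ k := ω.localizationLocalization ℚ (nonZeroDivisors ℤ) k
  have hωq : ∀ j, ωq j = (ω j : k) := fun j => by
    simp [ωq, Module.Basis.localizationLocalization_apply]
  set β : k := ∑ j, (l j : ℚ) • ωq.traceDual j with hβ
  have hβt : ∀ i, Algebra.trace ℚ k ((ω i : k) * β) = l i := by
    intro i
    rw [hβ, Finset.mul_sum, map_sum]
    simp only [mul_smul_comm, map_smul, ← hωq, Module.Basis.trace_mul_traceDual, smul_eq_mul]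
    simp
  have hyβ : y = fun a => ρ a β := by
    have h1 : B.transpose.mulVec (fun a => ρ a β) = ev l := by
      ext i
      have := ht ((ω i : k) * β)
      rw [hβt] at this
      simp only [Matrix.mulVec, dotProduct, Matrix.transpose_apply, hB, BM, ev]
      push_cast at this
      rw [this]
      exact Finset.sum_congr rfl fun a _ => (map_mul _ _ _).symm
    have hinj : Function.Injective B.transpose.mulVec :=
      Matrix.mulVec_injective_of_isUnit ((Matrix.isUnit_iff_isUnit_det _).2 (by rw [Matrix.det_transpose]; exact hu))
    exact hinj (hBy.trans h1.symm)
  have hβ0 : β ≠ 0 := by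
    intro h0
    apply hl
    ext i
    have := hβt i
    rw [h0] at this
    simp at this
    exact_mod_cast this.symm
  have hprod : ∏ a, y a ≠ 0 := by
    rw [Finset.prod_ne_zero_iff]
    intro a _
    rw [hyβ]
    exact (map_ne_zero (ρ a)).2 hβ0
  -- integral matrix
  let M : Matrix (Fin n) (Fin n) ℤ := fun i j => ∑ m, ω.repr (ω i * ω j) m * l m
  have hM : B.transpose * Matrix.diagonal y * B = M.map (Int.cast : ℤ → ℝ) := by
    ext i j
    rw [Matrix.mul_apply, Matrix.map_apply]
    simp only [Matrix.mul_diagonal, Matrix.transpose_apply, M]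
    push_cast
    have h2 : ∀ m, ((l m : ℤ) : ℝ) = ∑ a, B a m * y a := fun m => by
      have := congrFun hBy m
      simp only [Matrix.mulVec, dotProduct, Matrix.transpose_apply, ev] at this
      exact this.symm
    simp_rw [h2, Finset.mul_sum]
    rw [Finset.sum_comm]
    refine Finset.sum_congr rfl fun a _ => ?_
    have h3 : B a i * B a j = ∑ m, ((ω.repr (ω i * ω j) m : ℤ) : ℝ) * B a m := by
      have h4 : B a i * B a j = ρ a ((ω i * ω j : 𝓞 k) : k) := by simp [hB, BM]
      rw [h4]
      conv_lhs => rw [← ω.sum_repr (ω i * ω j)]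
      rw [rho_sum ω (fun m => ω.repr (ω i * ω j) m)]
      refine Finset.sum_congr rfl fun m _ => ?_
      simp [hB, BM]
    calc B a i * y a * B a j = (B a i * B a j) * y a := by ring
      _ = _ := by rw [h3, Finset.sum_mul]; exact Finset.sum_congr rfl fun m _ => by ring
  have hd := congrArg Matrix.det hM
  rw [Matrix.det_mul, Matrix.det_mul, Matrix.det_transpose, Matrix.det_diagonal] at hd
  have hd2 : (M.map (Int.cast : ℤ → ℝ)).det = ((M.det : ℤ) : ℝ) :=
    (RingHom.map_det (Int.castRingHom ℝ) M).symm
  rw [hd2] at hd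
  have hM0 : M.det ≠ 0 := by
    intro h0
    rw [h0] at hd
    have : B.det * (∏ a, y a) * B.det ≠ 0 := mul_ne_zero (mul_ne_zero hdet hprod) hdet
    exact this (by rw [hd]; simp)
  have h5 : (1:ℝ) ≤ |((M.det : ℤ) : ℝ)| := by exact_mod_cast Int.one_le_abs hM0
  rw [← hd, abs_mul, abs_mul] at h5
  calc (1:ℝ) ≤ _ := h5
    _ = _ := by rw [← sq_abs B.det]; ring
end

theorem main_ge_six (k : Type*) [Field k] [NumberField k]
    (hreal : ∀ v : InfinitePlace k, v.IsReal)
    (n : ℕ) (hn : Module.finrank ℚ k = n) (hn6 : 6 ≤ n) :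
    (14641 : ℤ) ^ n ≤ |NumberField.discr k| ^ 5 := by
  by_contra hcon
  push Not at hcon
  obtain ⟨ρ, ht, hN⟩ := exists_rho k hreal n hn
  have hc : Fintype.card (Module.Free.ChooseBasisIndex ℤ (𝓞 k)) = n := by
    rw [← Module.finrank_eq_card_basis (RingOfIntegers.basis k), RingOfIntegers.rank, hn]
  let ω : Module.Basis (Fin n) ℤ (𝓞 k) := (RingOfIntegers.basis k).reindex (Fintype.equivFinOfCardEq hc)
  set B := BM ρ ω with hB
  have hdet : B.det ≠ 0 := det_BM_ne ht ω
  have hD := det_BM ht ω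
  rw [← hB] at hD
  have hn0 : (n:ℝ) ≠ 0 := by have : n ≠ 0 := by omega
                             exact_mod_cast this
  have habs : 0 < |B.det| := abs_pos.2 hdet
  set s : ℝ := |B.det| ^ (-(1:ℝ)/n) with hs
  have hs0 : 0 < s := Real.rpow_pos_of_pos habs _
  have hsn : s ^ n = |B.det|⁻¹ := by
    rw [hs, ← Real.rpow_natCast, ← Real.rpow_mul habs.le, div_mul_cancel₀ _ hn0, Real.rpow_neg_one]
  have hA : |(s • B).det| = 1 := by
    rw [Matrix.det_smul, Fintype.card_fin, abs_mul, hsn, abs_inv, abs_abs, inv_mul_cancel₀ habs.ne']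
  have hDpos : 0 < B.det ^ 2 := by positivity
  have hmu : mu ^ n * B.det ^ 2 ≤ Real.pi ^ n := by
    have h1 : (B.det^2)^5 ≤ (14641:ℝ)^n := by
      have : |(discr k)|^5 ≤ (14641:ℤ)^n := hcon.le
      have h2 : ((|(discr k)|:ℤ):ℝ)^5 ≤ (14641:ℝ)^n := by exact_mod_cast this
      rw [Int.cast_abs, ← hD, abs_of_pos hDpos] at h2
      exact h2
    have h2 : mu^5 * 14641 ≤ Real.pi^5 := by
      have h3 : (3.141592:ℝ)^5 ≤ Real.pi^5 := pow_le_pow_left₀ (by norm_num) Real.pi_gt_d6.le 5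
      refine le_trans ?_ h3
      unfold mu; norm_num
    have h3 : (mu ^ n * B.det ^ 2)^5 ≤ (Real.pi ^ n)^5 := by
      calc (mu ^ n * B.det ^ 2)^5 = (mu^5)^n * (B.det^2)^5 := by ring
        _ ≤ (mu^5)^n * 14641^n := by
            have : (0:ℝ) ≤ (mu^5)^n := by have := mu_pos; positivity
            exact mul_le_mul_of_nonneg_left h1 this
        _ = (mu^5*14641)^n := by ring
        _ ≤ (Real.pi^5)^n := pow_le_pow_left₀ (by have := mu_pos; positivity) h2 n
        _ = _ := by ring
    exact le_of_pow_le_pow_left₀ (by norm_num) (by positivity) h3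
  have hprodv : ∀ (A : Matrix (Fin n) (Fin n) ℝ) (l : Fin n → ℤ), ∏ a, vv A l a
      = Real.pi^n * |∏ a, A.mulVec (ev l) a|^2 := by
    intro A l
    simp only [vv]
    rw [Finset.prod_mul_distrib, Finset.prod_pow, sq_abs]; simp
  have hsmul : ∀ (c : ℝ) (A : Matrix (Fin n) (Fin n) ℝ) (l : Fin n → ℤ),
      |∏ a, (c • A).mulVec (ev l) a| = |c|^n * |∏ a, A.mulVec (ev l) a| := by
    intro c A l
    simp only [Matrix.smul_mulVec, Pi.smul_apply, smul_eq_mul, Finset.prod_mul_distrib, abs_mul]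
    simp [abs_pow]
  have h1 : Big mu (s • B) := by
    intro l hl
    rw [hprodv, hsmul, abs_of_pos hs0, hsn, mul_pow, inv_pow, sq_abs]
    have := BM_norm hN ω l hl
    rw [← hB] at this
    have h2 : (1:ℝ) ≤ |∏ a, B.mulVec (ev l) a|^2 := one_le_pow₀ this
    calc mu^n ≤ Real.pi^n * (B.det^2)⁻¹ := by rw [← div_eq_mul_inv, le_div_iff₀ hDpos]; exact hmu
      _ ≤ _ := by
        rw [← mul_assoc]
        exact le_mul_of_one_le_right (by positivity) h2
  have hdual : dual (s • B) = s⁻¹ • dual B := by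
    have : (s • B)⁻¹ = s⁻¹ • B⁻¹ := by
      apply Matrix.inv_eq_right_inv
      rw [Matrix.smul_mul, Matrix.mul_smul, Matrix.mul_nonsing_inv _ hdet.isUnit, smul_smul,
        mul_inv_cancel₀ hs0.ne', one_smul]
    rw [dual, this, Matrix.transpose_smul, dual]
  have h2 : Big mu (dual (s • B)) := by
    intro l hl
    rw [hdual, hprodv, hsmul, abs_of_pos (inv_pos.2 hs0), inv_pow, hsn, inv_inv, mul_pow, sq_abs]
    have := BM_dual_norm ht ω l hl
    rw [← hB] at this
    set P := |∏ a, (dual B).mulVec (ev l) a| with hP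
    have h3 : (B.det^2)⁻¹ ≤ P := by rw [inv_le_iff_one_le_mul₀' hDpos]; exact this
    calc mu^n ≤ Real.pi^n * (B.det^2)⁻¹ := by rw [← div_eq_mul_inv, le_div_iff₀ hDpos]; exact hmu
      _ = Real.pi^n * (B.det^2 * ((B.det^2)⁻¹)^2) := by field_simp
      _ ≤ _ := by gcongr
  obtain ⟨N, rfl⟩ : ∃ N, n = N + 1 := ⟨n - 1, by omega⟩
  exact no_lattice (by norm_num : (0:ℝ) < 1/1000) (cert_all (N+1) hn6) hA h1 h2

end TR
end

section
namespace TR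
open Matrix

section Hermite
variable {n : ℕ}

/-- Bilinear form of a matrix. -/
noncomputable def bf (G : Matrix (Fin n) (Fin n) ℝ) (x y : Fin n → ℝ) : ℝ := ∑ i, ∑ j, x i * G i j * y j

/-- Quantitative positive definiteness. -/
def PD (G : Matrix (Fin n) (Fin n) ℝ) : Prop :=
  (∀ i j, G i j = G j i) ∧ ∃ c : ℝ, 0 < c ∧ ∀ x : Fin n → ℝ, c * ∑ i, x i ^ 2 ≤ bf G x x

/-- Columns of unimodular integer matrices. -/
def Prim (v : Fin n → ℤ) : Prop :=
  ∃ U : Matrix (Fin n) (Fin n) ℤ, IsUnit U.det ∧ ∃ j, ∀ i, U i j = v i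

/-- Schur complement of the upper left entry. -/
noncomputable def schur (G : Matrix (Fin (n+1)) (Fin (n+1)) ℝ) : Matrix (Fin n) (Fin n) ℝ :=
  fun i j => G i.succ j.succ - G i.succ 0 * G 0 j.succ / G 0 0

lemma PD_corner {G : Matrix (Fin (n+1)) (Fin (n+1)) ℝ} (h : PD G) : 0 < G 0 0 := by
  obtain ⟨c, hc, h⟩ := h.2
  have := h (Pi.single 0 1)
  simp [bf, Pi.single_apply] at this
  linarith

lemma det_schur {G : Matrix (Fin (n+1)) (Fin (n+1)) ℝ} (h : G 0 0 ≠ 0) :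
    G.det = G 0 0 * (schur G).det := by
  let M : Matrix (Fin (n+1)) (Fin (n+1)) ℝ :=
    fun i j => Fin.cases (G 0 j) (fun i' => G i'.succ j - G i'.succ 0 * G 0 j / G 0 0) i
  have h1 : G.det = M.det := by
    refine Matrix.det_eq_of_forall_row_eq_smul_add_const
      (fun i => Fin.cases 0 (fun i' => G i'.succ 0 / G 0 0) i) 0 rfl ?_
    intro i j
    refine Fin.cases ?_ (fun i' => ?_) i
    · simp [M]
    · simp only [M, Fin.cases_succ, Fin.cases_zero]; ring
  rw [h1, Matrix.det_succ_column_zero, Fin.sum_univ_succ]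
  have h2 : ∀ i : Fin n, M i.succ 0 = 0 := by
    intro i
    simp only [M, Fin.cases_succ]
    field_simp; ring
  have h3 : M.submatrix (Fin.succAbove 0) Fin.succ = schur G := by
    ext i j
    rw [Matrix.submatrix_apply, Fin.succAbove_zero]
    rfl
  simp only [h2, mul_zero, zero_mul, Finset.sum_const_zero, add_zero, h3]
  simp [M]

lemma bf_cons {G : Matrix (Fin (n+1)) (Fin (n+1)) ℝ} (hs : ∀ i j, G i j = G j i) (h : G 0 0 ≠ 0)
    (t : ℝ) (u : Fin n → ℝ) :
    bf G (Fin.cons t u) (Fin.cons t u) =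
      G 0 0 * (t + (∑ j, G 0 j.succ * u j) / G 0 0) ^ 2 + bf (schur G) u u := by
  simp only [bf, Fin.sum_univ_succ, Fin.cons_zero, Fin.cons_succ, schur]
  set S := ∑ j : Fin n, G 0 j.succ * u j with hS
  have h1 : ∑ j : Fin n, t * G 0 j.succ * u j = t * S := by
    rw [hS, Finset.mul_sum]; exact Finset.sum_congr rfl fun _ _ => by ring
  have h2 : ∑ i : Fin n, (u i * G i.succ 0 * t + ∑ j : Fin n, u i * G i.succ j.succ * u j)
      = t * S + ∑ i : Fin n, ∑ j : Fin n, u i * G i.succ j.succ * u j := by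
    rw [Finset.sum_add_distrib, hS, Finset.mul_sum]
    congr 1
    exact Finset.sum_congr rfl fun i _ => by rw [hs i.succ 0]; ring
  have h3 : ∑ i : Fin n, ∑ j : Fin n, u i * (G i.succ j.succ - G i.succ 0 * G 0 j.succ / G 0 0) * u j
      = ∑ i : Fin n, ∑ j : Fin n, u i * G i.succ j.succ * u j - S^2 / G 0 0 := by
    rw [pow_two, hS, Finset.sum_mul_sum, Finset.sum_div, ← Finset.sum_sub_distrib]
    refine Finset.sum_congr rfl fun i _ => ?_
    rw [Finset.sum_div, ← Finset.sum_sub_distrib]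
    refine Finset.sum_congr rfl fun j _ => ?_
    rw [hs i.succ 0]; ring
  rw [h1, h2, h3]
  field_simp
  ring

lemma PD_schur {G : Matrix (Fin (n+1)) (Fin (n+1)) ℝ} (h : PD G) : PD (schur G) := by
  have h0 := PD_corner h
  obtain ⟨hs, c, hc, hx⟩ := h
  refine ⟨fun i j => ?_, c, hc, fun u => ?_⟩
  · simp only [schur]; rw [hs i.succ j.succ, hs i.succ 0, hs 0 j.succ]; ring
  · have h1 := hx (Fin.cons (-((∑ j, G 0 j.succ * u j) / G 0 0)) u)
    rw [bf_cons hs h0.ne'] at h1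
    simp only [Fin.sum_univ_succ, Fin.cons_zero, Fin.cons_succ] at h1
    have h2 : 0 ≤ c * (-((∑ j, G 0 j.succ * u j) / G 0 0))^2 := by positivity
    have h3 : G 0 0 * (-((∑ j, G 0 j.succ * u j) / G 0 0) + (∑ j, G 0 j.succ * u j) / G 0 0) ^ 2 = 0 := by
      rw [neg_add_cancel]; simp
    rw [h3, mul_add] at h1
    linarith

lemma bf_eq (G : Matrix (Fin n) (Fin n) ℝ) (x y : Fin n → ℝ) : bf G x y = x ⬝ᵥ G.mulVec y := by
  simp only [bf, dotProduct, Matrix.mulVec, Finset.mul_sum]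
  exact Finset.sum_congr rfl fun i _ => Finset.sum_congr rfl fun j _ => by ring

lemma bf_congr (G V : Matrix (Fin n) (Fin n) ℝ) (x y : Fin n → ℝ) :
    bf (Vᵀ * G * V) x y = bf G (V.mulVec x) (V.mulVec y) := by
  rw [bf_eq, bf_eq, ← Matrix.mulVec_mulVec, ← Matrix.mulVec_mulVec, Matrix.dotProduct_mulVec,
    Matrix.vecMul_transpose]

lemma norm_le_of_inv (V : Matrix (Fin n) (Fin n) ℝ) (h : IsUnit V.det) :
    ∃ c : ℝ, 0 < c ∧ ∀ x : Fin n → ℝ, c * ∑ i, x i ^ 2 ≤ ∑ i, (V.mulVec x) i ^ 2 := by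
  set K : ℝ := ∑ i, ∑ j, (V⁻¹ i j)^2 with hK
  have hK0 : 0 ≤ K := Finset.sum_nonneg fun _ _ => Finset.sum_nonneg fun _ _ => sq_nonneg _
  refine ⟨(K+1)⁻¹, by positivity, fun x => ?_⟩
  rw [inv_mul_le_iff₀ (by positivity)]
  have h1 : x = V⁻¹.mulVec (V.mulVec x) := by
    rw [Matrix.mulVec_mulVec, Matrix.nonsing_inv_mul _ h, Matrix.one_mulVec]
  set y := V.mulVec x with hy
  have hyn : 0 ≤ ∑ i, y i ^ 2 := Finset.sum_nonneg fun _ _ => sq_nonneg _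
  calc ∑ i, x i ^ 2 = ∑ i, (∑ j, V⁻¹ i j * y j)^2 := by
        refine Finset.sum_congr rfl fun i _ => ?_
        conv_lhs => rw [h1]
        rfl
    _ ≤ ∑ i, (∑ j, (V⁻¹ i j)^2) * (∑ j, y j ^ 2) :=
        Finset.sum_le_sum fun i _ => Finset.sum_mul_sq_le_sq_mul_sq _ _ _
    _ = K * ∑ j, y j ^ 2 := by rw [← Finset.sum_mul]
    _ ≤ _ := by nlinarith

lemma PD_congr {G : Matrix (Fin n) (Fin n) ℝ} (hG : PD G) (V : Matrix (Fin n) (Fin n) ℝ)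
    (h : IsUnit V.det) : PD (Vᵀ * G * V) := by
  obtain ⟨hs, c, hc, hx⟩ := hG
  obtain ⟨c', hc', h'⟩ := norm_le_of_inv V h
  have hsym : Gᵀ = G := by ext i j; exact (hs j i)
  refine ⟨fun i j => ?_, c * c', by positivity, fun x => ?_⟩
  · have : (Vᵀ * G * V)ᵀ = Vᵀ * G * V := by
      rw [Matrix.transpose_mul, Matrix.transpose_mul, Matrix.transpose_transpose, hsym, Matrix.mul_assoc]
    conv_lhs => rw [← this]
    rfl
  · rw [bf_congr]
    refine le_trans ?_ (hx _)
    rw [mul_assoc]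
    exact mul_le_mul_of_nonneg_left (h' x) hc.le

lemma PD_gram (V : Matrix (Fin n) (Fin n) ℝ) (h : IsUnit V.det) : PD (Vᵀ * V) := by
  have h1 : PD (1 : Matrix (Fin n) (Fin n) ℝ) := by
    refine ⟨fun i j => by simp [Matrix.one_apply, eq_comm], 1, one_pos, fun x => ?_⟩
    rw [bf_eq, Matrix.one_mulVec, one_mul]
    exact le_of_eq (Finset.sum_congr rfl fun i _ => by ring)
  simpa using PD_congr h1 V h

lemma Prim.ne_zero {v : Fin n → ℤ} (h : Prim v) : v ≠ 0 := by
  rintro rfl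
  obtain ⟨U, hU, j, hj⟩ := h
  have : U.det = 0 := Matrix.det_eq_zero_of_column_eq_zero j (by simpa using hj)
  rw [this] at hU; simp at hU

lemma Prim.col_zero {v : Fin (n+1) → ℤ} (h : Prim v) :
    ∃ U : Matrix (Fin (n+1)) (Fin (n+1)) ℤ, IsUnit U.det ∧ ∀ i, U i 0 = v i := by
  obtain ⟨U, hU, j, hj⟩ := h
  refine ⟨U.submatrix id (Equiv.swap 0 j), ?_, fun i => ?_⟩
  · rw [Matrix.det_permute']
    exact IsUnit.mul (Units.isUnit _) hU
  · simp [hj]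

lemma Prim.mul {v : Fin n → ℤ} (h : Prim v) {U : Matrix (Fin n) (Fin n) ℤ} (hU : IsUnit U.det) :
    Prim (U.mulVec v) := by
  obtain ⟨W, hW, j, hj⟩ := h
  refine ⟨U * W, by rw [Matrix.det_mul]; exact hU.mul hW, j, fun i => ?_⟩
  simp only [Matrix.mul_apply, Matrix.mulVec, dotProduct, hj]

lemma Prim.cons {u : Fin n → ℤ} (h : Prim u) (t : ℤ) : Prim (Fin.cons t u : Fin (n+1) → ℤ) := by
  obtain ⟨W, hW, j, hj⟩ := h
  let R : Matrix (Fin (n+1)) (Fin (n+1)) ℤ := Matrix.of fun i l =>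
    Fin.cases (motive := fun _ => ℤ) (Fin.cases (motive := fun _ => ℤ) 1 (fun l => if l = j then t else 0) l)
      (fun i' => Fin.cases (motive := fun _ => ℤ) 0 (fun l => W i' l) l) i
  refine ⟨R, ?_, j.succ, fun i => ?_⟩
  · rw [Matrix.det_succ_column_zero, Fin.sum_univ_succ]
    have h1 : ∀ i : Fin n, R i.succ 0 = 0 := fun i => rfl
    have h2 : R 0 0 = 1 := rfl
    have h3 : R.submatrix (Fin.succAbove 0) Fin.succ = W := by
      ext a b
      rw [Matrix.submatrix_apply, Fin.succAbove_zero]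
      rfl
    simp only [h1, h2, h3, mul_zero, zero_mul, Finset.sum_const_zero, add_zero]
    simpa using hW
  · refine Fin.cases ?_ (fun i' => ?_) i
    · simp [R]
    · simp [R, hj]

/-- Hermite constants. -/
noncomputable def HC : ℕ → ℝ
  | 0 => 1
  | n+1 => HC n * (4/3)^(n+1)

lemma ev_mulVec (U : Matrix (Fin n) (Fin n) ℤ) (v : Fin n → ℤ) :
    (U.map (Int.cast : ℤ → ℝ)).mulVec (ev v) = ev (U.mulVec v) := by
  ext i
  simp [ev, Matrix.mulVec, dotProduct]

lemma exists_min {G : Matrix (Fin (n+1)) (Fin (n+1)) ℝ} (hG : PD G) :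
    ∃ v : Fin (n+1) → ℤ, Prim v ∧ ∀ w, Prim w → bf G (ev v) (ev v) ≤ bf G (ev w) (ev w) := by
  obtain ⟨hs, c, hc, hx⟩ := hG
  set e0 : Fin (n+1) → ℤ := fun i => (1 : Matrix (Fin (n+1)) (Fin (n+1)) ℤ) i 0 with he
  have hp : Prim e0 := ⟨1, by simp, 0, fun i => rfl⟩
  set S : Set (Fin (n+1) → ℤ) := {v | Prim v ∧ bf G (ev v) (ev v) ≤ bf G (ev e0) (ev e0)} with hS
  have hfin : S.Finite := by
    obtain ⟨N, hN⟩ := exists_nat_gt (bf G (ev e0) (ev e0) / c)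
    refine (Set.finite_Icc (fun _ => -(N:ℤ)) (fun _ => (N:ℤ))).subset ?_
    rintro v ⟨_, hv⟩
    have h1 : ∀ i, |v i| ≤ N := by
      intro i
      have h2 := (hx (ev v)).trans hv
      have h3 : (ev v i)^2 ≤ ∑ j, ev v j ^ 2 :=
        Finset.single_le_sum (f := fun j => ev v j ^ 2) (fun j _ => sq_nonneg _) (Finset.mem_univ i)
      have h4 : (ev v i)^2 < N := by
        rw [div_lt_iff₀ hc] at hN
        nlinarith
      have h5 : (v i)^2 < (N:ℤ) := by
        simp only [ev] at h4
        exact_mod_cast h4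
      have h6 : |v i| ≤ |v i|^2 := by
        rcases eq_or_ne (v i) 0 with h | h
        · simp [h]
        · have := Int.one_le_abs h; nlinarith
      rw [sq_abs] at h6
      linarith
    exact ⟨fun i => (abs_le.1 (h1 i)).1, fun i => (abs_le.1 (h1 i)).2⟩
  obtain ⟨v, hv, hm⟩ := Set.exists_min_image S (fun v => bf G (ev v) (ev v)) hfin ⟨e0, hp, le_rfl⟩
  refine ⟨v, hv.1, fun w hw => ?_⟩
  by_cases h : bf G (ev w) (ev w) ≤ bf G (ev e0) (ev e0)
  · exact hm w ⟨hw, h⟩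
  · exact hv.2.trans (not_le.1 h).le

lemma ev_single (v : Fin (n+1) → ℤ) (U : Matrix (Fin (n+1)) (Fin (n+1)) ℤ) (hv : ∀ i, U i 0 = v i) :
    (U.map (Int.cast : ℤ → ℝ)).mulVec (Pi.single 0 1) = ev v := by
  ext i
  simp [ev, hv]

lemma herm_step {G : Matrix (Fin (n+2)) (Fin (n+2)) ℝ} (hG : PD G)
    (IH : ∀ G' : Matrix (Fin (n+1)) (Fin (n+1)) ℝ, PD G' →
      ∃ v : Fin (n+1) → ℤ, Prim v ∧ (bf G' (ev v) (ev v))^(n+1) ≤ HC n * G'.det) :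
    ∃ v w : Fin (n+2) → ℤ, Prim v ∧ Prim w ∧ 0 < bf G (ev v) (ev v) ∧
      bf G (ev v) (ev v) ≤ bf G (ev w) (ev w) ∧
      2 * |bf G (ev v) (ev w)| ≤ bf G (ev v) (ev v) ∧
      bf G (ev v) (ev v) * (bf G (ev w) (ev w) - (bf G (ev v) (ev w))^2 / bf G (ev v) (ev v))^(n+1)
        ≤ HC n * G.det := by
  obtain ⟨v, hv, hmin⟩ := exists_min hG
  obtain ⟨U, hU, hU0⟩ := hv.col_zero
  set V := U.map (Int.cast : ℤ → ℝ) with hV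
  have hVd : V.det = ((U.det : ℤ) : ℝ) := (RingHom.map_det (Int.castRingHom ℝ) U).symm
  have hVu : IsUnit V.det := by
    rw [hVd]; exact hU.map (Int.castRingHom ℝ)
  have hVd2 : V.det * V.det = 1 := by
    rw [hVd]
    rcases Int.isUnit_iff.1 hU with h | h <;> rw [h] <;> norm_num
  set G1 := Vᵀ * G * V with hG1
  have hPD1 : PD G1 := PD_congr hG V hVu
  have hdet1 : G1.det = G.det := by
    rw [hG1, Matrix.det_mul, Matrix.det_mul, Matrix.det_transpose]
    linear_combination G.det * hVd2
  have hVe : V.mulVec (Pi.single 0 1) = ev v := ev_single v U hU0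
  have ha : G1 0 0 = bf G (ev v) (ev v) := by
    rw [← hVe, ← bf_congr]
    simp [bf, Pi.single_apply, hG1]
  have ha0 : 0 < G1 0 0 := PD_corner hPD1
  obtain ⟨u, hu, hub⟩ := IH (schur G1) (PD_schur hPD1)
  set s := (∑ j, G1 0 j.succ * ev u j) / G1 0 0 with hs
  set t : ℤ := - round s with ht
  set w1 : Fin (n+2) → ℤ := Fin.cons t u with hw1
  have hev : ev w1 = Fin.cons (t:ℝ) (ev u) := by
    ext i
    refine Fin.cases ?_ (fun i' => ?_) i <;> simp [ev, hw1]
  have hq : bf G1 (ev w1) (ev w1) = G1 0 0 * (t + s)^2 + bf (schur G1) (ev u) (ev u) := by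
    rw [hev, bf_cons hPD1.1 ha0.ne']
  have hb : bf G1 (Pi.single 0 1) (ev w1) = G1 0 0 * (t + s) := by
    rw [hev]
    have : bf G1 (Pi.single 0 1) (Fin.cons (t:ℝ) (ev u)) = G1 0 0 * t + ∑ j, G1 0 j.succ * ev u j := by
      simp [bf, Pi.single_apply, Fin.sum_univ_succ]
    rw [this, hs]; field_simp
  have hx : |(t:ℝ) + s| ≤ 1/2 := by
    rw [ht]; push_cast
    rw [neg_add_eq_sub]
    exact abs_sub_round s
  have hw2 : ev (U.mulVec w1) = V.mulVec (ev w1) := (ev_mulVec U w1).symm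
  have hww : bf G (ev (U.mulVec w1)) (ev (U.mulVec w1)) = G1 0 0 * (t + s)^2 + bf (schur G1) (ev u) (ev u) := by
    rw [hw2, ← bf_congr, ← hG1, hq]
  have hvw : bf G (ev v) (ev (U.mulVec w1)) = G1 0 0 * (t + s) := by
    rw [hw2, ← hVe, ← bf_congr, ← hG1, hb]
  have hpw : Prim (U.mulVec w1) := (hu.cons t).mul hU
  refine ⟨v, U.mulVec w1, hv, hpw, ha ▸ ha0, hmin _ hpw, ?_, ?_⟩
  · rw [hvw, ← ha, abs_mul, abs_of_pos ha0]
    nlinarith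
  · rw [hvw, ← ha, hww, ← hdet1, det_schur ha0.ne']
    have : G1 0 0 * (t + s)^2 + bf (schur G1) (ev u) (ev u) - (G1 0 0 * (t+s))^2 / G1 0 0
      = bf (schur G1) (ev u) (ev u) := by field_simp; ring
    rw [this]
    calc _ ≤ G1 0 0 * (HC n * (schur G1).det) := mul_le_mul_of_nonneg_left hub ha0.le
      _ = _ := by ring

lemma HC_pos (n : ℕ) : 0 < HC n := by
  induction n with
  | zero => simp [HC]
  | succ n ih => rw [HC]; positivity

lemma hermite (n : ℕ) : ∀ G : Matrix (Fin (n+1)) (Fin (n+1)) ℝ, PD G →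
      ∃ v : Fin (n+1) → ℤ, Prim v ∧ (bf G (ev v) (ev v))^(n+1) ≤ HC n * G.det := by
  induction n with
  | zero =>
    intro G _
    refine ⟨fun _ => 1, ⟨1, by simp, 0, fun i => by fin_cases i; rfl⟩, ?_⟩
    simp [bf, ev, HC]
  | succ n ih =>
    intro G hG
    obtain ⟨v, w, hv, hw, h0, h1, h2, h3⟩ := herm_step hG ih
    refine ⟨v, hv, ?_⟩
    set a := bf G (ev v) (ev v)
    set b := bf G (ev v) (ev w)
    set q := bf G (ev w) (ev w)
    have h4 : 3/4 * a ≤ q - b^2/a := by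
      have : b^2/a ≤ a/4 := by
        rw [div_le_iff₀ h0]
        have := sq_abs b
        nlinarith [abs_nonneg b]
      linarith
    have h5 : (3/4*a)^(n+1) ≤ (q - b^2/a)^(n+1) := pow_le_pow_left₀ (by positivity) h4 _
    have h6 : a * (3/4*a)^(n+1) ≤ HC n * G.det := le_trans (mul_le_mul_of_nonneg_left h5 h0.le) h3
    calc a^(n+1+1) = (4/3)^(n+1) * (a * (3/4*a)^(n+1)) := by
          rw [mul_pow]
          have : ((4:ℝ)/3)^(n+1) * (3/4)^(n+1) = 1 := by rw [← mul_pow]; norm_num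
          linear_combination (-(a * a^(n+1))) * this
      _ ≤ (4/3)^(n+1) * (HC n * G.det) := mul_le_mul_of_nonneg_left h6 (by positivity)
      _ = _ := by rw [HC]; ring
end Hermite
end TR
end

section
namespace TR
open NumberField Matrix

lemma exists_basis_one (k : Type*) [Field k] [NumberField k] (n : ℕ) (hn : Module.finrank ℚ k = n + 1) :
    ∃ ω : Module.Basis (Fin (n+1)) ℤ (𝓞 k), ω 0 = 1 := by
  have hc : Fintype.card (Module.Free.ChooseBasisIndex ℤ (𝓞 k)) = n + 1 := by
    rw [← Module.finrank_eq_card_basis (RingOfIntegers.basis k), RingOfIntegers.rank, hn]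
  let b : Module.Basis (Fin (n+1)) ℤ (𝓞 k) := (RingOfIntegers.basis k).reindex (Fintype.equivFinOfCardEq hc)
  let c : Fin (n+1) → ℤ := fun j => b.repr 1 j
  have hI : Ideal.span (Set.range c) = ⊤ := by
    obtain ⟨g, hg⟩ := (IsPrincipalIdealRing.principal (Ideal.span (Set.range c)))
    have hd : ∀ j, g ∣ c j := fun j => by
      rw [← Ideal.mem_span_singleton, ← Ideal.submodule_span_eq, ← hg]
      exact Ideal.subset_span ⟨j, rfl⟩
    choose z hz using hd
    have h1 : (1 : 𝓞 k) = algebraMap ℤ (𝓞 k) g * ∑ j, z j • b j := by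
      conv_lhs => rw [← b.sum_repr 1]
      rw [Finset.mul_sum]
      refine Finset.sum_congr rfl fun j _ => ?_
      change c j • b j = _
      rw [hz j, mul_smul, Algebra.smul_def]
    have h2 := congrArg (Algebra.norm ℤ) h1
    rw [map_one, map_mul, Algebra.norm_algebraMap_of_basis b] at h2
    have h3 : IsUnit (g ^ Fintype.card (Fin (n+1))) := IsUnit.of_mul_eq_one _ h2.symm
    have h4 : IsUnit g := (isUnit_pow_iff (by simp)).1 h3
    rw [hg, Ideal.submodule_span_eq]
    exact Ideal.span_singleton_eq_top.2 h4
  have h1 : (1:ℤ) ∈ Ideal.span (Set.range c) := by rw [hI]; trivial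
  obtain ⟨d, hd⟩ := Ideal.mem_span_range_iff_exists_fun.1 h1
  let φ : 𝓞 k →ₗ[ℤ] ℤ := ∑ j, d j • b.coord j
  have hφ : φ 1 = 1 := by
    simp only [φ, LinearMap.sum_apply, LinearMap.smul_apply, Module.Basis.coord_apply, smul_eq_mul]
    exact hd
  let N := LinearMap.ker φ
  let bN := Module.finBasis ℤ N
  have hli : ∀ (c : ℤ), ∀ x ∈ N, c • (1 : 𝓞 k) + x = 0 → c = 0 := by
    intro c x hx h
    have := congrArg φ h
    rw [map_add, map_smul, hφ, LinearMap.mem_ker.1 hx] at this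
    simpa using this
  have hsp : ∀ z : 𝓞 k, ∃ c : ℤ, z + c • (1 : 𝓞 k) ∈ N := by
    intro z
    refine ⟨-φ z, ?_⟩
    rw [LinearMap.mem_ker, map_add, map_smul, hφ]
    simp
  let ω0 := Module.Basis.mkFinCons (1 : 𝓞 k) bN hli hsp
  have hω0 : ω0 0 = 1 := by simp [ω0]
  have hcard : Module.finrank ℤ N + 1 = n + 1 := by
    have := Module.finrank_eq_card_basis ω0
    rw [Fintype.card_fin, RingOfIntegers.rank, hn] at this
    exact this.symm
  refine ⟨ω0.reindex (finCongr hcard), ?_⟩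
  rw [Module.Basis.reindex_apply]
  have : (finCongr hcard).symm 0 = 0 := by ext; simp
  rw [this, hω0]

section
variable {k : Type*} [Field k] [NumberField k]

/-- integer trace -/
noncomputable def tr (x : 𝓞 k) : ℤ := Algebra.trace ℤ (𝓞 k) x

lemma tr_eq {n : ℕ} {ρ : Fin n → k →+* ℝ}
    (ht : ∀ x : k, ((Algebra.trace ℚ k x : ℚ) : ℝ) = ∑ a, ρ a x) (x : 𝓞 k) :
    (tr x : ℝ) = ∑ a, ρ a (x : k) := by
  rw [← ht, ← Algebra.coe_trace_int]; simp [tr]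

lemma tr_add (x y : 𝓞 k) : tr (x + y) = tr x + tr y := map_add _ _ _

lemma tr_mul_int (m : ℤ) (x : 𝓞 k) : tr ((m : 𝓞 k) * x) = m * tr x := by
  unfold tr
  rw [← zsmul_eq_mul, map_smul, smul_eq_mul]

lemma tr_one : tr (1 : 𝓞 k) = Module.finrank ℚ k := by
  unfold tr
  have := Algebra.trace_algebraMap (S := 𝓞 k) (1 : ℤ)
  rw [map_one] at this
  rw [this, RingOfIntegers.rank]; simp

/-- the discriminant-like form -/
noncomputable def qb (x y : 𝓞 k) : ℤ := 5 * tr (x * y) - tr x * tr y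

lemma qb_shift (h5 : Module.finrank ℚ k = 5) (s m : ℤ) (x y : 𝓞 k) :
    qb ((s : 𝓞 k) * x + (m : 𝓞 k)) y = s * qb x y := by
  unfold qb
  have h1 : ((s : 𝓞 k) * x + (m : 𝓞 k)) * y = (s : 𝓞 k) * (x * y) + (m : 𝓞 k) * y := by ring
  have h2 : ((s : 𝓞 k) * x + (m : 𝓞 k)) = (s : 𝓞 k) * x + (m : 𝓞 k) * 1 := by ring
  rw [h1, h2, tr_add, tr_add, tr_mul_int, tr_mul_int, tr_mul_int, tr_mul_int, tr_one, h5]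
  push_cast; ring

lemma qb_comm (x y : 𝓞 k) : qb x y = qb y x := by
  unfold qb; rw [mul_comm x y]; ring

lemma small_elements (hreal : ∀ v : InfinitePlace k, v.IsReal) (h5 : Module.finrank ℚ k = 5) :
    ∃ α β : 𝓞 k, 0 < qb α α ∧ qb α α ≤ qb β β ∧ 2 * |qb α β| ≤ qb α α ∧
      27 * (qb α α * qb β β - (qb α β)^2)^3 ≤ 8000 * discr k * (qb α α)^2 := by
  obtain ⟨ρ, ht, hN⟩ := exists_rho k hreal 5 h5
  obtain ⟨ω, hω⟩ := exists_basis_one k 4 h5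
  set B := BM ρ ω with hB
  have hdet : B.det ≠ 0 := det_BM_ne ht ω
  have hD : B.det ^ 2 = (discr k : ℝ) := det_BM ht ω
  set G := Bᵀ * B with hG
  have hPD : PD G := PD_gram B hdet.isUnit
  have hbf : ∀ u w : Fin 5 → ℤ, bf G (ev u) (ev w) =
      (tr ((∑ j, u j • ω j) * (∑ j, w j • ω j) : 𝓞 k) : ℝ) := by
    intro u w
    rw [tr_eq ht]
    have h1 : G = Bᵀ * 1 * B := by rw [Matrix.mul_one]
    rw [h1, bf_congr, bf_eq, Matrix.one_mulVec]
    simp only [dotProduct, hB, BM_mulVec]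
    exact Finset.sum_congr rfl fun a _ => (map_mul (ρ a) _ _).symm
  let e0 : Fin 5 → ℤ := Pi.single 0 1
  have he0 : ∑ j, e0 j • ω j = 1 := by
    rw [Finset.sum_eq_single 0]
    · simp [e0, hω]
    · intro j _ hj; simp [e0, hj]
    · simp
  have hG00 : G 0 0 = 5 := by
    have h1 := hbf e0 e0
    rw [he0, mul_one, tr_one, h5] at h1
    have h2 : bf G (ev e0) (ev e0) = G 0 0 := by
      simp [bf, ev, e0, Pi.single_apply]
    rw [← h2, h1]; norm_num
  let el : (Fin 4 → ℤ) → 𝓞 k := fun v => ∑ j, (Fin.cons 0 v : Fin 5 → ℤ) j • ω j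
  have hrow : ∀ v : Fin 4 → ℤ, ∑ j : Fin 4, G 0 j.succ * ev v j = (tr (el v) : ℝ) := by
    intro v
    have h1 := hbf e0 (Fin.cons 0 v)
    rw [he0, one_mul] at h1
    rw [← h1]
    simp [bf, ev, e0, Pi.single_apply, Fin.sum_univ_succ]
  have hsch : ∀ u w : Fin 4 → ℤ, bf (schur G) (ev u) (ev w) = (qb (el u) (el w) : ℝ) / 5 := by
    intro u w
    have h1 := hbf (Fin.cons 0 u) (Fin.cons 0 w)
    have h2 : bf G (ev (Fin.cons 0 u)) (ev (Fin.cons 0 w)) =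
        ∑ i : Fin 4, ∑ j : Fin 4, ev u i * G i.succ j.succ * ev w j := by
      simp only [bf, Fin.sum_univ_succ (n := 4)]
      simp [ev]
    have h3 : bf (schur G) (ev u) (ev w) = ∑ i : Fin 4, ∑ j : Fin 4, ev u i * G i.succ j.succ * ev w j
        - (∑ j : Fin 4, G 0 j.succ * ev u j) * (∑ j : Fin 4, G 0 j.succ * ev w j) / G 0 0 := by
      rw [Finset.sum_mul_sum, Finset.sum_div, ← Finset.sum_sub_distrib]
      unfold bf
      refine Finset.sum_congr rfl fun i _ => ?_
      rw [Finset.sum_div, ← Finset.sum_sub_distrib]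
      refine Finset.sum_congr rfl fun j _ => ?_
      simp only [schur]
      rw [hPD.1 i.succ 0]; ring
    rw [h3, ← h2, h1, hrow, hrow, hG00]
    unfold qb
    push_cast
    simp only [el]
    ring
  obtain ⟨v, w, hv, hw, i0, i1, i2, i3⟩ := herm_step (PD_schur hPD) (hermite 2)
  simp only [hsch] at i0 i1 i2 i3
  refine ⟨el v, el w, ?_, ?_, ?_, ?_⟩
  · have : (0:ℝ) < (qb (el v) (el v) : ℝ) := by linarith
    exact_mod_cast this
  · have : (qb (el v) (el v) : ℝ) ≤ qb (el w) (el w) := by linarith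
    exact_mod_cast this
  · rw [abs_div, abs_of_pos (by norm_num : (0:ℝ) < 5)] at i2
    have : 2 * |(qb (el v) (el w) : ℝ)| ≤ qb (el v) (el v) := by linarith
    exact_mod_cast this
  · have hd : G.det = (discr k : ℝ) := by
      rw [hG, Matrix.det_mul, Matrix.det_transpose, ← hD]; ring
    have hd2 : (schur G).det = (discr k : ℝ) / 5 := by
      have := det_schur (G := G) (by rw [hG00]; norm_num)
      rw [hd, hG00] at this
      linarith
    have hHC : HC 2 = 64/27 := by simp only [HC]; norm_num
    rw [hd2, hHC] at i3
    set a : ℝ := (qb (el v) (el v) : ℝ) with ha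
    set q : ℝ := (qb (el w) (el w) : ℝ) with hq
    set b : ℝ := (qb (el v) (el w) : ℝ) with hb
    have ha0 : 0 < a := by linarith
    have h6 : a/5 * (q/5 - (b/5)^2/(a/5))^(2+1) = (a*q - b^2)^3 / (625 * a^2) := by
      have h7 : q/5 - (b/5)^2/(a/5) = (a*q - b^2) / (5*a) := by field_simp
      rw [h7, div_pow, div_mul_div_comm, div_eq_div_iff (by positivity) (by positivity)]
      ring
    rw [h6, div_le_iff₀ (by positivity)] at i3
    have : 27 * (a * q - b^2)^3 ≤ 8000 * (discr k : ℝ) * a^2 := by linarith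
    rw [ha, hq, hb] at this
    exact_mod_cast this

lemma small_norm (hreal : ∀ v : InfinitePlace k, v.IsReal) (h5 : Module.finrank ℚ k = 5) :
    ∃ α β : 𝓞 k, 0 < qb α α ∧ qb α α ≤ qb β β ∧ 2 * |qb α β| ≤ qb α α ∧
      27 * (qb α α * qb β β - (qb α β)^2)^3 ≤ 8000 * discr k * (qb α α)^2 ∧
      (tr α = 0 ∨ tr α = 1 ∨ tr α = 2) := by
  obtain ⟨α, β, h1, h2, h3, h4⟩ := small_elements hreal h5
  have key : ∃ s m : ℤ, (s = 1 ∨ s = -1) ∧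
      (s * tr α + 5 * m = 0 ∨ s * tr α + 5 * m = 1 ∨ s * tr α + 5 * m = 2) := by
    have : tr α % 5 = 0 ∨ tr α % 5 = 1 ∨ tr α % 5 = 2 ∨ tr α % 5 = 3 ∨ tr α % 5 = 4 := by omega
    rcases this with h | h | h | h | h
    · exact ⟨1, -(tr α / 5), Or.inl rfl, by omega⟩
    · exact ⟨1, -(tr α / 5), Or.inl rfl, by omega⟩
    · exact ⟨1, -(tr α / 5), Or.inl rfl, by omega⟩
    · exact ⟨-1, (tr α / 5) + 1, Or.inr rfl, by omega⟩
    · exact ⟨-1, (tr α / 5) + 1, Or.inr rfl, by omega⟩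
  obtain ⟨s, m, hs, hm⟩ := key
  set γ : 𝓞 k := (s : 𝓞 k) * α + (m : 𝓞 k) with hγ
  have hss : s * s = 1 := by rcases hs with rfl | rfl <;> norm_num
  have g1 : qb γ γ = qb α α := by
    rw [hγ, qb_shift h5, qb_comm, qb_shift h5, ← mul_assoc, hss, one_mul]
  have g2 : qb γ β = s * qb α β := qb_shift h5 s m α β
  have g3 : tr γ = s * tr α + 5 * m := by
    have : γ = (s : 𝓞 k) * α + (m : 𝓞 k) * 1 := by rw [hγ]; ring
    rw [this, tr_add, tr_mul_int, tr_mul_int, tr_one, h5]; push_cast; ring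
  refine ⟨γ, β, by rwa [g1], by rwa [g1], ?_, ?_, by rw [g3]; exact hm⟩
  · rw [g1, g2, abs_mul]
    have : |s| = 1 := by rcases hs with rfl | rfl <;> norm_num
    rw [this, one_mul]; exact h3
  · rw [g1, g2, mul_pow, pow_two s, hss, one_mul]; exact h4
end
end TR
end

section
namespace TR
open NumberField Matrix Polynomial IntermediateField

section
variable {k : Type*} [Field k] [NumberField k]

lemma gen_top (h5 : Module.finrank ℚ k = 5) {ρ : Fin 5 → k →+* ℝ}
    (ht : ∀ x : k, ((Algebra.trace ℚ k x : ℚ) : ℝ) = ∑ a, ρ a x) (α : 𝓞 k) (hq : 0 < qb α α) :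
    ℚ⟮(α : k)⟯ = ⊤ := by
  haveI := IntermediateField.isSimpleOrder_of_finrank_prime ℚ k (by rw [h5]; norm_num)
  refine (eq_bot_or_eq_top ℚ⟮(α : k)⟯).resolve_left fun hb => ?_
  rw [IntermediateField.adjoin_simple_eq_bot_iff, IntermediateField.mem_bot] at hb
  obtain ⟨r, hr⟩ := hb
  have h1 : ∀ a, ρ a (α : k) = (r : ℝ) := fun a => by rw [← hr]; simp
  have h2 : (tr α : ℝ) = 5 * r := by rw [tr_eq ht]; simp [h1]
  have h3 : (tr (α * α) : ℝ) = 5 * r^2 := by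
    rw [tr_eq ht]
    have : ∀ a, ρ a ((α * α : 𝓞 k) : k) = r^2 := fun a => by
      rw [← h1 a, pow_two, ← map_mul]; rfl
    rw [Finset.sum_congr rfl (fun a _ => this a)]; simp
  have h4 : (qb α α : ℝ) = 0 := by
    unfold qb; push_cast; rw [h2, h3]; ring
  have : qb α α = 0 := by exact_mod_cast h4
  omega

lemma x_inj {ρ : Fin 5 → k →+* ℝ}
    (ht : ∀ x : k, ((Algebra.trace ℚ k x : ℚ) : ℝ) = ∑ a, ρ a x)
    (ω : Module.Basis (Fin 5) ℤ (𝓞 k)) (α : 𝓞 k) (hg : ℚ⟮(α : k)⟯ = ⊤) :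
    Function.Injective (fun a => ρ a (α : k)) := by
  intro a b hab
  by_contra hne
  have hρ : ρ a = ρ b := by
    let F : IntermediateField ℚ k :=
      { (ρ a).eqLocusField (ρ b) with
        algebraMap_mem' := fun r => by
          change ρ a (algebraMap ℚ k r) = ρ b (algebraMap ℚ k r)
          simp }
    have hF : ℚ⟮(α : k)⟯ ≤ F := by
      rw [IntermediateField.adjoin_simple_le_iff]
      exact hab
    rw [hg] at hF
    ext x
    exact hF (IntermediateField.mem_top (x := x))
  refine det_BM_ne ht ω (Matrix.det_zero_of_row_eq hne ?_)
  ext j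
  simp [BM, hρ]

lemma esymm_data (h5 : Module.finrank ℚ k = 5) {ρ : Fin 5 → k →+* ℝ} (α : 𝓞 k)
    (hg : ℚ⟮(α : k)⟯ = ⊤) (hinj : Function.Injective (fun a => ρ a (α : k))) :
    ∃ P : ℤ[X], P.map (Int.castRingHom ℝ) = ∏ a, (X - C (ρ a (α : k))) := by
  have hIntg : IsIntegral ℤ (α : k) := α.isIntegral_coe
  refine ⟨minpoly ℤ (α : k), ?_⟩
  have hQ := minpoly.isIntegrallyClosed_eq_field_fractions' ℚ hIntg
  have hdeg : (minpoly ℤ (α : k)).natDegree = 5 := by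
    have h1 := (Field.primitive_element_iff_minpoly_natDegree_eq ℚ (α : k)).1 hg
    rw [hQ, (minpoly.monic hIntg).natDegree_map, h5] at h1
    exact h1
  have hmon := minpoly.monic hIntg
  refine Polynomial.eq_of_monic_of_dvd_of_natDegree_le (monic_prod_of_monic _ _ fun a _ => monic_X_sub_C _)
    (hmon.map _) ?_ ?_
  · refine Fintype.prod_dvd_of_coprime (pairwise_coprime_X_sub_C hinj) fun a => ?_
    rw [dvd_iff_isRoot, IsRoot.def, eval_map]
    have h2 := minpoly.aeval ℤ (α : k)
    have h3 := congrArg (ρ a) h2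
    rw [map_zero, aeval_def, hom_eval₂] at h3
    have h4 : (Int.castRingHom ℝ) = (ρ a).comp (algebraMap ℤ k) := RingHom.ext_int _ _
    rw [h4]; exact h3
  · rw [hmon.natDegree_map, hdeg, natDegree_prod_of_monic _ _ fun a _ => monic_X_sub_C _]
    simp

lemma disc_data {ρ : Fin 5 → k →+* ℝ}
    (ht : ∀ x : k, ((Algebra.trace ℚ k x : ℚ) : ℝ) = ∑ a, ρ a x)
    (ω : Module.Basis (Fin 5) ℤ (𝓞 k)) (α : 𝓞 k) :
    ∃ f : ℤ, (Matrix.vandermonde (fun a => ρ a (α : k))).det ^ 2 = (f:ℝ)^2 * (discr k : ℝ) := by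
  let Cm : Matrix (Fin 5) (Fin 5) ℤ := fun j i => ω.repr (α ^ (i:ℕ)) j
  refine ⟨Cm.det, ?_⟩
  have h : Matrix.vandermonde (fun a => ρ a (α : k)) = BM ρ ω * Cm.map (Int.cast : ℤ → ℝ) := by
    ext a i
    rw [Matrix.vandermonde_apply, Matrix.mul_apply]
    have h1 : (ρ a (α : k))^(i:ℕ) = ρ a ((α^(i:ℕ) : 𝓞 k) : k) := by simp
    rw [h1]
    conv_lhs => rw [← ω.sum_repr (α ^ (i:ℕ))]
    rw [rho_sum ω (fun m => ω.repr (α ^ (i:ℕ)) m)]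
    refine Finset.sum_congr rfl fun m _ => ?_
    change _ = ρ a (ω m) * ((ω.repr (α^(i:ℕ)) m : ℤ):ℝ)
    exact mul_comm _ _
  rw [h, Matrix.det_mul, mul_pow, det_BM ht ω]
  have : (Cm.map (Int.cast : ℤ → ℝ)).det = ((Cm.det : ℤ) : ℝ) := (RingHom.map_det (Int.castRingHom ℝ) Cm).symm
  rw [this]; ring
end

/-- positivity of determinants -/
lemma PD_det : ∀ {n : ℕ} {G : Matrix (Fin n) (Fin n) ℝ}, PD G → 0 < G.det
  | 0, G, _ => by simp
  | n+1, G, h => by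
    rw [det_schur (PD_corner h).ne']
    exact mul_pos (PD_corner h) (PD_det (PD_schur h))

lemma PD_sub {n : ℕ} {G : Matrix (Fin (n+1)) (Fin (n+1)) ℝ} (h : PD G) :
    PD (G.submatrix Fin.castSucc Fin.castSucc) := by
  obtain ⟨hs, c, hc, hx⟩ := h
  refine ⟨fun i j => hs _ _, c, hc, fun x => ?_⟩
  have h1 := hx (Fin.snoc (α := fun _ => ℝ) x 0)
  simp only [bf, Fin.sum_univ_castSucc, Fin.snoc_castSucc, Fin.snoc_last] at h1
  simpa [bf] using h1

/-- Hankel 3 -/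
def hk3 (p0 p1 p2 p3 p4 : ℤ) : ℤ :=
  p0 * (p2 * p4 - p3 * p3) - p1 * (p1 * p4 - p2 * p3) + p2 * (p1 * p3 - p2 * p2)

/-- Hankel 4 -/
def hk4 (p0 p1 p2 p3 p4 p5 p6 : ℤ) : ℤ :=
  fZ (p3*p5 - p4*p4) fun a => fZ (p3*p6-p4*p5) fun b => fZ (p4*p6-p5*p5) fun c =>
  fZ (p2*p5 - p3*p4) fun d => fZ (p2*p6-p3*p5) fun e => fZ (p2*p4 - p3*p3) fun g =>
    p0 * (p2*c - p3*b + p4*a) - p1 * (p1*c - p3*e + p4*d)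
      + p2 * (p1*b - p2*e + p4*g) - p3 * (p1*a - p2*d + p3*g)

/-- 3 by 3 determinant -/
def d3 (a b c d e f g h i : ℤ) : ℤ := a*(e*i-f*h) - b*(d*i-f*g) + c*(d*h-e*g)

/-- Hankel 5 -/
def hk5 (p0 p1 p2 p3 p4 p5 p6 p7 p8 : ℤ) : ℤ :=
  fZ (d3 p2 p3 p4 p3 p4 p5 p4 p5 p6) fun m012 =>
  fZ (d3 p2 p3 p5 p3 p4 p6 p4 p5 p7) fun m013 =>
  fZ (d3 p2 p3 p6 p3 p4 p7 p4 p5 p8) fun m014 =>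
  fZ (d3 p2 p4 p5 p3 p5 p6 p4 p6 p7) fun m023 =>
  fZ (d3 p2 p4 p6 p3 p5 p7 p4 p6 p8) fun m024 =>
  fZ (d3 p2 p5 p6 p3 p6 p7 p4 p7 p8) fun m034 =>
  fZ (d3 p3 p4 p5 p4 p5 p6 p5 p6 p7) fun m123 =>
  fZ (d3 p3 p4 p6 p4 p5 p7 p5 p6 p8) fun m124 =>
  fZ (d3 p3 p5 p6 p4 p6 p7 p5 p7 p8) fun m134 =>
  fZ (d3 p4 p5 p6 p5 p6 p7 p6 p7 p8) fun m234 =>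
    p0 * (p2*m234 - p3*m134 + p4*m124 - p5*m123)
    - p1 * (p1*m234 - p3*m034 + p4*m024 - p5*m023)
    + p2 * (p1*m134 - p2*m034 + p4*m014 - p5*m013)
    - p3 * (p1*m124 - p2*m024 + p3*m014 - p5*m012)
    + p4 * (p1*m123 - p2*m023 + p3*m013 - p4*m012)

/-- Hankel matrix -/
def HM (n : ℕ) (p : ℕ → ℤ) : Matrix (Fin n) (Fin n) ℤ := fun i j => p (i + j)

lemma hk3_eq (p : ℕ → ℤ) : (HM 3 p).det = hk3 (p 0) (p 1) (p 2) (p 3) (p 4) := by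
  rw [Matrix.det_fin_three]
  simp only [HM, hk3]
  simp
  ring

lemma hk4_eq (p : ℕ → ℤ) : (HM 4 p).det = hk4 (p 0) (p 1) (p 2) (p 3) (p 4) (p 5) (p 6) := by
  simp only [hk4, fZ_eq]
  rw [Matrix.det_succ_row_zero]
  simp only [Fin.sum_univ_succ, Matrix.det_fin_three, HM, Matrix.submatrix_apply]
  simp [Fin.succAbove, Fin.lt_def]
  ring

lemma hk5_eq (p : ℕ → ℤ) : (HM 5 p).det = hk5 (p 0) (p 1) (p 2) (p 3) (p 4) (p 5) (p 6) (p 7) (p 8) := by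
  simp only [hk5, fZ_eq, d3]
  rw [Matrix.det_succ_row_zero]
  simp only [Matrix.det_succ_row_zero (n := 3)]
  simp only [Fin.sum_univ_succ, Matrix.det_fin_three, HM, Matrix.submatrix_apply]
  simp [Fin.succAbove, Fin.lt_def]
  ring

lemma hankel_gram (x : Fin 5 → ℝ) (p : ℕ → ℤ) (hp : ∀ i, (p i : ℝ) = ∑ a, x a ^ i) :
    (HM 5 p).map (Int.cast : ℤ → ℝ) = (Matrix.vandermonde x)ᵀ * Matrix.vandermonde x := by
  ext i j
  simp only [HM, Matrix.map_apply, Matrix.mul_apply, Matrix.transpose_apply, Matrix.vandermonde_apply, hp]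
  exact Finset.sum_congr rfl fun a _ => pow_add _ _ _

lemma hankel_facts (x : Fin 5 → ℝ) (hx : Function.Injective x) (p : ℕ → ℤ)
    (hp : ∀ i, (p i : ℝ) = ∑ a, x a ^ i) :
    0 < hk3 (p 0) (p 1) (p 2) (p 3) (p 4) ∧ 0 < hk4 (p 0) (p 1) (p 2) (p 3) (p 4) (p 5) (p 6) ∧
    0 < hk5 (p 0) (p 1) (p 2) (p 3) (p 4) (p 5) (p 6) (p 7) (p 8) ∧
    (hk5 (p 0) (p 1) (p 2) (p 3) (p 4) (p 5) (p 6) (p 7) (p 8) : ℝ) = (Matrix.vandermonde x).det ^ 2 := by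
  have hv : (Matrix.vandermonde x).det ≠ 0 := Matrix.det_vandermonde_ne_zero_iff.2 hx
  have hg := hankel_gram x p hp
  have h5 : PD ((HM 5 p).map (Int.cast : ℤ → ℝ)) := by
    rw [hg]; exact PD_gram _ hv.isUnit
  have h4 : PD ((HM 4 p).map (Int.cast : ℤ → ℝ)) := PD_sub h5
  have h3 : PD ((HM 3 p).map (Int.cast : ℤ → ℝ)) := PD_sub h4
  have hd : ∀ n, ((HM n p).map (Int.cast : ℤ → ℝ)).det = (((HM n p).det : ℤ) : ℝ) := fun n =>
    (RingHom.map_det (Int.castRingHom ℝ) _).symm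
  have i3 := PD_det h3
  have i4 := PD_det h4
  have i5 := PD_det h5
  rw [hd, Int.cast_pos] at i3 i4 i5
  rw [hk3_eq] at i3
  rw [hk4_eq] at i4
  rw [hk5_eq] at i5
  refine ⟨i3, i4, i5, ?_⟩
  rw [← hk5_eq, ← hd, hg, Matrix.det_mul, Matrix.det_transpose]; ring

lemma coeff5 (a b c d e : ℝ) :
    (X^5 + C a * X^4 + C b * X^3 + C c * X^2 + C d * X + C e : ℝ[X]).coeff 4 = a ∧
    (X^5 + C a * X^4 + C b * X^3 + C c * X^2 + C d * X + C e : ℝ[X]).coeff 3 = b ∧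
    (X^5 + C a * X^4 + C b * X^3 + C c * X^2 + C d * X + C e : ℝ[X]).coeff 2 = c ∧
    (X^5 + C a * X^4 + C b * X^3 + C c * X^2 + C d * X + C e : ℝ[X]).coeff 1 = d ∧
    (X^5 + C a * X^4 + C b * X^3 + C c * X^2 + C d * X + C e : ℝ[X]).coeff 0 = e := by
  refine ⟨?_, ?_, ?_, ?_, ?_⟩ <;> simp [coeff_X, coeff_C, coeff_X_pow]

/-- Bounds on power sums and Newton's identities. -/
lemma newton (x : Fin 5 → ℝ) (p : ℕ → ℤ) (hp : ∀ i, (p i : ℝ) = ∑ a, x a ^ i)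
    (P : ℤ[X]) (hP : P.map (Int.castRingHom ℝ) = ∏ a, (X - C (x a))) :
    ∃ e1 e2 e3 e4 e5 : ℤ, p 0 = 5 ∧ p 1 = e1 ∧ p 2 = e1^2 - 2*e2 ∧ p 3 = e1^3 - 3*e1*e2 + 3*e3 ∧
      p 4 = e1^4 - 4*e1^2*e2 + 2*e2^2 + 4*e1*e3 - 4*e4 ∧
      (∀ i, p (i+5) = e1 * p (i+4) - e2 * p (i+3) + e3 * p (i+2) - e4 * p (i+1) + e5 * p i) ∧
      (e5 : ℝ) = ∏ a, x a ∧
      (∀ a, x a ^ 5 - e1 * x a ^ 4 + e2 * x a ^ 3 - e3 * x a ^ 2 + e4 * x a - e5 = 0) ∧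
      (∀ m : ℤ, m^5 - e1 * m^4 + e2 * m^3 - e3 * m^2 + e4 * m - e5 = 0 → ∃ a, x a = m) := by
  have hexp : ∏ a, (X - C (x a)) = X^5 + C (-(x 0 + x 1 + x 2 + x 3 + x 4)) * X^4
      + C (x 0 * x 1 + x 0 * x 2 + x 0 * x 3 + x 0 * x 4 + x 1 * x 2 + x 1 * x 3 + x 1 * x 4
        + x 2 * x 3 + x 2 * x 4 + x 3 * x 4) * X^3
      + C (-(x 0 * x 1 * x 2 + x 0 * x 1 * x 3 + x 0 * x 1 * x 4 + x 0 * x 2 * x 3 + x 0 * x 2 * x 4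
        + x 0 * x 3 * x 4 + x 1 * x 2 * x 3 + x 1 * x 2 * x 4 + x 1 * x 3 * x 4 + x 2 * x 3 * x 4)) * X^2
      + C (x 0 * x 1 * x 2 * x 3 + x 0 * x 1 * x 2 * x 4 + x 0 * x 1 * x 3 * x 4 + x 0 * x 2 * x 3 * x 4
        + x 1 * x 2 * x 3 * x 4) * X
      + C (-(x 0 * x 1 * x 2 * x 3 * x 4)) := by
    rw [Fin.prod_univ_five]
    simp only [map_add, map_mul, map_neg]
    ring
  have hc : ∀ i, ((P.coeff i : ℤ) : ℝ) = (∏ a, (X - C (x a))).coeff i := fun i => by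
    rw [← hP, coeff_map]; simp
  rw [hexp] at hc
  obtain ⟨i4, i3, i2, i1, i0⟩ := coeff5 (-(x 0 + x 1 + x 2 + x 3 + x 4))
      (x 0 * x 1 + x 0 * x 2 + x 0 * x 3 + x 0 * x 4 + x 1 * x 2 + x 1 * x 3 + x 1 * x 4
        + x 2 * x 3 + x 2 * x 4 + x 3 * x 4)
      (-(x 0 * x 1 * x 2 + x 0 * x 1 * x 3 + x 0 * x 1 * x 4 + x 0 * x 2 * x 3 + x 0 * x 2 * x 4
        + x 0 * x 3 * x 4 + x 1 * x 2 * x 3 + x 1 * x 2 * x 4 + x 1 * x 3 * x 4 + x 2 * x 3 * x 4))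
      (x 0 * x 1 * x 2 * x 3 + x 0 * x 1 * x 2 * x 4 + x 0 * x 1 * x 3 * x 4 + x 0 * x 2 * x 3 * x 4
        + x 1 * x 2 * x 3 * x 4) (-(x 0 * x 1 * x 2 * x 3 * x 4))
  have c4 := (hc 4).trans i4
  have c3 := (hc 3).trans i3
  have c2 := (hc 2).trans i2
  have c1 := (hc 1).trans i1
  have c0 := (hc 0).trans i0
  clear i4 i3 i2 i1 i0 hc hexp
  have hroot : ∀ a, x a ^ 5 - (-P.coeff 4 : ℤ) * x a ^ 4 + (P.coeff 3 : ℤ) * x a ^ 3 - (-P.coeff 2 : ℤ) * x a ^ 2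
      + (P.coeff 1 : ℤ) * x a - (-P.coeff 0 : ℤ) = 0 := by
    intro a
    push_cast
    rw [c4, c3, c2, c1, c0]
    have ha : a = 0 ∨ a = 1 ∨ a = 2 ∨ a = 3 ∨ a = 4 := by revert a; decide
    rcases ha with h | h | h | h | h <;> subst h
    all_goals ring
  refine ⟨-P.coeff 4, P.coeff 3, -P.coeff 2, P.coeff 1, -P.coeff 0, ?_, ?_, ?_, ?_, ?_, ?_, ?_, hroot, ?_⟩
  · have h : ((p 0 : ℤ) : ℝ) = ((5:ℤ):ℝ) := by rw [hp]; simp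
    exact Int.cast_injective h
  · have := hp 1
    rw [Fin.sum_univ_five] at this
    have h : (p 1 : ℝ) = ((-P.coeff 4 : ℤ) : ℝ) := by rw [this]; push_cast; rw [c4]; ring
    exact_mod_cast h
  · have := hp 2
    rw [Fin.sum_univ_five] at this
    have h : (p 2 : ℝ) = (((-P.coeff 4)^2 - 2 * P.coeff 3 : ℤ) : ℝ) := by rw [this]; push_cast; rw [c4, c3]; ring
    exact_mod_cast h
  · have := hp 3
    rw [Fin.sum_univ_five] at this
    have h : (p 3 : ℝ) = (((-P.coeff 4)^3 - 3 * (-P.coeff 4) * P.coeff 3 + 3 * (-P.coeff 2) : ℤ) : ℝ) := by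
      rw [this]; push_cast; rw [c4, c3, c2]; ring
    exact_mod_cast h
  · have := hp 4
    rw [Fin.sum_univ_five] at this
    have h : (p 4 : ℝ) = (((-P.coeff 4)^4 - 4 * (-P.coeff 4)^2 * P.coeff 3 + 2 * (P.coeff 3)^2
        + 4 * (-P.coeff 4) * (-P.coeff 2) - 4 * P.coeff 1 : ℤ) : ℝ) := by
      rw [this]; push_cast; rw [c4, c3, c2, c1]; ring
    exact_mod_cast h
  · intro i
    have h : (p (i+5) : ℝ) = (((-P.coeff 4) * p (i+4) - P.coeff 3 * p (i+3) + (-P.coeff 2) * p (i+2)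
        - P.coeff 1 * p (i+1) + (-P.coeff 0) * p i : ℤ) : ℝ) := by
      push_cast
      simp only [hp, Finset.mul_sum]
      rw [← Finset.sum_sub_distrib, ← Finset.sum_add_distrib, ← Finset.sum_sub_distrib, ← Finset.sum_add_distrib]
      refine Finset.sum_congr rfl fun a _ => ?_
      have := hroot a
      push_cast at this
      linear_combination (x a ^ i) * this
    exact_mod_cast h
  · rw [Fin.prod_univ_five]; push_cast; rw [c0]; ring
  · intro m hm
    have h1 : (∏ a, ((m:ℝ) - x a)) = 0 := by
      rw [Fin.prod_univ_five]
      have h2 : ((m^5 - (-P.coeff 4) * m^4 + P.coeff 3 * m^3 - (-P.coeff 2) * m^2 + P.coeff 1 * m - (-P.coeff 0) : ℤ):ℝ) = 0 := by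
        rw [hm]; simp
      push_cast at h2
      rw [c4, c3, c2, c1, c0] at h2
      linear_combination h2
    obtain ⟨a, _, ha⟩ := Finset.prod_eq_zero_iff.1 h1
    exact ⟨a, by linarith⟩

lemma psum_bounds (x : Fin 5 → ℝ) :
    (∑ a, x a ^ 4) ≤ (∑ a, x a ^ 2)^2 ∧ (∑ a, x a ^ 3)^2 ≤ (∑ a, x a ^ 2)^3 ∧
    3125 * (∏ a, x a)^2 ≤ (∑ a, x a ^ 2)^5 := by
  have h1 : (∑ a, x a ^ 4) ≤ (∑ a, x a ^ 2)^2 := by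
    rw [pow_two (∑ a, x a ^ 2), Finset.sum_mul]
    refine Finset.sum_le_sum fun a _ => ?_
    have h : x a ^ 2 ≤ ∑ b, x b ^ 2 :=
      Finset.single_le_sum (f := fun b => x b ^ 2) (fun _ _ => sq_nonneg _) (Finset.mem_univ a)
    calc x a ^ 4 = x a ^ 2 * x a ^ 2 := by ring
      _ ≤ _ := mul_le_mul_of_nonneg_left h (sq_nonneg _)
  have h0 : 0 ≤ ∑ a, x a ^ 2 := Finset.sum_nonneg fun _ _ => sq_nonneg _
  refine ⟨h1, ?_, ?_⟩
  · have h2 := Finset.sum_mul_sq_le_sq_mul_sq Finset.univ x (fun a => x a ^ 2)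
    have h3 : (∑ a, x a ^ 3) = ∑ a, x a * x a ^ 2 := Finset.sum_congr rfl fun a _ => by ring
    have h4 : (∑ a, x a ^ 4) = ∑ a, (x a ^ 2)^2 := Finset.sum_congr rfl fun a _ => by ring
    rw [h3]
    rw [h4] at h1
    calc _ ≤ _ := h2
      _ ≤ (∑ a, x a ^ 2) * (∑ a, x a ^ 2)^2 := mul_le_mul_of_nonneg_left h1 h0
      _ = _ := by ring
  · have h2 := Real.geom_mean_le_arith_mean_weighted Finset.univ (fun _ => (1/5:ℝ)) (fun a => x a ^ 2)
      (fun _ _ => by norm_num) (by simp) (fun _ _ => sq_nonneg _)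
    rw [Real.finsetProd_rpow _ _ (fun _ _ => sq_nonneg _), ← Finset.mul_sum, Finset.prod_pow] at h2
    have h3 : (0:ℝ) ≤ (∏ a, x a)^2 := sq_nonneg _
    have h4 := pow_le_pow_left₀ (Real.rpow_nonneg h3 _) h2 5
    rw [← Real.rpow_natCast, ← Real.rpow_mul h3] at h4
    norm_num at h4
    nlinarith
end TR
end

section
namespace TR
open NumberField Matrix Polynomial IntermediateField

/-- test of all possible indices -/
def goF (h LB : ℕ) : ℕ → ℕ → Bool
  | 0, _ => false
  | n+1, f => fN f fun f => fN (f*f) fun s =>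
      if h < LB * s then true else
        (if h % s = 0 then (if h / s < LB then true else if h / s < 14641 then false else true) else true) &&
          goF h LB n (f+1)

lemma goF_spec (h LB : ℕ) : ∀ (n f : ℕ), goF h LB n f = true → 0 < f → ∀ g D : ℕ, f ≤ g → h = g*g*D →
    LB ≤ D → D < 14641 → False
  | 0, f, hf, _, _, _, _, _, _, _ => by simp [goF] at hf
  | n+1, f, hf, h0, g, D, hg, hh, hL, hD => by
    rw [goF, fN_eq, fN_eq] at hf
    split_ifs at hf with h1 h2 h3 h4
    · have : f * f ≤ g * g := Nat.mul_le_mul hg hg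
      have := Nat.mul_le_mul this hL
      rw [← hh] at this
      linarith [mul_comm LB (f*f)]
    · rcases hg.eq_or_lt with rfl | hlt
      · rw [hh, Nat.mul_div_cancel_left _ (by positivity)] at h3
        omega
      · exact goF_spec h LB n (f+1) (by simpa using hf) (by omega) g D hlt hh hL hD
    · simp at hf
    · rcases hg.eq_or_lt with rfl | hlt
      · rw [hh, Nat.mul_div_cancel_left _ (by positivity)] at h4
        omega
      · exact goF_spec h LB n (f+1) (by simpa using hf) (by omega) g D hlt hh hL hD
    · rcases hg.eq_or_lt with rfl | hlt
      · exact absurd (by rw [hh, Nat.mul_mod_right]) h2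
      · exact goF_spec h LB n (f+1) (by simpa using hf) (by omega) g D hlt hh hL hD

/-- bounded loop -/
def allR (P : ℤ → Bool) : ℕ → ℤ → Bool
  | 0, _ => true
  | n+1, z => fZ z fun z => P z && allR P n (z+1)

lemma allR_spec (P : ℤ → Bool) : ∀ (n : ℕ) (z : ℤ), allR P n z = true → ∀ w, z ≤ w → w < z + n → P w = true
  | 0, z, _, w, h1, h2 => by simp at h2; omega
  | n+1, z, h, w, h1, h2 => by
    rw [allR, fZ_eq, Bool.and_eq_true] at h
    rcases h1.eq_or_lt with rfl | hlt
    · exact h.1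
    · exact allR_spec P n (z+1) h.2 w (by omega) (by push_cast at h2; omega)

/-- innermost test -/
def inner5 (LB : ℕ) (e1 e2 e3 e4 e5 p2 p3 p4 : ℤ) : Bool :=
  fZ (e1*p4-e2*p3+e3*p2-e4*e1+e5*5) fun p5 =>
  fZ (e1*p5-e2*p4+e3*p3-e4*p2+e5*e1) fun p6 =>
  if hk4 5 e1 p2 p3 p4 p5 p6 ≤ 0 then true else
  fZ (e1*p6-e2*p5+e3*p4-e4*p3+e5*p2) fun p7 =>
  fZ (e1*p7-e2*p6+e3*p5-e4*p4+e5*p3) fun p8 =>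
  fZ (hk5 5 e1 p2 p3 p4 p5 p6 p7 p8) fun h =>
  if h ≤ 0 then true else
  if 1 - e1 + e2 - e3 + e4 - e5 = 0 then true else
  if -1 - e1 - e2 - e3 - e4 - e5 = 0 then true else
  if 32 - 16*e1 + 8*e2 - 4*e3 + 2*e4 - e5 = 0 then true else
  goF h.toNat LB 300 1

/-- test of a family -/
def fam (LB : ℕ) (e1 e2 : ℤ) : Bool :=
  fZ (e1*e1-2*e2) fun p2 =>
  allR (fun e3 => fZ (e1*e1*e1-3*e1*e2+3*e3) fun p3 =>
    if p2*p2*p2 < p3*p3 then true else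
    allR (fun t => fZ (e1*e1*e1*e1-4*e1*e1*e2+2*e2*e2+4*t) fun p4 =>
      if p4 < 0 then true else if p2*p2 < p4 then true else
      if hk3 5 e1 p2 p3 p4 ≤ 0 then true else
      fZ (e1*e3-t) fun e4 =>
      allR (fun e5 => if e5 = 0 then true else if p2*p2*p2*p2*p2 < 3125*(e5*e5) then true else
        inner5 LB e1 e2 e3 e4 e5 p2 p3 p4) 15 (-7)) 51 (-25)) 51 (-25)

set_option maxRecDepth 100000
lemma fam_0_6 : fam 1154 0 (-3) = true := by decide +kernel
lemma fam_0_8 : fam 3645 0 (-4) = true := by decide +kernel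
lemma fam_0_10 : fam 8899 0 (-5) = true := by decide +kernel
lemma fam_1_5 : fam 473 1 (-2) = true := by decide +kernel
lemma fam_1_7 : fam 1903 1 (-3) = true := by decide +kernel
lemma fam_1_9 : fam 5337 1 (-4) = true := by decide +kernel
lemma fam_1_11 : fam 12107 1 (-5) = true := by decide +kernel
lemma fam_2_6 : fam 651 2 (-1) = true := by decide +kernel
lemma fam_2_8 : fam 2392 2 (-2) = true := by decide +kernel
lemma fam_2_10 : fam 6376 2 (-3) = true := by decide +kernel

lemma inner5_spec {LB : ℕ} {e1 e2 e3 e4 e5 : ℤ} {p : ℕ → ℤ} (h0 : p 0 = 5) (h1 : p 1 = e1)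
    (hrec : ∀ i, p (i+5) = e1 * p (i+4) - e2 * p (i+3) + e3 * p (i+2) - e4 * p (i+1) + e5 * p i)
    (k4 : 0 < hk4 (p 0) (p 1) (p 2) (p 3) (p 4) (p 5) (p 6))
    (k5 : 0 < hk5 (p 0) (p 1) (p 2) (p 3) (p 4) (p 5) (p 6) (p 7) (p 8))
    (hm : ∀ m : ℤ, m^5 - e1 * m^4 + e2 * m^3 - e3 * m^2 + e4 * m - e5 ≠ 0)
    {f D : ℤ} (hD : hk5 (p 0) (p 1) (p 2) (p 3) (p 4) (p 5) (p 6) (p 7) (p 8) = f^2 * D)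
    (hL : (LB : ℤ) ≤ D) (hD0 : 0 < D) (hDu : D < 14641)
    (h : inner5 LB e1 e2 e3 e4 e5 (p 2) (p 3) (p 4) = true) : False := by
  simp only [inner5, fZ_eq] at h
  have h5 := hrec 0
  have h6 := hrec 1
  have h7 := hrec 2
  have h8 := hrec 3
  simp only [Nat.reduceAdd, zero_add, h0, h1] at h5 h6 h7 h8
  rw [h0, h1] at k4 k5 hD
  rw [← h5, ← h6, ← h7, ← h8] at h
  rw [if_neg (not_le.2 k4), if_neg (not_le.2 k5)] at h
  have m1 := hm 1
  have m2 := hm (-1)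
  have m3 := hm 2
  rw [if_neg (fun hh => m1 (by linear_combination hh)), if_neg (fun hh => m2 (by linear_combination hh)),
    if_neg (fun hh => m3 (by linear_combination hh))] at h
  have hf : f ≠ 0 := by rintro rfl; simp at hD; omega
  refine goF_spec _ LB 300 1 h one_pos f.natAbs D.toNat (Int.natAbs_pos.2 hf) ?_ (by omega) (by omega)
  zify
  rw [Int.toNat_of_nonneg k5.le, Int.toNat_of_nonneg hD0.le, hD, ← sq, sq_abs]

lemma fam_spec {LB : ℕ} {e1 e2 e3 e4 e5 : ℤ} {p : ℕ → ℤ} (h0 : p 0 = 5) (h1 : p 1 = e1)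
    (h2 : p 2 = e1^2 - 2*e2) (h3 : p 3 = e1^3 - 3*e1*e2 + 3*e3)
    (h4 : p 4 = e1^4 - 4*e1^2*e2 + 2*e2^2 + 4*e1*e3 - 4*e4)
    (hrec : ∀ i, p (i+5) = e1 * p (i+4) - e2 * p (i+3) + e3 * p (i+2) - e4 * p (i+1) + e5 * p i)
    (k3 : 0 < hk3 (p 0) (p 1) (p 2) (p 3) (p 4))
    (k4 : 0 < hk4 (p 0) (p 1) (p 2) (p 3) (p 4) (p 5) (p 6))
    (k5 : 0 < hk5 (p 0) (p 1) (p 2) (p 3) (p 4) (p 5) (p 6) (p 7) (p 8))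
    (hm : ∀ m : ℤ, m^5 - e1 * m^4 + e2 * m^3 - e3 * m^2 + e4 * m - e5 ≠ 0)
    {f D : ℤ} (hD : hk5 (p 0) (p 1) (p 2) (p 3) (p 4) (p 5) (p 6) (p 7) (p 8) = f^2 * D)
    (hL : (LB : ℤ) ≤ D) (hD0 : 0 < D) (hDu : D < 14641)
    (b4 : 0 ≤ p 4) (b4' : p 4 ≤ p 2 ^ 2) (b3 : p 3 ^ 2 ≤ p 2 ^ 3) (b5 : 3125 * e5^2 ≤ p 2 ^ 5)
    (r3 : -25 ≤ e3 ∧ e3 < -25 + (51:ℕ)) (r4 : -25 ≤ e1*e3-e4 ∧ e1*e3-e4 < -25 + (51:ℕ))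
    (r5 : -7 ≤ e5 ∧ e5 < -7 + (15:ℕ))
    (h : fam LB e1 e2 = true) : False := by
  simp only [fam, fZ_eq] at h
  have i3 := allR_spec _ _ _ h e3 r3.1 r3.2
  have q2 : e1*e1-2*e2 = p 2 := by rw [h2]; ring
  have q3 : e1*e1*e1-3*e1*e2+3*e3 = p 3 := by rw [h3]; ring
  rw [q2] at i3
  simp only [q3] at i3
  rw [if_neg (by nlinarith)] at i3
  have i4 := allR_spec _ _ _ i3 (e1*e3-e4) r4.1 r4.2
  have q4 : e1*e1*e1*e1-4*e1*e1*e2+2*e2*e2+4*(e1*e3-e4) = p 4 := by rw [h4]; ring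
  have q5 : e1*e3-(e1*e3-e4) = e4 := by ring
  simp only [q4, q5] at i4
  rw [if_neg (by linarith), if_neg (by nlinarith), if_neg (by rw [h0, h1] at k3; exact not_le.2 k3)] at i4
  have i5 := allR_spec _ _ _ i4 e5 r5.1 r5.2
  have e50 : e5 ≠ 0 := by have := hm 0; intro hh; apply this; rw [hh]; ring
  rw [if_neg e50, if_neg (by rw [not_lt]; calc 3125*(e5*e5) = 3125*e5^2 := by ring
                                  _ ≤ _ := b5
                                  _ = _ := by ring)] at i5
  exact inner5_spec h0 h1 hrec k4 k5 hm hD hL hD0 hDu i5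

lemma abs_of_sq {z B : ℤ} (hB : 0 ≤ B) (h : z^2 < (B+1)^2) : -B ≤ z ∧ z ≤ B := by
  have := abs_lt_of_sq_lt_sq h (by omega)
  rw [abs_lt] at this
  omega

lemma arith5 {a q b D : ℤ} (ha : 0 < a) (hq : a ≤ q) (hb : 2*|b| ≤ a)
    (h : 27 * (a*q-b^2)^3 ≤ 8000 * D * a^2) : 729 * a^4 ≤ 512000 * D := by
  have hb2 : 4 * b^2 ≤ a^2 := by
    have := pow_le_pow_left₀ (by positivity) hb 2
    rw [mul_pow, sq_abs] at this
    linarith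
  have h1 : 3 * a^2 ≤ 4 * (a*q-b^2) := by nlinarith
  have h2 := pow_le_pow_left₀ (by positivity) h1 3
  have h3 : (729 * a^4) * a^2 ≤ (512000 * D) * a^2 := by nlinarith
  exact le_of_mul_le_mul_right h3 (by positivity)

lemma case56 {a q b D t v s : ℤ} (ha : a = 56) (hq : a ≤ q) (hb : 2*|b| ≤ a)
    (h : 27 * (a*q-b^2)^3 ≤ 8000 * D * a^2) (hD : D < 14641) (hv : q = 5*s - v*v) (hbv : b = 5*t - 2*v) :
    False := by
  subst ha
  have h1 : 56*q-b^2 ≤ 2387 := by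
    by_contra hc
    push Not at hc
    have := pow_le_pow_left₀ (by norm_num) (show (2388:ℤ) ≤ 56*q-b^2 by omega) 3
    nlinarith
  have hb' : |b| ≤ 28 := by omega
  rw [abs_le] at hb'
  have h2 : b^2 ≤ 784 := by nlinarith
  have h3 : q = 56 := by omega
  subst h3
  have h4 : 749 ≤ b^2 := by omega
  have h5 : b = 28 ∨ b = -28 := by
    by_contra hc
    have : b^2 ≤ 729 := by
      have : -27 ≤ b ∧ b ≤ 27 := by omega
      nlinarith
    omega
  have hv5 : v % 5 = 0 ∨ v % 5 = 1 ∨ v % 5 = 2 ∨ v % 5 = 3 ∨ v % 5 = 4 := by omega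
  have hvv : (v*v) % 5 = 4 := by omega
  rw [Int.mul_emod] at hvv
  rcases hv5 with hh | hh | hh | hh | hh <;> rw [hh] at hvv <;> omega

theorem main_five (k : Type*) [Field k] [NumberField k]
    (hreal : ∀ v : InfinitePlace k, v.IsReal) (h5 : Module.finrank ℚ k = 5) :
    (14641 : ℤ) ≤ discr k := by
  by_contra hcon
  push Not at hcon
  obtain ⟨ρ, ht, -⟩ := exists_rho k hreal 5 h5
  obtain ⟨ω, -⟩ := exists_basis_one k 4 h5
  obtain ⟨α, β, ha, haq, hb, hh, hT1⟩ := small_norm hreal h5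
  have hD0 : 0 < discr k := by
    have h1 := det_BM ht ω
    have h2 := det_BM_ne ht ω
    have : (0:ℝ) < (discr k : ℝ) := by rw [← h1]; positivity
    exact_mod_cast this
  have hg := gen_top h5 ht α ha
  have hinj := x_inj ht ω α hg
  obtain ⟨P, hP⟩ := esymm_data h5 α hg hinj
  obtain ⟨f, hf⟩ := disc_data ht ω α
  obtain ⟨p, hpd⟩ : ∃ p : ℕ → ℤ, ∀ i, p i = tr (α ^ i) := ⟨_, fun _ => rfl⟩
  have hp : ∀ i, (p i : ℝ) = ∑ a, (ρ a (α : k)) ^ i := fun i => by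
    rw [hpd, tr_eq ht]
    exact Finset.sum_congr rfl fun a _ => by rw [← map_pow]; rfl
  obtain ⟨e1, e2, e3, e4, e5, h0, h1, h2, h3, h4, hrec, he5, -, hroot⟩ := newton _ p hp P hP
  obtain ⟨k3, k4, k5, hk⟩ := hankel_facts _ hinj p hp
  have hD : hk5 (p 0) (p 1) (p 2) (p 3) (p 4) (p 5) (p 6) (p 7) (p 8) = f^2 * discr k := by
    have := hk.trans hf
    exact_mod_cast this
  have hm : ∀ m : ℤ, m^5 - e1 * m^4 + e2 * m^3 - e3 * m^2 + e4 * m - e5 ≠ 0 := by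
    intro m hm
    obtain ⟨a, hxa⟩ := hroot m hm
    have hα : (α : k) = (m : k) := (ρ a).injective (by rw [hxa]; simp)
    have : (0 : Fin 5) = 1 := hinj (by simp only [hα]; simp)
    exact absurd this (by decide)
  have e50 : e5 ≠ 0 := by have := hm 0; intro hh; apply this; rw [hh]; ring
  obtain ⟨c4, c3, c5⟩ := psum_bounds (fun a => ρ a (α : k))
  rw [← he5] at c5
  simp only [← hp] at c4 c3 c5
  have b4' : p 4 ≤ p 2 ^ 2 := by exact_mod_cast c4
  have b3 : p 3 ^ 2 ≤ p 2 ^ 3 := by exact_mod_cast c3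
  have b5 : 3125 * e5^2 ≤ p 2 ^ 5 := by exact_mod_cast c5
  have b4 : 0 ≤ p 4 := by
    have : (0:ℝ) ≤ p 4 := by
      rw [hp]; exact Finset.sum_nonneg fun a _ => by positivity
    exact_mod_cast this
  have hLB := arith5 ha haq hb hh
  have hT : tr α = e1 := by rw [← h1, hpd, pow_one]
  have hqa : qb α α = 5 * p 2 - e1^2 := by
    rw [qb, hT, hpd, pow_two, pow_two]
  have ha56 : qb α α ≤ 56 := by
    by_contra hc
    push Not at hc
    have := pow_le_pow_left₀ (by norm_num) (show (57:ℤ) ≤ qb α α by omega) 4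
    omega
  have hp2 : 5 ≤ p 2 := by
    by_contra hc
    push Not at hc
    have h6 : 0 ≤ p 2 := by
      have := sq_nonneg e1
      omega
    have := pow_le_pow_left₀ h6 (show p 2 ≤ 4 by omega) 5
    have : 1 ≤ e5^2 := by have := sq_pos_of_ne_zero e50; omega
    omega
  rw [hT] at hT1
  by_cases h56 : qb α α = 56
  · have : e1 = 2 := by
      rcases hT1 with hh | hh | hh
      · rw [hh] at hqa; omega
      · rw [hh] at hqa; omega
      · exact hh
    refine case56 (t := tr (α*β)) (v := tr β) (s := tr (β*β)) h56 haq hb hh hcon rfl ?_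
    rw [qb, hT, this]
  have ha55 : qb α α ≤ 55 := by omega
  have fin : ∀ (LB : ℕ), 729 * (qb α α)^4 > 512000 * ((LB:ℤ) - 1) → p 2 ≤ 11 → (e1^3-3*e1*e2 ≤ 26 ∧ 0 ≤ e1^3-3*e1*e2) →
      (p 2 ^ 2 ≤ 100 + (e1^4 - 4*e1^2*e2 + 2*e2^2) ∧ e1^4 - 4*e1^2*e2 + 2*e2^2 ≤ 100) → fam LB e1 e2 = true → False := by
    intro LB hl hp11 hc3 hc4 hfam
    have hL : (LB:ℤ) ≤ discr k := by omega
    have u2 := pow_le_pow_left₀ (by omega) hp11 2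
    have u3 := pow_le_pow_left₀ (by omega) hp11 3
    have u5 := pow_le_pow_left₀ (by omega) hp11 5
    have r3 := abs_of_sq (z := p 3) (B := 36) (by norm_num) (by omega)
    have r5 := abs_of_sq (z := e5) (B := 7) (by norm_num) (by omega)
    have h4' : p 4 = (e1^4 - 4*e1^2*e2 + 2*e2^2) + 4 * (e1*e3-e4) := by rw [h4]; ring
    exact fam_spec h0 h1 h2 h3 h4 hrec k3 k4 k5 hm hD hL hD0 hcon b4 b4' b3 b5
      (by push_cast; omega) (by push_cast; omega) (by push_cast; omega) hfam
  rcases hT1 with rfl | rfl | rfl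
  · have : e2 = -3 ∨ e2 = -4 ∨ e2 = -5 := by omega
    rcases this with rfl | rfl | rfl
    · have hp2' : p 2 = 6 := by rw [h2]; norm_num
      exact fin 1154 (by rw [hqa, hp2']; norm_num) (by omega) (by norm_num) (by rw [hp2']; norm_num) fam_0_6
    · have hp2' : p 2 = 8 := by rw [h2]; norm_num
      exact fin 3645 (by rw [hqa, hp2']; norm_num) (by omega) (by norm_num) (by rw [hp2']; norm_num) fam_0_8
    · have hp2' : p 2 = 10 := by rw [h2]; norm_num
      exact fin 8899 (by rw [hqa, hp2']; norm_num) (by omega) (by norm_num) (by rw [hp2']; norm_num) fam_0_10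
  · have : e2 = -2 ∨ e2 = -3 ∨ e2 = -4 ∨ e2 = -5 := by omega
    rcases this with rfl | rfl | rfl | rfl
    · have hp2' : p 2 = 5 := by rw [h2]; norm_num
      exact fin 473 (by rw [hqa, hp2']; norm_num) (by omega) (by norm_num) (by rw [hp2']; norm_num) fam_1_5
    · have hp2' : p 2 = 7 := by rw [h2]; norm_num
      exact fin 1903 (by rw [hqa, hp2']; norm_num) (by omega) (by norm_num) (by rw [hp2']; norm_num) fam_1_7
    · have hp2' : p 2 = 9 := by rw [h2]; norm_num
      exact fin 5337 (by rw [hqa, hp2']; norm_num) (by omega) (by norm_num) (by rw [hp2']; norm_num) fam_1_9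
    · have hp2' : p 2 = 11 := by rw [h2]; norm_num
      exact fin 12107 (by rw [hqa, hp2']; norm_num) (by omega) (by norm_num) (by rw [hp2']; norm_num) fam_1_11
  · have : e2 = -1 ∨ e2 = -2 ∨ e2 = -3 := by omega
    rcases this with rfl | rfl | rfl
    · have hp2' : p 2 = 6 := by rw [h2]; norm_num
      exact fin 651 (by rw [hqa, hp2']; norm_num) (by omega) (by norm_num) (by rw [hp2']; norm_num) fam_2_6
    · have hp2' : p 2 = 8 := by rw [h2]; norm_num
      exact fin 2392 (by rw [hqa, hp2']; norm_num) (by omega) (by norm_num) (by rw [hp2']; norm_num) fam_2_8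
    · have hp2' : p 2 = 10 := by rw [h2]; norm_num
      exact fin 6376 (by rw [hqa, hp2']; norm_num) (by omega) (by norm_num) (by rw [hp2']; norm_num) fam_2_10
end TR
end

open NumberField

/-- Let `k` be a totally real number field of degree `d ≥ 5` over `ℚ`.
Then the absolute value `D_k` of the discriminant of `k` satisfies `D_k^{1/d} ≥ 14641^{1/5}`,
equivalently `D_k⁵ ≥ 14641^d`. -/
theorem stmt_7 (k : Type*) [Field k] [NumberField k]
    (hreal : ∀ v : InfinitePlace k, v.IsReal)
    (d : ℕ) (hd : Module.finrank ℚ k = d) (hd5 : 5 ≤ d) :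
    (14641 : ℤ) ^ d ≤ |NumberField.discr k| ^ 5 := by
  rcases hd5.eq_or_lt with h | h
  · subst h
    have h1 := TR.main_five k hreal hd
    exact pow_le_pow_left₀ (by norm_num) (h1.trans (le_abs_self _)) 5
  · exact TR.main_ge_six k hreal d hd h
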